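/- Let N ≥ 3, 0 < R₁ < R₂, 1 < p < (N+2)/(N−2) and λ > 0. Then there exists a sign-changing function ṽ_λ ∈ C²(D) ∩ C¹(D̄) with ṽ_λ = 0 on ∂D, solving −Δṽ_λ = (|ṽ_λ|^{p−1}ṽ_λ − λ ṽ_λ)/(2|z|) in D, such that both the positive part ṽ_λ⁺ and the negative part ṽ_λ⁻ are not identically zero and each satisfies the Nehari identity, J_λ(ṽ_λ) ≤ J_λ(w) for every w in the nodal Nehari set N_λ⁺, and moreover the open set {z ∈ D : ṽ_λ(z) ≠ 0} has exactly two connected components. -/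

import Mathlib

noncomputable section
open Real MeasureTheory Filter

/-- The Euclidean Laplacian on `ℝ^N`. -/
def lapE {N : ℕ} (f : EuclideanSpace ℝ (Fin N) → ℝ) (z : EuclideanSpace ℝ (Fin N)) : ℝ :=
  ∑ i : Fin N,
    fderiv ℝ (fun y => fderiv ℝ f y (EuclideanSpace.single i (1 : ℝ))) z
      (EuclideanSpace.single i (1 : ℝ))

/-- The annulus `D = {R₁ < |z| < R₂}` in `ℝ^N`. -/
def DSet (N : ℕ) (R₁ R₂ : ℝ) : Set (EuclideanSpace ℝ (Fin N)) := {z | R₁ < ‖z‖ ∧ ‖z‖ < R₂}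

/-- The energy functional
`J_λ(v) = ∫_D ( |∇v|²/2 + λ v²/(4|z|) − |v|^{p+1}/(2(p+1)|z|) ) dz`. -/
def Jfun (N : ℕ) (R₁ R₂ lam p : ℝ) (v : EuclideanSpace ℝ (Fin N) → ℝ) : ℝ :=
  ∫ z in DSet N R₁ R₂,
    (‖fderiv ℝ v z‖ ^ 2 / 2 + lam * v z ^ 2 / (4 * ‖z‖)
      - |v z| ^ (p + 1) / (2 * (p + 1) * ‖z‖))

/-- The Nehari identity `∫_D |∇w|² dz + λ ∫_D w²/(2|z|) dz = ∫_D |w|^{p+1}/(2|z|) dz`. -/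
def NehariId (N : ℕ) (R₁ R₂ lam p : ℝ) (w : EuclideanSpace ℝ (Fin N) → ℝ) : Prop :=
  (∫ z in DSet N R₁ R₂, ‖fderiv ℝ w z‖ ^ 2)
      + lam * ∫ z in DSet N R₁ R₂, w z ^ 2 / (2 * ‖z‖)
    = ∫ z in DSet N R₁ R₂, |w z| ^ (p + 1) / (2 * ‖z‖)

/-- The Nehari set: Lipschitz functions on `D̄` vanishing on `∂D`, not identically zero,
satisfying the Nehari identity. -/
def Nehari (N : ℕ) (R₁ R₂ lam p : ℝ) : Set (EuclideanSpace ℝ (Fin N) → ℝ) :=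
  {v | (∃ K, LipschitzOnWith K v (closure (DSet N R₁ R₂))) ∧
    (∀ z ∈ frontier (DSet N R₁ R₂), v z = 0) ∧
    (∃ z ∈ closure (DSet N R₁ R₂), v z ≠ 0) ∧ NehariId N R₁ R₂ lam p v}

/-- The nodal Nehari set: Lipschitz functions on `D̄` vanishing on `∂D` whose positive and
negative parts are both nontrivial and both satisfy the Nehari identity. -/
def NodalNehari (N : ℕ) (R₁ R₂ lam p : ℝ) : Set (EuclideanSpace ℝ (Fin N) → ℝ) :=
  {v | (∃ K, LipschitzOnWith K v (closure (DSet N R₁ R₂))) ∧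
    (∀ z ∈ frontier (DSet N R₁ R₂), v z = 0) ∧
    (∃ z ∈ closure (DSet N R₁ R₂), 0 < v z) ∧
    (∃ z ∈ closure (DSet N R₁ R₂), v z < 0) ∧
    NehariId N R₁ R₂ lam p (fun z => max (v z) 0) ∧
    NehariId N R₁ R₂ lam p (fun z => max (-v z) 0)}


abbrev EE (N : ℕ) : Type := EuclideanSpace ℝ (Fin N)


section IsWsec
open scoped ENNReal NNReal Topology
variable {N : ℕ} {D : Set (EE N)}

/-- test functions -/
def TF (D : Set (EE N)) (φ : EE N → ℝ) : Prop :=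
  ContDiff ℝ 1 φ ∧ HasCompactSupport φ ∧ tsupport φ ⊆ D

/-- the Sobolev space `H^1_0(D)`, as pairs (function, gradient) -/
def IsW (D : Set (EE N)) (u : EE N → ℝ) (g : EE N → EE N) : Prop :=
  MemLp u 2 (volume.restrict D) ∧ MemLp g 2 (volume.restrict D) ∧
  ∀ ε : ℝ≥0∞, ε ≠ 0 → ∃ φ, TF D φ ∧ eLpNorm (u - φ) 2 (volume.restrict D) ≤ ε ∧
    eLpNorm (g - gradient φ) 2 (volume.restrict D) ≤ ε

lemma gradient_add' {φ ψ : EE N → ℝ} {z : EE N} (h1 : DifferentiableAt ℝ φ z)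
    (h2 : DifferentiableAt ℝ ψ z) : gradient (φ + ψ) z = gradient φ z + gradient ψ z := by
  simp [gradient, fderiv_add h1 h2]

lemma gradient_smul' {φ : EE N → ℝ} {z : EE N} (c : ℝ) (h1 : DifferentiableAt ℝ φ z) :
    gradient (c • φ) z = c • gradient φ z := by
  simp [gradient, fderiv_const_smul h1 c]

lemma norm_gradient' (φ : EE N → ℝ) (z : EE N) : ‖gradient φ z‖ = ‖fderiv ℝ φ z‖ := by
  simp [gradient]

lemma inner_gradient' (φ : EE N → ℝ) (z e : EE N) : inner ℝ (gradient φ z) e = fderiv ℝ φ z e := by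
  simp [gradient]

lemma continuous_gradient' {φ : EE N → ℝ} (h : ContDiff ℝ 1 φ) : Continuous (gradient φ) := by
  unfold gradient
  exact (LinearIsometryEquiv.continuous _).comp (h.continuous_fderiv one_ne_zero)

lemma hcs_gradient {φ : EE N → ℝ} (h : HasCompactSupport φ) : HasCompactSupport (gradient φ) := by
  have := h.fderiv (𝕜 := ℝ)
  unfold gradient
  exact this.comp_left (g := (InnerProductSpace.toDual ℝ (EE N)).symm) (by simp)

lemma TF.contDiff {φ : EE N → ℝ} (h : TF D φ) : ContDiff ℝ 1 φ := h.1
lemma TF.diff {φ : EE N → ℝ} (h : TF D φ) (z) : DifferentiableAt ℝ φ z :=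
  h.1.differentiable one_ne_zero z

lemma TF.memLp {φ : EE N → ℝ} (h : TF D φ) (q : ℝ≥0∞) : MemLp φ q (volume.restrict D) :=
  (h.1.continuous.memLp_of_hasCompactSupport h.2.1).restrict D

lemma TF.memLp_grad {φ : EE N → ℝ} (h : TF D φ) (q : ℝ≥0∞) :
    MemLp (gradient φ) q (volume.restrict D) :=
  ((continuous_gradient' h.1).memLp_of_hasCompactSupport (hcs_gradient h.2.1)).restrict D

lemma TF.add {φ ψ : EE N → ℝ} (h : TF D φ) (h' : TF D ψ) : TF D (φ + ψ) :=
  ⟨h.1.add h'.1, h.2.1.add h'.2.1, (tsupport_add φ ψ).trans (Set.union_subset h.2.2 h'.2.2)⟩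

lemma TF.smul {φ : EE N → ℝ} (c : ℝ) (h : TF D φ) : TF D (c • φ) :=
  ⟨h.1.const_smul c, h.2.1.smul_left (f := fun _ => c),
    (tsupport_smul_subset_right (fun _ => c) φ).trans h.2.2⟩

lemma IsW.of_TF {φ : EE N → ℝ} (h : TF D φ) : IsW D φ (gradient φ) :=
  ⟨h.memLp 2, h.memLp_grad 2, fun ε hε => ⟨φ, h, by simp, by simp⟩⟩

lemma IsW.closed {u : EE N → ℝ} {g : EE N → EE N} (hu : MemLp u 2 (volume.restrict D))
    (hg : MemLp g 2 (volume.restrict D))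
    (h : ∀ ε : ℝ≥0∞, ε ≠ 0 → ∃ u' g', IsW D u' g' ∧ eLpNorm (u - u') 2 (volume.restrict D) ≤ ε ∧
      eLpNorm (g - g') 2 (volume.restrict D) ≤ ε) : IsW D u g := by
  refine ⟨hu, hg, fun ε hε => ?_⟩
  have hε2 : ε / 2 ≠ 0 := by simpa using hε
  obtain ⟨u', g', hw, h1, h2⟩ := h (ε / 2) hε2
  obtain ⟨φ, hφ, h3, h4⟩ := hw.2.2 (ε / 2) hε2
  refine ⟨φ, hφ, ?_, ?_⟩
  · calc eLpNorm (u - φ) 2 (volume.restrict D) = eLpNorm ((u - u') + (u' - φ)) 2 (volume.restrict D) := by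
          congr 1; abel
      _ ≤ _ := eLpNorm_add_le (hu.sub hw.1).1 (hw.1.sub (hφ.memLp 2)).1 (by norm_num)
      _ ≤ ε / 2 + ε / 2 := add_le_add h1 h3
      _ = ε := ENNReal.add_halves ε
  · calc eLpNorm (g - gradient φ) 2 (volume.restrict D)
        = eLpNorm ((g - g') + (g' - gradient φ)) 2 (volume.restrict D) := by
          congr 1; abel
      _ ≤ _ := eLpNorm_add_le (hg.sub hw.2.1).1 (hw.2.1.sub (hφ.memLp_grad 2)).1 (by norm_num)
      _ ≤ ε / 2 + ε / 2 := add_le_add h2 h4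
      _ = ε := ENNReal.add_halves ε

lemma IsW.of_tendsto {u : EE N → ℝ} {g : EE N → EE N} (hu : MemLp u 2 (volume.restrict D))
    (hg : MemLp g 2 (volume.restrict D)) (u' : ℕ → EE N → ℝ) (g' : ℕ → EE N → EE N)
    (hw : ∀ n, IsW D (u' n) (g' n))
    (h1 : Tendsto (fun n => eLpNorm (u' n - u) 2 (volume.restrict D)) atTop (𝓝 0))
    (h2 : Tendsto (fun n => eLpNorm (g' n - g) 2 (volume.restrict D)) atTop (𝓝 0)) : IsW D u g := by
  refine IsW.closed hu hg fun ε hε => ?_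
  have hε' : 0 < ε := pos_iff_ne_zero.2 hε
  obtain ⟨n, h3, h4⟩ := ((h1.eventually (ge_mem_nhds hε')).and (h2.eventually (ge_mem_nhds hε'))).exists
  exact ⟨u' n, g' n, hw n, by rwa [eLpNorm_sub_comm], by rwa [eLpNorm_sub_comm]⟩

lemma IsW.congr {u u' : EE N → ℝ} {g g' : EE N → EE N} (h : IsW D u g)
    (h1 : u =ᵐ[volume.restrict D] u') (h2 : g =ᵐ[volume.restrict D] g') : IsW D u' g' := by
  refine IsW.closed (h.1.ae_eq h1) (h.2.1.ae_eq h2) fun ε hε => ⟨u, g, h, ?_, ?_⟩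
  · rw [eLpNorm_congr_ae (g := 0)]
    · simp
    · filter_upwards [h1] with x hx; simp [hx]
  · rw [eLpNorm_congr_ae (g := 0)]
    · simp
    · filter_upwards [h2] with x hx; simp [hx]

lemma IsW.add {u u' : EE N → ℝ} {g g' : EE N → EE N} (h : IsW D u g) (h' : IsW D u' g') :
    IsW D (u + u') (g + g') := by
  refine ⟨h.1.add h'.1, h.2.1.add h'.2.1, fun ε hε => ?_⟩
  have hε2 : ε / 2 ≠ 0 := by simpa using hε
  obtain ⟨φ, hφ, h1, h2⟩ := h.2.2 (ε / 2) hε2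
  obtain ⟨ψ, hψ, h3, h4⟩ := h'.2.2 (ε / 2) hε2
  refine ⟨φ + ψ, hφ.add hψ, ?_, ?_⟩
  · calc eLpNorm (u + u' - (φ + ψ)) 2 (volume.restrict D)
        = eLpNorm ((u - φ) + (u' - ψ)) 2 (volume.restrict D) := by congr 1; abel
      _ ≤ _ := eLpNorm_add_le (h.1.sub (hφ.memLp 2)).1 (h'.1.sub (hψ.memLp 2)).1 (by norm_num)
      _ ≤ ε / 2 + ε / 2 := add_le_add h1 h3
      _ = ε := ENNReal.add_halves ε
  · have : gradient (φ + ψ) = gradient φ + gradient ψ := by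
      ext1 z; exact gradient_add' (hφ.diff z) (hψ.diff z)
    rw [this]
    calc eLpNorm (g + g' - (gradient φ + gradient ψ)) 2 (volume.restrict D)
        = eLpNorm ((g - gradient φ) + (g' - gradient ψ)) 2 (volume.restrict D) := by congr 1; abel
      _ ≤ _ := eLpNorm_add_le (h.2.1.sub (hφ.memLp_grad 2)).1 (h'.2.1.sub (hψ.memLp_grad 2)).1
          (by norm_num)
      _ ≤ ε / 2 + ε / 2 := add_le_add h2 h4
      _ = ε := ENNReal.add_halves ε

lemma IsW.seq {u : EE N → ℝ} {g : EE N → EE N} (h : IsW D u g) :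
    ∃ φ : ℕ → EE N → ℝ, (∀ n, TF D (φ n)) ∧
      Tendsto (fun n => eLpNorm (φ n - u) 2 (volume.restrict D)) atTop (𝓝 0) ∧
      Tendsto (fun n => eLpNorm (gradient (φ n) - g) 2 (volume.restrict D)) atTop (𝓝 0) ∧
      (∀ᵐ z ∂(volume.restrict D), Tendsto (fun n => φ n z) atTop (𝓝 (u z))) := by
  have hne : ∀ n : ℕ, ((n : ℝ≥0∞) + 1)⁻¹ ≠ 0 := fun n => by
    simp [ENNReal.add_eq_top]
  have hlim : Tendsto (fun n : ℕ => ((n : ℝ≥0∞) + 1)⁻¹) atTop (𝓝 0) := by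
    have := ENNReal.tendsto_inv_nat_nhds_zero.comp (tendsto_add_atTop_nat 1)
    refine this.congr fun n => by simp
  choose φ hφ h1 h2 using fun n : ℕ => h.2.2 _ (hne n)
  have t1 : Tendsto (fun n => eLpNorm (φ n - u) 2 (volume.restrict D)) atTop (𝓝 0) :=
    tendsto_of_tendsto_of_tendsto_of_le_of_le tendsto_const_nhds hlim (fun _ => zero_le)
      fun n => by rw [eLpNorm_sub_comm]; exact h1 n
  have t2 : Tendsto (fun n => eLpNorm (gradient (φ n) - g) 2 (volume.restrict D)) atTop (𝓝 0) :=
    tendsto_of_tendsto_of_tendsto_of_le_of_le tendsto_const_nhds hlim (fun _ => zero_le)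
      fun n => by rw [eLpNorm_sub_comm]; exact h2 n
  obtain ⟨ns, hns, hae⟩ := (tendstoInMeasure_of_tendsto_eLpNorm (by norm_num)
    (fun n => ((hφ n).memLp 2).1) h.1.1 t1).exists_seq_tendsto_ae
  exact ⟨fun n => φ (ns n), fun n => hφ _, t1.comp hns.tendsto_atTop, t2.comp hns.tendsto_atTop, hae⟩

lemma IsW.smul {u : EE N → ℝ} {g : EE N → EE N} (c : ℝ) (h : IsW D u g) :
    IsW D (c • u) (c • g) := by
  obtain ⟨φ, hφ, h1, h2, -⟩ := h.seq
  refine IsW.of_tendsto (h.1.const_smul c) (h.2.1.const_smul c) (fun n => c • φ n)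
    (fun n => gradient (c • φ n)) (fun n => IsW.of_TF ((hφ n).smul c)) ?_ ?_
  · have : ∀ n, eLpNorm (c • φ n - c • u) 2 (volume.restrict D)
        = ‖c‖ₑ * eLpNorm (φ n - u) 2 (volume.restrict D) := fun n => by
      rw [← smul_sub, eLpNorm_const_smul]
    simp_rw [this]
    simpa using ENNReal.Tendsto.const_mul h1 (Or.inr (by simp : ‖c‖ₑ ≠ ∞))
  · have : ∀ n, eLpNorm (gradient (c • φ n) - c • g) 2 (volume.restrict D)
        = ‖c‖ₑ * eLpNorm (gradient (φ n) - g) 2 (volume.restrict D) := fun n => by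
      rw [← eLpNorm_const_smul, smul_sub]
      congr 2; ext1 z; exact gradient_smul' c ((hφ n).diff z)
    simp_rw [this]
    simpa using ENNReal.Tendsto.const_mul h2 (Or.inr (by simp : ‖c‖ₑ ≠ ∞))

lemma IsW.neg {u : EE N → ℝ} {g : EE N → EE N} (h : IsW D u g) : IsW D (-u) (-g) := by
  simpa using h.smul (-1)

lemma IsW.sub {u u' : EE N → ℝ} {g g' : EE N → EE N} (h : IsW D u g) (h' : IsW D u' g') :
    IsW D (u - u') (g - g') := by
  simpa [sub_eq_add_neg] using h.add h'.neg

/-- integration by parts -/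
lemma TF.ibp {φ ψ : EE N → ℝ} (h : TF D φ) (hψ : ContDiff ℝ 1 ψ) (hψc : HasCompactSupport ψ)
    (e : EE N) :
    ∫ z in D, φ z * fderiv ℝ ψ z e = - ∫ z in D, inner ℝ (gradient φ z) e * ψ z := by
  have s1 : ∫ z in D, φ z * fderiv ℝ ψ z e = ∫ z, φ z * fderiv ℝ ψ z e := by
    refine setIntegral_eq_integral_of_forall_compl_eq_zero fun z hz => ?_
    have : φ z = 0 := image_eq_zero_of_notMem_tsupport fun h' => hz (h.2.2 h')
    simp [this]
  have s2 : ∫ z in D, inner ℝ (gradient φ z) e * ψ z = ∫ z, fderiv ℝ φ z e * ψ z := by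
    simp_rw [inner_gradient']
    refine setIntegral_eq_integral_of_forall_compl_eq_zero fun z hz => ?_
    have : fderiv ℝ φ z = 0 := image_eq_zero_of_notMem_tsupport
      fun h' => hz (h.2.2 (tsupport_fderiv_subset ℝ h'))
    simp [this]
  rw [s1, s2]
  have c1 : Continuous fun z => fderiv ℝ φ z e := (h.1.continuous_fderiv one_ne_zero).clm_apply continuous_const
  have c2 : Continuous fun z => fderiv ℝ ψ z e := (hψ.continuous_fderiv one_ne_zero).clm_apply continuous_const
  refine integral_mul_fderiv_eq_neg_fderiv_mul_of_integrable ?_ ?_ ?_ (fun z _ => h.diff z)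
    (fun z _ => hψ.differentiable one_ne_zero z)
  · exact (c1.mul hψ.continuous).integrable_of_hasCompactSupport hψc.mul_left
  · exact (h.1.continuous.mul c2).integrable_of_hasCompactSupport h.2.1.mul_right
  · exact (h.1.continuous.mul hψ.continuous).integrable_of_hasCompactSupport h.2.1.mul_right

lemma tendsto_integral_of_L2 {ι : Type*} {l : Filter ι} {μ : Measure (EE N)} {f : ι → EE N → ℝ} {u w : EE N → ℝ}
    (hf : ∀ n, MemLp (f n) 2 μ) (hu : MemLp u 2 μ) (hw : MemLp w 2 μ)
    (h : Tendsto (fun n => eLpNorm (f n - u) 2 μ) l (𝓝 0)) :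
    Tendsto (fun n => ∫ z, f n z * w z ∂μ) l (𝓝 (∫ z, u z * w z ∂μ)) := by
  refine tendsto_integral_of_L1 _ (hu.integrable_mul hw).1 (Eventually.of_forall fun n => (hf n).integrable_mul hw) ?_
  have : ∀ n, ∫⁻ z, ‖f n z * w z - u z * w z‖ₑ ∂μ ≤ eLpNorm (f n - u) 2 μ * eLpNorm w 2 μ := fun n => by
    have := eLpNorm_smul_le_mul_eLpNorm (p := 2) (q := 2) (r := 1) (μ := μ) hw.1 ((hf n).sub hu).1
    rw [eLpNorm_one_eq_lintegral_enorm] at this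
    refine le_trans (le_of_eq ?_) this
    refine lintegral_congr fun z => ?_
    simp [sub_mul]
  refine tendsto_of_tendsto_of_tendsto_of_le_of_le tendsto_const_nhds ?_ (fun _ => zero_le) this
  simpa using ENNReal.Tendsto.mul_const h (Or.inr hw.2.ne)

lemma memLp_inner_left {μ : Measure (EE N)} {g : EE N → EE N} (hg : MemLp g 2 μ) (e : EE N) :
    MemLp (fun z => inner ℝ (g z) e) 2 μ := by
  refine (hg.norm.const_mul ‖e‖).mono (hg.1.inner aestronglyMeasurable_const) ?_
  refine Eventually.of_forall fun z => ?_
  have := norm_inner_le_norm (𝕜 := ℝ) (g z) e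
  simpa [mul_comm] using this

lemma eLpNorm_inner_sub_le {μ : Measure (EE N)} (g g' : EE N → EE N) (e : EE N) :
    eLpNorm ((fun z => inner ℝ (g z) e) - fun z => inner ℝ (g' z) e) 2 μ
      ≤ ‖e‖ₑ * eLpNorm (g - g') 2 μ := by
  have := eLpNorm_le_nnreal_smul_eLpNorm_of_ae_le_mul (μ := μ) (f := (fun z => inner ℝ (g z) e) - fun z => inner ℝ (g' z) e)
    (g := g - g') (c := ‖e‖₊) (Eventually.of_forall fun z => ?_) 2
  · exact this
  · simp only [Pi.sub_apply, ← inner_sub_left]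
    rw [mul_comm]
    exact nnnorm_inner_le_nnnorm (𝕜 := ℝ) (g z - g' z) e

lemma IsW.ibp {u ψ : EE N → ℝ} {g : EE N → EE N} (h : IsW D u g) (hψ : ContDiff ℝ 1 ψ)
    (hψc : HasCompactSupport ψ) (e : EE N) :
    ∫ z in D, u z * fderiv ℝ ψ z e = - ∫ z in D, inner ℝ (g z) e * ψ z := by
  obtain ⟨φ, hφ, h1, h2, -⟩ := h.seq
  have c2 : Continuous fun z => fderiv ℝ ψ z e := (hψ.continuous_fderiv one_ne_zero).clm_apply continuous_const
  have hs2 : HasCompactSupport fun z => fderiv ℝ ψ z e := hψc.fderiv_apply (𝕜 := ℝ) e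
  have w1 : MemLp (fun z => fderiv ℝ ψ z e) 2 (volume.restrict D) :=
    (c2.memLp_of_hasCompactSupport hs2).restrict D
  have w2 : MemLp ψ 2 (volume.restrict D) := (hψ.continuous.memLp_of_hasCompactSupport hψc).restrict D
  have t1 := tendsto_integral_of_L2 (fun n => (hφ n).memLp 2) h.1 w1 h1
  have t2 := tendsto_integral_of_L2 (fun n => memLp_inner_left ((hφ n).memLp_grad 2) e)
    (memLp_inner_left h.2.1 e) w2 (l := atTop) (by
      refine tendsto_of_tendsto_of_tendsto_of_le_of_le tendsto_const_nhds ?_ (fun _ => zero_le)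
        (fun n => eLpNorm_inner_sub_le _ _ e)
      simpa using ENNReal.Tendsto.const_mul h2 (Or.inr (by simp : ‖e‖ₑ ≠ ∞)))
  refine tendsto_nhds_unique t1 ?_
  have := t2.neg
  refine this.congr fun n => ?_
  exact ((hφ n).ibp hψ hψc e).symm

lemma tendsto_eLpNorm_dom {F : Type*} [NormedAddCommGroup F] {μ : Measure (EE N)} {q : ℝ≥0∞} (hq : q ≠ 0) (hq' : q ≠ ∞)
    {f : ℕ → EE N → F} {G : EE N → ℝ} (hf : ∀ n, AEStronglyMeasurable (f n) μ) (hG : MemLp G q μ)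
    (hb : ∀ n, ∀ᵐ z ∂μ, ‖f n z‖ ≤ ‖G z‖) (hl : ∀ᵐ z ∂μ, Tendsto (fun n => f n z) atTop (𝓝 0)) :
    Tendsto (fun n => eLpNorm (f n) q μ) atTop (𝓝 0) := by
  have hpos : 0 < q.toReal := ENNReal.toReal_pos hq hq'
  have : Tendsto (fun n => ∫⁻ z, ‖f n z‖ₑ ^ q.toReal ∂μ) atTop (𝓝 (∫⁻ z, 0 ∂μ)) := by
    refine tendsto_lintegral_of_dominated_convergence' (fun z => ‖G z‖ₑ ^ q.toReal)
      (fun n => (hf n).enorm.pow_const _) ?_ ?_ ?_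
    · intro n
      filter_upwards [hb n] with z hz
      gcongr
      exact enorm_le_iff_norm_le.2 hz
    · exact (lintegral_rpow_enorm_lt_top_of_eLpNorm_lt_top hq hq' hG.2).ne
    · filter_upwards [hl] with z hz
      have h0 : Tendsto (fun n => ‖f n z‖ₑ) atTop (𝓝 0) := by
        simpa [Function.comp_def] using (continuous_enorm.tendsto _).comp hz
      have := (ENNReal.continuous_rpow_const (y := q.toReal)).tendsto 0 |>.comp h0
      simpa [hpos, Function.comp_def] using this
  simp only [lintegral_zero] at this
  have h2 := (ENNReal.continuous_rpow_const (y := 1 / q.toReal)).tendsto 0 |>.comp this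
  simp only [eLpNorm_eq_lintegral_rpow_enorm_toReal hq hq']
  simpa [hpos, Function.comp_def] using h2

lemma IsW.comp {u : EE N → ℝ} {g : EE N → EE N} (h : IsW D u g) {F : ℝ → ℝ} (hF : ContDiff ℝ 1 F)
    (hF0 : F 0 = 0) (hF1 : ∀ t, |deriv F t| ≤ 1) :
    IsW D (fun z => F (u z)) (fun z => deriv F (u z) • g z) := by
  obtain ⟨φ, hφ, h1, h2, h3⟩ := h.seq
  have hcd : Continuous (deriv F) := hF.continuous_deriv le_rfl
  have hL : LipschitzWith 1 F := lipschitzWith_of_nnnorm_deriv_le (hF.differentiable one_ne_zero)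
    fun t => by simpa [← NNReal.coe_le_coe] using hF1 t
  have hLb : ∀ s t, ‖F s - F t‖ ≤ ‖s - t‖ := fun s t => by
    simpa [dist_eq_norm] using hL.dist_le_mul s t
  have hTF : ∀ n, TF D (fun z => F (φ n z)) := fun n => by
    refine ⟨hF.comp (hφ n).1, (hφ n).2.1.comp_left hF0, ?_⟩
    exact (closure_mono (Function.support_comp_subset hF0 (φ n))).trans (hφ n).2.2
  have hgr : ∀ n z, gradient (fun z => F (φ n z)) z = deriv F (φ n z) • gradient (φ n) z := fun n z => by
    have := ((hF.differentiable one_ne_zero (φ n z)).hasDerivAt.comp_hasFDerivAt z ((hφ n).diff z).hasFDerivAt).fderiv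
    simp only [Function.comp_def] at this
    simp [gradient, this]
  have mu : MemLp (fun z => F (u z)) 2 (volume.restrict D) :=
    h.1.mono (hF.continuous.comp_aestronglyMeasurable h.1.1) (Eventually.of_forall fun z => by
      simpa [hF0] using hLb (u z) 0)
  have ms : ∀ w : EE N → ℝ, AEStronglyMeasurable w (volume.restrict D) →
    AEStronglyMeasurable (fun z => deriv F (w z)) (volume.restrict D) := fun w hw =>
      hcd.comp_aestronglyMeasurable hw
  have mg : MemLp (fun z => deriv F (u z) • g z) 2 (volume.restrict D) :=
    h.2.1.mono ((ms u h.1.1).smul h.2.1.1) (Eventually.of_forall fun z => by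
      rw [norm_smul]; exact mul_le_of_le_one_left (norm_nonneg _) (hF1 _))
  refine IsW.of_tendsto mu mg (fun n z => F (φ n z)) _ (fun n => IsW.of_TF (hTF n)) ?_ ?_
  · refine tendsto_of_tendsto_of_tendsto_of_le_of_le tendsto_const_nhds h1 (fun _ => zero_le)
      fun n => eLpNorm_mono fun z => ?_
    exact hLb _ _
  · have e1 : ∀ n, gradient (fun z => F (φ n z)) - (fun z => deriv F (u z) • g z)
        = (fun z => deriv F (φ n z) • (gradient (φ n) z - g z)) +
          fun z => (deriv F (φ n z) - deriv F (u z)) • g z := fun n => by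
      ext1 z; simp only [Pi.sub_apply, Pi.add_apply, hgr]; module
    have b1 : Tendsto (fun n => eLpNorm (fun z => deriv F (φ n z) • (gradient (φ n) z - g z)) 2
        (volume.restrict D)) atTop (𝓝 0) := by
      refine tendsto_of_tendsto_of_tendsto_of_le_of_le tendsto_const_nhds h2 (fun _ => zero_le)
        fun n => eLpNorm_mono fun z => ?_
      rw [norm_smul]; exact mul_le_of_le_one_left (norm_nonneg _) (hF1 _)
    have b2 : Tendsto (fun n => eLpNorm (fun z => (deriv F (φ n z) - deriv F (u z)) • g z) 2
        (volume.restrict D)) atTop (𝓝 0) := by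
      refine tendsto_eLpNorm_dom (by norm_num) (by norm_num) (G := fun z => 2 * ‖g z‖)
        (fun n => ((ms _ ((hφ n).memLp 2).1).sub (ms u h.1.1)).smul h.2.1.1)
        (h.2.1.norm.const_mul 2) (fun n => Eventually.of_forall fun z => ?_) ?_
      · rw [norm_smul, norm_mul, norm_norm]
        gcongr
        have := norm_sub_le (deriv F (φ n z)) (deriv F (u z))
        have a := hF1 (φ n z); have b := hF1 (u z)
        simp only [Real.norm_eq_abs] at *
        norm_num; linarith
      · filter_upwards [h3] with z hz
        have := ((hcd.tendsto _).comp hz).sub_const (deriv F (u z))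
        simpa using this.smul_const (g z)
    refine tendsto_of_tendsto_of_tendsto_of_le_of_le tendsto_const_nhds
      (by simpa using b1.add b2) (fun _ => zero_le) fun n => ?_
    rw [e1]
    exact eLpNorm_add_le ((ms _ ((hφ n).memLp 2).1).smul (((hφ n).memLp_grad 2).1.sub h.2.1.1))
      (((ms _ ((hφ n).memLp 2).1).sub (ms u h.1.1)).smul h.2.1.1) (by norm_num)

/-- smooth approximation of the positive part of `t - k` -/
def Fap (k ε t : ℝ) : ℝ := √((max (t - k) 0) ^ 2 + ε ^ 2) - ε

lemma hasDerivAt_sqpos (t : ℝ) : HasDerivAt (fun t : ℝ => (max t 0) ^ 2) (2 * max t 0) t := by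
  rcases lt_trichotomy t 0 with ht | ht | ht
  · have : (fun t : ℝ => (max t 0) ^ 2) =ᶠ[𝓝 t] fun _ => 0 := by
      filter_upwards [gt_mem_nhds ht] with s hs; simp [max_eq_right hs.le]
    rw [max_eq_right ht.le, mul_zero]
    exact (hasDerivAt_const t (0:ℝ)).congr_of_eventuallyEq this
  · subst ht
    rw [hasDerivAt_iff_isLittleO_nhds_zero]
    simp only [zero_add, max_self, mul_zero, smul_zero, sub_zero]
    have : (fun h : ℝ => (max h 0) ^ 2) =O[𝓝 0] fun h : ℝ => h ^ 2 := by
      refine Asymptotics.IsBigO.of_bound 1 (Eventually.of_forall fun h => ?_)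
      rw [one_mul, norm_pow, norm_pow]
      gcongr
      rw [Real.norm_eq_abs, Real.norm_eq_abs]
      rcases le_total h 0 with h' | h' <;> simp [h']
    simp only [ne_eq, OfNat.ofNat_ne_zero, not_false_eq_true, zero_pow, sub_zero]
    refine this.trans_isLittleO ?_
    simpa using Asymptotics.isLittleO_pow_pow (𝕜 := ℝ) (m := 1) (n := 2) (by norm_num)
  · have : (fun t : ℝ => (max t 0) ^ 2) =ᶠ[𝓝 t] fun t => t ^ 2 := by
      filter_upwards [lt_mem_nhds ht] with s hs; simp [max_eq_left (le_of_lt hs)]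
    rw [max_eq_left ht.le]
    refine HasDerivAt.congr_of_eventuallyEq ?_ this
    simpa using hasDerivAt_pow 2 t

lemma hasDerivAt_Fap {ε : ℝ} (hε : 0 < ε) (k t : ℝ) :
    HasDerivAt (Fap k ε) (max (t - k) 0 / √((max (t - k) 0) ^ 2 + ε ^ 2)) t := by
  have h1 : HasDerivAt (fun t : ℝ => (max (t - k) 0) ^ 2) (2 * max (t - k) 0) t := by
    simpa using (hasDerivAt_sqpos (t - k)).comp_sub_const t k
  have h2 := ((h1.add_const (ε ^ 2)).sqrt (by positivity)).sub_const ε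
  rw [mul_div_mul_left _ _ two_ne_zero] at h2
  exact h2

lemma Fap_cd {ε : ℝ} (hε : 0 < ε) (k : ℝ) : ContDiff ℝ 1 (Fap k ε) := by
  rw [contDiff_one_iff_deriv]
  refine ⟨fun t => (hasDerivAt_Fap hε k t).differentiableAt, ?_⟩
  have : deriv (Fap k ε) = fun t => max (t - k) 0 / √((max (t - k) 0) ^ 2 + ε ^ 2) := by
    ext1 t; exact (hasDerivAt_Fap hε k t).deriv
  rw [this]
  refine Continuous.div (by fun_prop) (by fun_prop) fun t => ?_
  positivity

lemma Fap_err {ε : ℝ} (hε : 0 < ε) (k t : ℝ) : |Fap k ε t - max (t - k) 0| ≤ ε := by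
  unfold Fap
  have h0 : 0 ≤ max (t - k) 0 := le_max_right _ _
  generalize max (t - k) 0 = m at *
  have h1 : m ≤ √(m ^ 2 + ε ^ 2) := Real.le_sqrt_of_sq_le (by nlinarith)
  have h2 : √(m ^ 2 + ε ^ 2) ≤ m + ε := Real.sqrt_le_iff.2 ⟨by positivity, by nlinarith⟩
  rw [abs_le]; constructor <;> linarith

lemma Fap_deriv {ε : ℝ} (hε : 0 < ε) (k t : ℝ) : |deriv (Fap k ε) t| ≤ 1 := by
  rw [(hasDerivAt_Fap hε k t).deriv]
  have h0 : 0 ≤ max (t - k) 0 := le_max_right _ _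
  generalize max (t - k) 0 = m at *
  have h1 : m ≤ √(m ^ 2 + ε ^ 2) := Real.le_sqrt_of_sq_le (by nlinarith)
  have : 0 < √(m ^ 2 + ε ^ 2) := by positivity
  rw [abs_of_nonneg (by positivity), div_le_one this]; exact h1

lemma Fap_deriv_tendsto (k t : ℝ) : Tendsto (fun n : ℕ => deriv (Fap k (1 / ((n : ℝ) + 1))) t) atTop
    (𝓝 (if k < t then 1 else 0)) := by
  have he : ∀ n : ℕ, (0 : ℝ) < 1 / ((n : ℝ) + 1) := fun n => by positivity
  simp_rw [fun n => (hasDerivAt_Fap (he n) k t).deriv]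
  split_ifs with h
  · have hm : max (t - k) 0 = t - k := max_eq_left (by linarith)
    rw [hm]
    have h0 : 0 < t - k := by linarith
    have : Tendsto (fun n : ℕ => (t - k) / √((t - k) ^ 2 + (1 / ((n : ℝ) + 1)) ^ 2)) atTop
        (𝓝 ((t - k) / √((t - k) ^ 2 + 0 ^ 2))) := by
      refine Tendsto.div tendsto_const_nhds ?_ (by positivity)
      exact (Real.continuous_sqrt.tendsto _).comp
        ((tendsto_one_div_add_atTop_nhds_zero_nat.pow 2).const_add _)
    convert this using 2
    rw [zero_pow two_ne_zero, add_zero, Real.sqrt_sq h0.le, div_self h0.ne']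
  · have hm : max (t - k) 0 = 0 := max_eq_right (by linarith)
    simp [hm]

lemma IsW.pos [IsFiniteMeasure ((volume : Measure (EE N)).restrict D)] {u : EE N → ℝ} {g : EE N → EE N} (h : IsW D u g) {k : ℝ} (hk : 0 ≤ k) :
    IsW D (fun z => max (u z - k) 0) (fun z => if k < u z then g z else 0) := by
  have he : ∀ n : ℕ, (0 : ℝ) < 1 / ((n : ℝ) + 1) := fun n => by positivity
  have hW : ∀ n : ℕ, IsW D (fun z => Fap k (1 / ((n : ℝ) + 1)) (u z))
      (fun z => deriv (Fap k (1 / ((n : ℝ) + 1))) (u z) • g z) := fun n =>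
    h.comp (Fap_cd (he n) k) (by
      simp only [Fap]
      rw [max_eq_right (by linarith), zero_pow two_ne_zero, zero_add, Real.sqrt_sq (he n).le, sub_self])
      (Fap_deriv (he n) k)
  have hlim : ∀ z, Tendsto (fun n : ℕ => deriv (Fap k (1 / ((n : ℝ) + 1))) (u z) • g z) atTop
      (𝓝 (if k < u z then g z else 0)) := fun z => by
    have := (Fap_deriv_tendsto k (u z)).smul_const (g z)
    convert this using 2
    split_ifs <;> simp
  have hmg : AEStronglyMeasurable (fun z => if k < u z then g z else 0) (volume.restrict D) :=
    aestronglyMeasurable_of_tendsto_ae atTop (fun n => (hW n).2.1.1) (Eventually.of_forall hlim)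
  have mg : MemLp (fun z => if k < u z then g z else 0) 2 (volume.restrict D) :=
    h.2.1.mono hmg (Eventually.of_forall fun z => by split_ifs <;> simp)
  have mu : MemLp (fun z => max (u z - k) 0) 2 (volume.restrict D) := by
    refine h.1.mono ?_ (Eventually.of_forall fun z => ?_)
    · exact (continuous_id.sub continuous_const |>.max continuous_const).comp_aestronglyMeasurable h.1.1
    · rw [Real.norm_eq_abs, Real.norm_eq_abs, abs_of_nonneg (le_max_right _ _)]
      refine max_le ?_ (abs_nonneg _)
      linarith [le_abs_self (u z)]
  refine IsW.of_tendsto mu mg _ _ hW ?_ ?_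
  · have hmeas : ∀ n : ℕ, AEStronglyMeasurable ((fun z => Fap k (1 / ((n : ℝ) + 1)) (u z)) - fun z => max (u z - k) 0) (volume.restrict D) :=
      fun n => (hW n).1.1.sub mu.1
    refine tendsto_eLpNorm_dom (by norm_num) (by norm_num) (G := fun _ => (1 : ℝ)) hmeas
        (memLp_const 1) (fun n => Eventually.of_forall fun z => ?_) (Eventually.of_forall fun z => ?_)
    · refine (Fap_err (he n) k (u z)).trans ?_
      rw [norm_one, div_le_one (by positivity)]; linarith [Nat.cast_nonneg (α := ℝ) n]
    · exact squeeze_zero_norm (fun n => Fap_err (he n) k (u z)) tendsto_one_div_add_atTop_nhds_zero_nat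
  · refine tendsto_eLpNorm_dom (by norm_num) (by norm_num) (G := fun z => 2 * ‖g z‖)
        (fun n => (hW n).2.1.1.sub hmg)
        (h.2.1.norm.const_mul 2) (fun n => Eventually.of_forall fun z => ?_) (Eventually.of_forall fun z => ?_)
    · rw [norm_mul, norm_norm]
      refine (norm_sub_le _ _).trans ?_
      have a : ‖deriv (Fap k (1 / ((n : ℝ) + 1))) (u z) • g z‖ ≤ ‖g z‖ := by
        rw [norm_smul]; exact mul_le_of_le_one_left (norm_nonneg _) (Fap_deriv (he n) k _)
      have b : ‖if k < u z then g z else 0‖ ≤ ‖g z‖ := by split_ifs <;> simp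
      rw [Real.norm_ofNat]; linarith
    · simpa using (hlim z).sub_const (if k < u z then g z else 0)

lemma IsW.unique (hD : IsOpen D) {u : EE N → ℝ} {g g' : EE N → EE N} (h : IsW D u g) (h' : IsW D u g') :
    g =ᵐ[volume.restrict D] g' := by
  have key : ∀ e : EE N, ∀ᵐ z ∂(volume.restrict D), inner ℝ (g z - g' z) e = 0 := fun e => by
    have ml : MemLp (fun z => inner ℝ (g z - g' z) e) 2 (volume.restrict D) :=
      memLp_inner_left (h.2.1.sub h'.2.1) e
    rw [ae_restrict_iff' hD.measurableSet]
    refine hD.ae_eq_zero_of_integral_contDiff_smul_eq_zero ?_ ?_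
    · intro z hz
      obtain ⟨K, hK, hzK, hKD⟩ : ∃ K, IsCompact K ∧ z ∈ interior K ∧ K ⊆ D := exists_compact_subset hD hz
      refine ⟨K, mem_nhdsWithin_of_mem_nhds (mem_interior_iff_mem_nhds.1 hzK), ?_⟩
      have : MemLp (fun z => inner ℝ (g z - g' z) e) 2 (volume.restrict K) :=
        ml.mono_measure (Measure.restrict_mono hKD le_rfl)
      have hfin : IsFiniteMeasure ((volume : Measure (EE N)).restrict K) := ⟨by simpa using hK.measure_lt_top⟩
      exact this.integrable (by norm_num)
    · intro ψ hψ hc hs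
      have hψ1 : ContDiff ℝ 1 ψ := hψ.of_le (by exact_mod_cast le_top)
      have a := h.ibp hψ1 hc e
      rw [h'.ibp hψ1 hc e] at a
      have w2 : MemLp ψ 2 (volume.restrict D) := (hψ.continuous.memLp_of_hasCompactSupport hc).restrict D
      have i1 := (memLp_inner_left h.2.1 e).integrable_mul w2
      have i2 := (memLp_inner_left h'.2.1 e).integrable_mul w2
      have : ∫ z in D, (inner ℝ (g z) e * ψ z - inner ℝ (g' z) e * ψ z) = 0 := by
        have := integral_sub i1 i2
        simp only [Pi.mul_apply] at this
        rw [this]; linarith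
      rw [← setIntegral_eq_integral_of_forall_compl_eq_zero (s := D), ← this]
      · refine integral_congr_ae (Eventually.of_forall fun z => ?_)
        simp only [smul_eq_mul, inner_sub_left]; ring
      · intro z hz
        have : ψ z = 0 := image_eq_zero_of_notMem_tsupport fun h' => hz (hs h')
        simp [this]
  have : ∀ᵐ z ∂(volume.restrict D), ∀ i : Fin N, inner ℝ (g z - g' z) (EuclideanSpace.single i (1 : ℝ)) = 0 :=
    ae_all_iff.2 fun i => key _
  filter_upwards [this] with z hz
  rw [← sub_eq_zero]
  ext i
  simpa [EuclideanSpace.inner_single_right] using hz i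

lemma IsW.neg_part [IsFiniteMeasure ((volume : Measure (EE N)).restrict D)] {u : EE N → ℝ} {g : EE N → EE N} (h : IsW D u g) :
    IsW D (fun z => max (- u z) 0) (fun z => if u z < 0 then - g z else 0) := by
  have := h.neg.pos le_rfl
  simpa only [Pi.neg_apply, sub_zero, Left.neg_pos_iff] using this

lemma IsW.pos_part [IsFiniteMeasure ((volume : Measure (EE N)).restrict D)] {u : EE N → ℝ} {g : EE N → EE N} (h : IsW D u g) :
    IsW D (fun z => max (u z) 0) (fun z => if 0 < u z then g z else 0) := by
  have := h.pos le_rfl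
  simpa only [sub_zero] using this

lemma IsW.grad_zero (hD : IsOpen D) [IsFiniteMeasure ((volume : Measure (EE N)).restrict D)] {u : EE N → ℝ} {g : EE N → EE N} (h : IsW D u g) :
    ∀ᵐ z ∂(volume.restrict D), u z = 0 → g z = 0 := by
  have h1 := h.pos_part.sub h.neg_part
  have h2 : IsW D u _ := h1.congr (u' := u) (Eventually.of_forall fun z => by
    simp only [Pi.sub_apply]
    rcases le_total (u z) 0 with h | h
    · rw [max_eq_right h, max_eq_left (by linarith)]; ring
    · rw [max_eq_left h, max_eq_right (by linarith)]; ring) (EventuallyEq.refl _ _)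
  filter_upwards [h.unique hD h2] with z hz h0
  rw [hz]; simp [h0]

end IsWsec


section P2sec
open scoped ENNReal NNReal Topology
variable {N : ℕ} {D : Set (EE N)}

lemma finMeas (hb : Bornology.IsBounded D) : IsFiniteMeasure ((volume : Measure (EE N)).restrict D) :=
  ⟨by simpa using hb.measure_lt_top⟩

/-- restricted norms of test functions -/
lemma TF.restrict_eLpNorm {φ : EE N → ℝ} (h : TF D φ) (q : ℝ≥0∞) (hD : MeasurableSet D) :
    eLpNorm φ q (volume.restrict D) = eLpNorm φ q volume := by
  rw [← eLpNorm_indicator_eq_eLpNorm_restrict hD, Set.indicator_eq_self.2]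
  exact (subset_tsupport φ).trans h.2.2

lemma TF.restrict_eLpNorm_grad {φ : EE N → ℝ} (h : TF D φ) (q : ℝ≥0∞) (hD : MeasurableSet D) :
    eLpNorm (gradient φ) q (volume.restrict D) = eLpNorm (gradient φ) q volume := by
  rw [← eLpNorm_indicator_eq_eLpNorm_restrict hD, Set.indicator_eq_self.2]
  intro z hz
  by_contra hz'
  have : fderiv ℝ φ z = 0 := image_eq_zero_of_notMem_tsupport
      fun h' => hz' (h.2.2 (tsupport_fderiv_subset ℝ h'))
  apply hz; rw [gradient, this]; simp

lemma sobolev_W (hN : 3 ≤ N) (hD : IsOpen D) (hb : Bornology.IsBounded D) {q : ℝ≥0} 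
    (hq : (2 : ℝ)⁻¹ - (N : ℝ)⁻¹ ≤ (q : ℝ)⁻¹) :
    ∃ C : ℝ≥0, ∀ u g, IsW D u g →
      eLpNorm u q (volume.restrict D) ≤ C * eLpNorm g 2 (volume.restrict D) := by
  let C : ℝ≥0 := eLpNormLESNormFDerivOfLeConst ℝ (volume : Measure (EE N)) D 2 q
  refine ⟨C, fun u g h => ?_⟩
  obtain ⟨φ, hφ, h1, h2, h3⟩ := h.seq
  have hTF : ∀ n, eLpNorm (φ n) q (volume.restrict D) ≤ C * eLpNorm (gradient (φ n)) 2 (volume.restrict D) := fun n => by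
    rw [(hφ n).restrict_eLpNorm _ hD.measurableSet, (hφ n).restrict_eLpNorm_grad _ hD.measurableSet]
    have := eLpNorm_le_eLpNorm_fderiv_of_le (μ := (volume : Measure (EE N))) (hφ n).1 (s := D) ((subset_tsupport (φ n)).trans (hφ n).2.2) (p := 2) (q := q) (by norm_num) (by simp; exact_mod_cast hN) (by simpa using hq) hb
    refine this.trans ?_
    have e : eLpNorm (fderiv ℝ (φ n)) ((2 : ℝ≥0) : ℝ≥0∞) volume = eLpNorm (gradient (φ n)) 2 volume :=
      eLpNorm_congr_norm_ae (Eventually.of_forall fun z => (norm_gradient' _ _).symm)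
    rw [e]
  have hlim : Tendsto (fun n => eLpNorm (gradient (φ n)) 2 (volume.restrict D)) atTop (𝓝 (eLpNorm g 2 (volume.restrict D))) := by
    have hle : ∀ n, eLpNorm (gradient (φ n)) 2 (volume.restrict D) ≤ eLpNorm (gradient (φ n) - g) 2 (volume.restrict D) + eLpNorm g 2 (volume.restrict D) := fun n => by
      have := eLpNorm_add_le (((hφ n).memLp_grad 2).sub h.2.1).1 h.2.1.1 (p := 2) (by norm_num)
      simpa using this
    have hge : ∀ n, eLpNorm g 2 (volume.restrict D) - eLpNorm (gradient (φ n) - g) 2 (volume.restrict D) ≤ eLpNorm (gradient (φ n)) 2 (volume.restrict D) := fun n => by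
      rw [tsub_le_iff_right]
      have := eLpNorm_sub_le ((hφ n).memLp_grad 2).1 (((hφ n).memLp_grad 2).sub h.2.1).1 (p := 2) (by norm_num)
      simpa using this
    refine tendsto_of_tendsto_of_tendsto_of_le_of_le ?_ ?_ hge hle
    · simpa using ENNReal.Tendsto.sub tendsto_const_nhds h2 (Or.inl h.2.1.2.ne)
    · simpa using h2.add_const _
  have := Lp.eLpNorm_lim_le_liminf_eLpNorm (p := q) (fun n => ((hφ n).memLp q).1) u h3
  refine this.trans ?_
  refine (liminf_le_liminf (Eventually.of_forall hTF)).trans ?_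
  exact (ENNReal.Tendsto.const_mul hlim (Or.inr ENNReal.coe_ne_top)).liminf_eq.le

/-- weak sequential compactness in Hilbert spaces -/
lemma weak_seq_compact {H : Type*} [NormedAddCommGroup H] [InnerProductSpace ℝ H] [CompleteSpace H]
    [TopologicalSpace.SeparableSpace H] (x : ℕ → H) (M : ℝ) (hx : ∀ n, ‖x n‖ ≤ M) :
    ∃ x0 : H, ∃ k : ℕ → ℕ, StrictMono k ∧ ∀ y, Tendsto (fun n => inner ℝ (x (k n)) y) atTop (𝓝 (inner ℝ x0 y)) := by
  have := WeakDual.isSeqCompact_closedBall ℝ H 0 M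
  obtain ⟨f, hf, k, hk, hl⟩ := @this (fun n => StrongDual.toWeakDual (InnerProductSpace.toDual ℝ H (x n))) (fun n => by simpa using hx n)
  refine ⟨(InnerProductSpace.toDual ℝ H).symm (WeakDual.toStrongDual f), k, hk, fun y => ?_⟩
  rw [InnerProductSpace.toDual_symm_apply]
  have := ((WeakDual.eval_continuous (𝕜 := ℝ) (E := H) y).tendsto f).comp hl
  simpa [Function.comp_def] using this

/-- bundling of the pair space -/
abbrev HHs (D : Set (EE N)) := WithLp 2 (Lp ℝ 2 ((volume : Measure (EE N)).restrict D) × Lp (EE N) 2 ((volume : Measure (EE N)).restrict D))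

/-- the closed subspace of pairs -/
def Ksub (D : Set (EE N)) : Submodule ℝ (HHs D) where
  carrier := {x | IsW D x.fst x.snd}
  zero_mem' := by
    have h0 : TF D (0 : EE N → ℝ) := ⟨contDiff_const, HasCompactSupport.zero, by simp [tsupport]⟩
    refine (IsW.of_TF h0).congr ?_ ?_
    · exact (Lp.coeFn_zero ..).symm
    · refine EventuallyEq.trans (Eventually.of_forall fun z => ?_) (Lp.coeFn_zero ..).symm
      simp only [Pi.zero_apply]
      have : fderiv ℝ (0 : EE N → ℝ) z = 0 := by
        exact fderiv_const_apply 0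
      rw [gradient, this]; simp
  add_mem' := fun {x y} hx hy => (IsW.add hx hy).congr (Lp.coeFn_add ..).symm (Lp.coeFn_add ..).symm
  smul_mem' := fun c x hx => (IsW.smul c hx).congr (Lp.coeFn_smul ..).symm (Lp.coeFn_smul ..).symm

lemma Ksub_closed : IsClosed (Ksub D : Set (HHs D)) := by
  refine IsSeqClosed.isClosed fun x x0 hx hl => ?_
  have h1 : Tendsto (fun n => (x n).fst) atTop (𝓝 x0.fst) :=
    ((WithLp.prod_continuous_ofLp 2 _ _).fst.tendsto x0).comp hl
  have h2 : Tendsto (fun n => (x n).snd) atTop (𝓝 x0.snd) :=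
    ((WithLp.prod_continuous_ofLp 2 _ _).snd.tendsto x0).comp hl
  rw [Lp.tendsto_Lp_iff_tendsto_eLpNorm'] at h1 h2
  exact IsW.of_tendsto (Lp.memLp _) (Lp.memLp _) _ _ hx h1 h2

lemma weak_compact_W {u : ℕ → EE N → ℝ} {g : ℕ → EE N → EE N} (h : ∀ n, IsW D (u n) (g n)) {M : ℝ≥0}
    (hu : ∀ n, eLpNorm (u n) 2 (volume.restrict D) ≤ M) (hg : ∀ n, eLpNorm (g n) 2 (volume.restrict D) ≤ M) :
    ∃ u0 g0, ∃ k : ℕ → ℕ, StrictMono k ∧ IsW D u0 g0 ∧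
     (∀ w, MemLp w 2 (volume.restrict D) → Tendsto (fun n => ∫ z in D, u (k n) z * w z) atTop (𝓝 (∫ z in D, u0 z * w z))) ∧
     (∀ w, MemLp w 2 (volume.restrict D) → Tendsto (fun n => ∫ z in D, inner ℝ (g (k n) z) (w z)) atTop (𝓝 (∫ z in D, inner ℝ (g0 z) (w z)))) := by
  have : Fact ((2 : ℝ≥0∞) ≠ ∞) := ⟨by norm_num⟩
  have s1 : SecondCountableTopology (Lp ℝ 2 ((volume : Measure (EE N)).restrict D)) := Lp.SecondCountableTopology
  have s2 : SecondCountableTopology (Lp (EE N) 2 ((volume : Measure (EE N)).restrict D)) := Lp.SecondCountableTopology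
  have : TopologicalSpace.SeparableSpace (HHs D) :=
    (WithLp.homeomorphProd 2 (Lp ℝ 2 ((volume : Measure (EE N)).restrict D)) (Lp (EE N) 2 ((volume : Measure (EE N)).restrict D))).symm.surjective.denseRange.separableSpace (Homeomorph.continuous _)
  let x : ℕ → HHs D := fun n => WithLp.toLp 2 ((h n).1.toLp, (h n).2.1.toLp)
  have hx : ∀ n, ‖x n‖ ≤ 2 * M := fun n => by
    have e1 : ‖(x n).fst‖ ≤ M := by
      have : (x n).fst = (h n).1.toLp := rfl
      rw [this, Lp.norm_toLp]
      exact ENNReal.toReal_le_coe_of_le_coe (hu n)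
    have e2 : ‖(x n).snd‖ ≤ M := by
      have : (x n).snd = (h n).2.1.toLp := rfl
      rw [this, Lp.norm_toLp]
      exact ENNReal.toReal_le_coe_of_le_coe (hg n)
    have e3 := WithLp.prod_norm_sq_eq_of_L2 (x n)
    have := norm_nonneg (x n); have := norm_nonneg (x n).fst; have := norm_nonneg (x n).snd
    nlinarith
  obtain ⟨x0, k, hk, hl⟩ := weak_seq_compact x _ hx
  refine ⟨x0.fst, x0.snd, k, hk, ?_, ?_, ?_⟩
  · have hK : x0 ∈ Ksub D := by
      have := Submodule.orthogonal_orthogonal_eq_closure (Ksub D)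
      rw [Ksub_closed.submodule_topologicalClosure_eq] at this
      rw [← this, Submodule.mem_orthogonal']
      intro y hy
      rw [Submodule.mem_orthogonal] at hy
      refine tendsto_nhds_unique (hl y) ?_
      have : ∀ n, inner ℝ (x (k n)) y = 0 := fun n => hy _ <|
        (h (k n)).congr (h (k n)).1.coeFn_toLp.symm (h (k n)).2.1.coeFn_toLp.symm
      simp [this]
    exact hK
  · intro w hw
    have := hl (WithLp.toLp 2 (hw.toLp, 0))
    simp only [WithLp.prod_inner_apply, L2.inner_def] at this
    have e1 : ∀ (v : Lp ℝ 2 ((volume : Measure (EE N)).restrict D)) , ∫ z in D, inner ℝ (v z) ((hw.toLp w) z) = ∫ z in D, v z * w z := fun v => by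
      refine integral_congr_ae ?_
      filter_upwards [hw.coeFn_toLp] with z hz
      rw [hz]; simp [mul_comm]
    have e2 : ∀ (v : Lp (EE N) 2 ((volume : Measure (EE N)).restrict D)) , ∫ z in D, inner ℝ (v z) ((0 : Lp (EE N) 2 ((volume : Measure (EE N)).restrict D)) z) = 0 := fun v => by
      rw [integral_congr_ae (g := 0)]
      · simp
      filter_upwards [Lp.coeFn_zero (E := EE N) 2 ((volume : Measure (EE N)).restrict D)] with z hz
      rw [hz]; simp
    simp only [e1, e2, add_zero] at this
    refine this.congr fun n => ?_
    refine integral_congr_ae ?_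
    filter_upwards [(h (k n)).1.coeFn_toLp] with z hz
    rw [← hz]
  · intro w hw
    have := hl (WithLp.toLp 2 (0, hw.toLp))
    simp only [WithLp.prod_inner_apply, L2.inner_def] at this
    have e1 : ∀ (v : Lp (EE N) 2 ((volume : Measure (EE N)).restrict D)) , ∫ z in D, inner ℝ (v z) ((hw.toLp w) z) = ∫ z in D, inner ℝ (v z) (w z) := fun v => by
      refine integral_congr_ae ?_
      filter_upwards [hw.coeFn_toLp] with z hz
      rw [hz]
    have e2 : ∀ (v : Lp ℝ 2 ((volume : Measure (EE N)).restrict D)) , ∫ z in D, inner ℝ (v z) ((0 : Lp ℝ 2 ((volume : Measure (EE N)).restrict D)) z) = 0 := fun v => by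
      rw [integral_congr_ae (g := 0)]
      · simp
      filter_upwards [Lp.coeFn_zero (E := ℝ) 2 ((volume : Measure (EE N)).restrict D)] with z hz
      rw [hz]; simp
    simp only [e1, e2, zero_add] at this
    refine this.congr fun n => ?_
    refine integral_congr_ae ?_
    filter_upwards [(h (k n)).2.1.coeFn_toLp] with z hz
    rw [← hz]

/-- lower semicontinuity of the Dirichlet integral -/
lemma lsc_W {g : ℕ → EE N → EE N} {g0 : EE N → EE N} (hg : ∀ n, MemLp (g n) 2 (volume.restrict D)) (hg0 : MemLp g0 2 (volume.restrict D))
    (hw : Tendsto (fun n => ∫ z in D, inner ℝ (g n z) (g0 z)) atTop (𝓝 (∫ z in D, inner ℝ (g0 z) (g0 z)))) {a : ℕ → ℝ} {A : ℝ}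
    (ha : ∀ n, ∫ z in D, ‖g n z‖ ^ 2 ≤ a n) (hA : Tendsto a atTop (𝓝 A)) : ∫ z in D, ‖g0 z‖ ^ 2 ≤ A := by
  simp only [real_inner_self_eq_norm_sq] at hw
  have key : ∀ n, ∫ z in D, inner ℝ (g n z) (g0 z) ≤ a n / 2 + (∫ z in D, ‖g0 z‖ ^ 2) / 2 := fun n => by
    have i1 : Integrable (fun z => ‖g n z‖ ^ 2) (volume.restrict D) := (hg n).integrable_norm_pow two_ne_zero
    have i2 : Integrable (fun z => ‖g0 z‖ ^ 2) (volume.restrict D) := hg0.integrable_norm_pow two_ne_zero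
    calc ∫ z in D, inner ℝ (g n z) (g0 z) ≤ ∫ z in D, (‖g n z‖ ^ 2 / 2 + ‖g0 z‖ ^ 2 / 2) := by
          have hb : ∀ z, ‖(inner ℝ (g n z) (g0 z) : ℝ)‖ ≤ ‖g n z‖ ^ 2 / 2 + ‖g0 z‖ ^ 2 / 2 := fun z => by
            have := norm_inner_le_norm (𝕜 := ℝ) (g n z) (g0 z)
            nlinarith [sq_nonneg (‖g n z‖ - ‖g0 z‖)]
          have i3 := (i1.div_const 2).add (i2.div_const 2)
          refine integral_mono (i3.mono' ((hg n).1.inner hg0.1) (Eventually.of_forall hb)) i3 fun z => (le_abs_self _).trans (hb z)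
      _ = (∫ z in D, ‖g n z‖ ^ 2) / 2 + (∫ z in D, ‖g0 z‖ ^ 2) / 2 := by
          rw [integral_add (i1.div_const 2) (i2.div_const 2), integral_div, integral_div]
      _ ≤ _ := by linarith [ha n]
  have := le_of_tendsto_of_tendsto' hw ((hA.div_const 2).add_const _) key
  linarith

end P2sec


section P3sec
open scoped ENNReal NNReal Topology
variable {N : ℕ} {D : Set (EE N)}

lemma jensen_sq {X : Type*} [MeasurableSpace X] {ν : Measure X} [IsProbabilityMeasure ν] {f : X → ℝ}
    (hf : AEStronglyMeasurable f ν) : ‖∫ x, f x ∂ν‖ₑ ^ 2 ≤ ∫⁻ x, ‖f x‖ₑ ^ 2 ∂ν := by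
  have h1 := enorm_integral_le_lintegral_enorm (μ := ν) f
  rw [← eLpNorm_one_eq_lintegral_enorm] at h1
  have h2 := h1.trans (eLpNorm_le_eLpNorm_of_exponent_le (p := 1) (q := 2) (by norm_num) hf)
  calc ‖∫ x, f x ∂ν‖ₑ ^ 2 ≤ (eLpNorm f 2 ν) ^ 2 := by gcongr
    _ = _ := by
      have := eLpNorm_nnreal_pow_eq_lintegral (μ := ν) (f := f) (p := 2) (by norm_num)
      simpa using this

lemma eLpNorm2_sq {X F : Type*} [MeasurableSpace X] [NormedAddCommGroup F] (ν : Measure X) (f : X → F) :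
    (eLpNorm f 2 ν) ^ 2 = ∫⁻ x, ‖f x‖ₑ ^ 2 ∂ν := by
  have := eLpNorm_nnreal_pow_eq_lintegral (μ := ν) (f := f) (p := 2) (by norm_num)
  simpa using this

lemma TF.shift {φ : EE N → ℝ} (h : TF D φ) (y : EE N) :
    ∫⁻ x, ‖φ (x + y) - φ x‖ₑ ^ 2 ≤ ‖y‖ₑ ^ 2 * ∫⁻ x, ‖gradient φ x‖ₑ ^ 2 := by
  have cg := continuous_gradient' h.1
  let ν : Measure ℝ := volume.restrict (Set.Ioc 0 1)
  have hν : IsProbabilityMeasure ν := ⟨by simp [ν]⟩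
  have e1 : ∀ x, φ (x + y) - φ x = ∫ t, inner ℝ (gradient φ (x + t • y)) y ∂ν := fun x => by
    have hd : ∀ t : ℝ, HasDerivAt (fun t : ℝ => φ (x + t • y)) (inner ℝ (gradient φ (x + t • y)) y) t := fun t => by
      rw [inner_gradient']
      have h1 : HasDerivAt (fun t : ℝ => x + t • y) y t := by
        simpa using ((hasDerivAt_id t).smul_const y).const_add x
      exact (h.diff _).hasFDerivAt.comp_hasDerivAt t h1
    have := intervalIntegral.integral_eq_sub_of_hasDerivAt (a := 0) (b := 1) (fun t _ => hd t)
      ((by fun_prop : Continuous fun t : ℝ => (inner ℝ (gradient φ (x + t • y)) y : ℝ)).intervalIntegrable 0 1)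
    rw [intervalIntegral.integral_of_le zero_le_one] at this
    simp only [zero_smul, one_smul, add_zero] at this
    exact this.symm
  calc ∫⁻ x, ‖φ (x + y) - φ x‖ₑ ^ 2 ≤ ∫⁻ x, ∫⁻ t, ‖(inner ℝ (gradient φ (x + t • y)) y : ℝ)‖ₑ ^ 2 ∂ν := by
        refine lintegral_mono fun x => ?_
        rw [e1]
        exact jensen_sq (by fun_prop : Continuous fun t : ℝ => (inner ℝ (gradient φ (x + t • y)) y : ℝ)).aestronglyMeasurable
    _ = ∫⁻ t, (∫⁻ x, ‖(inner ℝ (gradient φ (x + t • y)) y : ℝ)‖ₑ ^ 2) ∂ν := by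
        refine lintegral_lintegral_swap ?_
        have : Continuous fun q : EE N × ℝ => (inner ℝ (gradient φ (q.1 + q.2 • y)) y : ℝ) := by fun_prop
        exact (this.measurable.enorm.pow_const 2).aemeasurable
    _ ≤ ∫⁻ t, (‖y‖ₑ ^ 2 * ∫⁻ x, ‖gradient φ x‖ₑ ^ 2) ∂ν := by
        refine lintegral_mono fun t => ?_
        calc ∫⁻ x, ‖(inner ℝ (gradient φ (x + t • y)) y : ℝ)‖ₑ ^ 2 
            ≤ ∫⁻ x, ‖y‖ₑ ^ 2 * ‖gradient φ (x + t • y)‖ₑ ^ 2 := by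
              refine lintegral_mono fun x => ?_
              rw [← mul_pow]
              gcongr
              rw [← enorm_norm y, ← enorm_norm (gradient φ (x + t • y)), ← enorm_mul]
              refine enorm_le_iff_norm_le.2 ?_ 
              rw [mul_comm]
              simpa using norm_inner_le_norm (𝕜 := ℝ) (gradient φ (x + t • y)) y
          _ = ‖y‖ₑ ^ 2 * ∫⁻ x, ‖gradient φ (x + t • y)‖ₑ ^ 2 := by
              rw [lintegral_const_mul' _ _ (by simp)]
          _ = _ := by
              rw [lintegral_add_right_eq_self (fun x => ‖gradient φ x‖ₑ ^ 2)]
    _ = _ := by simp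

/-- average over a ball -/
def avg (D : Set (EE N)) (r : ℝ) (u : EE N → ℝ) (x : EE N) : ℝ :=
  ∫ y in D, u y * (Metric.ball x r).indicator (fun _ => (volume.real (Metric.ball (0 : EE N) r))⁻¹) y

lemma TF.avg_eq {φ : EE N → ℝ} (h : TF D φ) {r : ℝ} (x : EE N) :
    avg D r φ x = (volume.real (Metric.ball (0 : EE N) r))⁻¹ * ∫ y in Metric.ball (0 : EE N) r, φ (x + y) := by
  unfold avg
  rw [setIntegral_eq_integral_of_forall_compl_eq_zero (fun y hy => by
    rw [image_eq_zero_of_notMem_tsupport fun h' => hy (h.2.2 h'), zero_mul]),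
    ← integral_const_mul, ← integral_indicator measurableSet_ball, ← integral_add_left_eq_self _ x]
  congr 1; ext y
  by_cases hy : y ∈ Metric.ball 0 r
  · have : x + y ∈ Metric.ball x r := by simpa [dist_eq_norm] using hy
    simp only [Set.indicator_of_mem, hy, this]; ring
  · have : x + y ∉ Metric.ball x r := by simpa [dist_eq_norm] using hy
    simp only [Set.indicator_of_notMem, hy, this, not_false_eq_true]; ring

lemma TF.avg_sub {φ : EE N → ℝ} (h : TF D φ) {r : ℝ} (hr : 0 < r) :
    ∫⁻ x, ‖avg D r φ x - φ x‖ₑ ^ 2 ≤ ENNReal.ofReal r ^ 2 * ∫⁻ x, ‖gradient φ x‖ₑ ^ 2 := by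
  let B := Metric.ball (0 : EE N) r
  let c : ℝ≥0∞ := (volume B)⁻¹
  have hB0 : volume B ≠ 0 := (Metric.measure_ball_pos volume _ hr).ne'
  have hB1 : volume B ≠ ∞ := measure_ball_lt_top.ne
  let ν : Measure (EE N) := c • volume.restrict B
  have hν : IsProbabilityMeasure ν := ⟨by simp [ν, c, ENNReal.inv_mul_cancel hB0 hB1]⟩
  have hcont := h.1.continuous
  have e1 : ∀ x, avg D r φ x - φ x = ∫ y, (φ (x + y) - φ x) ∂ν := fun x => by
    rw [integral_sub, h.avg_eq]
    · simp [ν, c, integral_smul_measure, Measure.real, ENNReal.toReal_inv, B]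
    · have i1 : Integrable φ volume := hcont.integrable_of_hasCompactSupport h.2.1
      exact ((i1.comp_add_left x).restrict).smul_measure (by simpa [c] using hB0)
    · exact integrable_const _
  calc ∫⁻ x, ‖avg D r φ x - φ x‖ₑ ^ 2 ≤ ∫⁻ x, ∫⁻ y, ‖φ (x + y) - φ x‖ₑ ^ 2 ∂ν := by
        refine lintegral_mono fun x => ?_
        rw [e1]
        exact jensen_sq (by fun_prop : Continuous fun y => φ (x + y) - φ x).aestronglyMeasurable
    _ = ∫⁻ y, (∫⁻ x, ‖φ (x + y) - φ x‖ₑ ^ 2) ∂ν := by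
        refine lintegral_lintegral_swap ?_
        have : Continuous fun q : EE N × EE N => φ (q.1 + q.2) - φ q.1 := by fun_prop
        exact (this.measurable.enorm.pow_const 2).aemeasurable
    _ ≤ ∫⁻ y, (ENNReal.ofReal r ^ 2 * ∫⁻ x, ‖gradient φ x‖ₑ ^ 2) ∂ν := by
        refine lintegral_mono_ae ?_
        have : ∀ᵐ y ∂ν, y ∈ B := by
          refine Measure.ae_smul_measure ?_ c
          exact ae_restrict_mem measurableSet_ball
        filter_upwards [this] with y hy
        refine (h.shift y).trans ?_
        gcongr
        rw [← ofReal_norm]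
        exact ENNReal.ofReal_le_ofReal (by simpa [B] using (le_of_lt (by simpa [B] using hy : ‖y‖ < r)))
    _ = _ := by simp

lemma avgker_memLp (hb : Bornology.IsBounded D) (r c : ℝ) (x : EE N) :
    MemLp ((Metric.ball x r).indicator (fun _ => c)) 2 (volume.restrict D) := by
  have := finMeas hb
  exact (memLp_const c).indicator measurableSet_ball

lemma avg_meas (r : ℝ) {u : EE N → ℝ} (hu : AEStronglyMeasurable u (volume.restrict D)) (μ : Measure (EE N)) [SFinite μ] :
    AEStronglyMeasurable (avg D r u) μ := by
  unfold avg
  refine AEStronglyMeasurable.integral_prod_right' (f := fun q : EE N × EE N => u q.2 * (Metric.ball q.1 r).indicator (fun _ => (volume.real (Metric.ball (0 : EE N) r))⁻¹) q.2) ?_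
  refine hu.comp_snd.mul ?_
  have : (fun q : EE N × EE N => (Metric.ball q.1 r).indicator (fun _ => (volume.real (Metric.ball (0 : EE N) r))⁻¹) q.2)
      = {q : EE N × EE N | dist q.2 q.1 < r}.indicator (fun _ => (volume.real (Metric.ball (0 : EE N) r))⁻¹) := by
    ext q; simp [Set.indicator]
  rw [this]
  exact (stronglyMeasurable_const.indicator (isOpen_lt (by fun_prop) (by fun_prop)).measurableSet).aestronglyMeasurable

lemma IsW.avg_sub (hD : IsOpen D) (hb : Bornology.IsBounded D) {u : EE N → ℝ} {g : EE N → EE N} (h : IsW D u g) {r : ℝ} (hr : 0 < r) :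
    eLpNorm (avg D r u - u) 2 (volume.restrict D) ≤ ENNReal.ofReal r * eLpNorm g 2 (volume.restrict D) := by
  obtain ⟨φ, hφ, h1, h2, h3⟩ := h.seq
  have hTF : ∀ n, eLpNorm (avg D r (φ n) - φ n) 2 (volume.restrict D) ≤ ENNReal.ofReal r * eLpNorm (gradient (φ n)) 2 (volume.restrict D) := fun n => by
    rw [(hφ n).restrict_eLpNorm_grad _ hD.measurableSet]
    refine (eLpNorm_mono_measure _ Measure.restrict_le_self).trans ?_
    rw [← ENNReal.pow_le_pow_left_iff two_ne_zero, mul_pow, eLpNorm2_sq, eLpNorm2_sq]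
    exact (hφ n).avg_sub hr
  have hav : ∀ x, Tendsto (fun n => avg D r (φ n) x) atTop (𝓝 (avg D r u x)) := fun x =>
    tendsto_integral_of_L2 (fun n => (hφ n).memLp 2) h.1 (avgker_memLp hb r _ x) h1
  have h3' : ∀ᵐ z ∂(volume.restrict D), Tendsto (fun n => (avg D r (φ n) - φ n) z) atTop (𝓝 ((avg D r u - u) z)) := by
    filter_upwards [h3] with z hz
    exact (hav z).sub hz
  have hle : ∀ n, eLpNorm (gradient (φ n)) 2 (volume.restrict D) ≤ eLpNorm (gradient (φ n) - g) 2 (volume.restrict D) + eLpNorm g 2 (volume.restrict D) := fun n => by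
    have := eLpNorm_add_le (((hφ n).memLp_grad 2).sub h.2.1).1 h.2.1.1 (p := 2) (by norm_num)
    simpa using this
  have hlim : Tendsto (fun n => ENNReal.ofReal r * (eLpNorm (gradient (φ n) - g) 2 (volume.restrict D) + eLpNorm g 2 (volume.restrict D))) atTop (𝓝 (ENNReal.ofReal r * eLpNorm g 2 (volume.restrict D))) := by
    refine ENNReal.Tendsto.const_mul ?_ (Or.inr ENNReal.ofReal_ne_top)
    simpa using h2.add_const _
  have := Lp.eLpNorm_lim_le_liminf_eLpNorm (p := 2) (fun n => (avg_meas r ((hφ n).memLp 2).1 (volume.restrict D)).sub ((hφ n).memLp 2).1) _ h3'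
  refine this.trans ((liminf_le_liminf (Eventually.of_forall fun n => (hTF n).trans ?_)).trans hlim.liminf_eq.le)
  gcongr
  exact hle n

lemma rellich (hD : IsOpen D) (hb : Bornology.IsBounded D) {v : ℕ → EE N → ℝ} {g : ℕ → EE N → EE N} (h : ∀ n, IsW D (v n) (g n)) {M : ℝ≥0}
    (hv : ∀ n, eLpNorm (v n) 2 (volume.restrict D) ≤ M) (hg : ∀ n, eLpNorm (g n) 2 (volume.restrict D) ≤ M)
    (hw : ∀ w, MemLp w 2 (volume.restrict D) → Tendsto (fun n => ∫ z in D, v n z * w z) atTop (𝓝 0)) :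
    Tendsto (fun n => eLpNorm (v n) 2 (volume.restrict D)) atTop (𝓝 0) := by
  have := finMeas hb
  obtain ⟨M1, hM1⟩ : ∃ M1 : ℝ≥0, ∀ n, eLpNorm (v n) 1 (volume.restrict D) ≤ M1 := by
    let c : ℝ≥0∞ := (volume.restrict D) Set.univ ^ (1 / (1 : ℝ≥0∞).toReal - 1 / (2 : ℝ≥0∞).toReal)
    have hc : c ≠ ∞ := ENNReal.rpow_ne_top_of_nonneg (by norm_num) (measure_ne_top _ _)
    refine ⟨M * c.toNNReal, fun n => ?_⟩
    refine (eLpNorm_le_eLpNorm_mul_rpow_measure_univ (p := 1) (q := 2) (by norm_num) (h n).1.1).trans ?_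
    push_cast
    rw [ENNReal.coe_toNNReal hc]
    gcongr
    exact hv n
  have hav : ∀ r, 0 < r → Tendsto (fun n => eLpNorm (avg D r (v n)) 2 (volume.restrict D)) atTop (𝓝 0) := fun r hr => by
    let c := (volume.real (Metric.ball (0 : EE N) r))⁻¹
    have hc : 0 ≤ c := by positivity
    refine tendsto_eLpNorm_dom (by norm_num) (by norm_num) (fun n => avg_meas r (h n).1.1 _) (memLp_const (M1 * c : ℝ)) ?_ ?_
    · intro n
      refine Eventually.of_forall fun x => ?_
      rw [Real.norm_of_nonneg (by positivity : (0 : ℝ) ≤ M1 * c)]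
      have i1 : Integrable (v n) (volume.restrict D) := (h n).1.integrable (by norm_num)
      calc ‖avg D r (v n) x‖ ≤ ∫ y in D, ‖v n y‖ * c := by
            refine norm_integral_le_of_norm_le (i1.norm.mul_const c) (Eventually.of_forall fun y => ?_)
            rw [norm_mul]
            gcongr
            refine (norm_indicator_le_norm_self _ _).trans ?_
            exact (Real.norm_of_nonneg hc).le
        _ = (∫ y in D, ‖v n y‖) * c := integral_mul_const _ _
        _ ≤ M1 * c := by
            gcongr
            have := hM1 n
            rw [eLpNorm_one_eq_lintegral_enorm] at this
            rw [integral_norm_eq_lintegral_enorm i1.1]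
            exact ENNReal.toReal_le_coe_of_le_coe this
    · exact Eventually.of_forall fun x => hw _ (avgker_memLp hb r _ x)
  rw [ENNReal.tendsto_nhds_zero]
  intro ε hε
  obtain ⟨r, hr, hr2⟩ : ∃ r : ℝ, 0 < r ∧ ENNReal.ofReal r * M ≤ ε / 2 := by
    have : Tendsto (fun r : ℝ => ENNReal.ofReal r * M) (𝓝[>] 0) (𝓝 (ENNReal.ofReal 0 * M)) := by
      refine ENNReal.Tendsto.mul_const ?_ (Or.inr ENNReal.coe_ne_top)
      exact (ENNReal.continuous_ofReal.tendsto 0).mono_left nhdsWithin_le_nhds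
    simp only [ENNReal.ofReal_zero, zero_mul] at this
    obtain ⟨r, h1, h2⟩ := ((this.eventually (ge_mem_nhds (ENNReal.half_pos hε.ne'))).and self_mem_nhdsWithin).exists
    exact ⟨r, h2, h1⟩
  filter_upwards [(hav r hr).eventually (ge_mem_nhds (ENNReal.half_pos hε.ne'))] with n hn
  calc eLpNorm (v n) 2 (volume.restrict D) = eLpNorm (avg D r (v n) - (avg D r (v n) - v n)) 2 (volume.restrict D) := by
        congr 1; abel
    _ ≤ _ := eLpNorm_sub_le (avg_meas r (h n).1.1 _) ((avg_meas r (h n).1.1 _).sub (h n).1.1) (by norm_num)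
    _ ≤ ε / 2 + ε / 2 := by
        refine add_le_add hn (((h n).avg_sub hD hb hr).trans (le_trans ?_ hr2))
        gcongr
        exact hg n
    _ = ε := ENNReal.add_halves ε

end P3sec


section P4sec
open scoped ENNReal NNReal Topology
variable {N : ℕ} {D : Set (EE N)}

lemma int_rpow {X F : Type*} [MeasurableSpace X] {μ : Measure X} [NormedAddCommGroup F] {f : X → F} {q : ℝ≥0} (hq : q ≠ 0)
    (hf : MemLp f q μ) : ∫ x, ‖f x‖ ^ (q : ℝ) ∂μ = (eLpNorm f q μ).toReal ^ (q : ℝ) := by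
  have hq' : (0 : ℝ) < q := by exact_mod_cast pos_iff_ne_zero.2 hq
  have h0 : 0 ≤ ∫ x, ‖f x‖ ^ (q : ℝ) ∂μ := integral_nonneg fun x => by positivity
  rw [hf.eLpNorm_eq_integral_rpow_norm (by exact_mod_cast hq) (by simp), ENNReal.toReal_ofReal (by positivity)]
  simp only [ENNReal.coe_toReal]
  rw [← Real.rpow_mul h0, inv_mul_cancel₀ hq'.ne', Real.rpow_one]

lemma int_sq {X F : Type*} [MeasurableSpace X] {μ : Measure X} [NormedAddCommGroup F] {f : X → F}
    (hf : MemLp f 2 μ) : ∫ x, ‖f x‖ ^ 2 ∂μ = (eLpNorm f 2 μ).toReal ^ 2 := by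
  have := int_rpow (q := 2) two_ne_zero (μ := μ) (f := f) (by simpa using hf)
  simpa using this

lemma tendsto_int_rpow {q : ℝ≥0} (hq : 1 ≤ q) {μ : Measure (EE N)} {f : ℕ → EE N → ℝ} {f0 : EE N → ℝ} (hf : ∀ n, MemLp (f n) q μ) (hf0 : MemLp f0 q μ)
    (h : Tendsto (fun n => eLpNorm (f n - f0) q μ) atTop (𝓝 0)) :
    Tendsto (fun n => ∫ x, ‖f n x‖ ^ (q : ℝ) ∂μ) atTop (𝓝 (∫ x, ‖f0 x‖ ^ (q : ℝ) ∂μ)) := by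
  have hq0 : q ≠ 0 := (zero_lt_one.trans_le hq).ne'
  have hq1 : (1 : ℝ≥0∞) ≤ q := by exact_mod_cast hq
  rw [int_rpow hq0 hf0]
  simp_rw [fun n => int_rpow hq0 (hf n)]
  have hlim : Tendsto (fun n => eLpNorm (f n) q μ) atTop (𝓝 (eLpNorm f0 q μ)) := by
    have hle : ∀ n, eLpNorm (f n) q μ ≤ eLpNorm (f n - f0) q μ + eLpNorm f0 q μ := fun n => by
      have := eLpNorm_add_le ((hf n).sub hf0).1 hf0.1 hq1
      simpa using this
    have hge : ∀ n, eLpNorm f0 q μ - eLpNorm (f n - f0) q μ ≤ eLpNorm (f n) q μ := fun n => by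
      rw [tsub_le_iff_right]
      have := eLpNorm_sub_le (hf n).1 ((hf n).sub hf0).1 hq1
      simpa using this
    refine tendsto_of_tendsto_of_tendsto_of_le_of_le ?_ ?_ hge hle
    · simpa using ENNReal.Tendsto.sub tendsto_const_nhds h (Or.inl hf0.2.ne)
    · simpa using h.add_const _
  refine Tendsto.rpow_const ?_ (Or.inr q.2)
  exact (ENNReal.tendsto_toReal hf0.2.ne).comp hlim

lemma tendsto_int_wt {q : ℝ≥0} (hq : 1 ≤ q) {μ : Measure (EE N)} {wt : EE N → ℝ} {a1 : ℝ} (hwm : AEStronglyMeasurable wt μ) (hw : ∀ᵐ z ∂μ, 0 ≤ wt z ∧ wt z ≤ a1) {f : ℕ → EE N → ℝ} {f0 : EE N → ℝ} (hf : ∀ n, MemLp (f n) q μ) (hf0 : MemLp f0 q μ)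
    (h : Tendsto (fun n => eLpNorm (f n - f0) q μ) atTop (𝓝 0)) :
    Tendsto (fun n => ∫ x, wt x * |f n x| ^ (q : ℝ) ∂μ) atTop (𝓝 (∫ x, wt x * |f0 x| ^ (q : ℝ) ∂μ)) := by
  have hq0 : q ≠ 0 := (zero_lt_one.trans_le hq).ne'
  have hq' : (0 : ℝ) < q := by exact_mod_cast pos_iff_ne_zero.2 hq0
  let c : EE N → ℝ := fun z => wt z ^ (q : ℝ)⁻¹
  have hc : AEStronglyMeasurable c μ := (hwm.aemeasurable.pow_const _).aestronglyMeasurable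
  have hcb : ∀ᵐ z ∂μ, ‖c z‖ ≤ a1 ^ (q : ℝ)⁻¹ := by
    filter_upwards [hw] with z hz
    have := Real.rpow_nonneg hz.1 (q : ℝ)⁻¹
    rw [Real.norm_of_nonneg this]
    exact Real.rpow_le_rpow hz.1 hz.2 (by positivity)
  have hm : ∀ f, MemLp f q μ → MemLp (fun z => c z * f z) q μ := fun f hf => by
    refine MemLp.of_le_mul hf (hc.mul hf.1) (c := a1 ^ (q : ℝ)⁻¹) ?_
    filter_upwards [hcb] with z hz
    rw [norm_mul]; gcongr
  have he : ∀ f : EE N → ℝ, ∫ x, wt x * |f x| ^ (q : ℝ) ∂μ = ∫ x, ‖c x * f x‖ ^ (q : ℝ) ∂μ := fun f => by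
    refine integral_congr_ae ?_
    filter_upwards [hw] with z hz
    rw [norm_mul, Real.mul_rpow (norm_nonneg _) (norm_nonneg _), Real.norm_of_nonneg (Real.rpow_nonneg hz.1 _), ← Real.rpow_mul hz.1, inv_mul_cancel₀ hq'.ne', Real.rpow_one, Real.norm_eq_abs]
  simp_rw [he]
  refine tendsto_int_rpow hq (fun n => hm _ (hf n)) (hm _ hf0) ?_
  have hb : ∀ n, eLpNorm ((fun z => c z * f n z) - (fun z => c z * f0 z)) q μ ≤ ENNReal.ofReal (a1 ^ (q : ℝ)⁻¹) * eLpNorm (f n - f0) q μ := fun n => by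
    refine eLpNorm_le_mul_eLpNorm_of_ae_le_mul ?_ _
    filter_upwards [hcb] with z hz
    simp only [Pi.sub_apply, ← mul_sub, norm_mul]
    gcongr
  refine tendsto_of_tendsto_of_tendsto_of_le_of_le tendsto_const_nhds ?_ (fun _ => zero_le) hb
  simpa using ENNReal.Tendsto.const_mul h (Or.inr ENNReal.ofReal_ne_top)

lemma split_rpow {q r t T : ℝ} (h2 : 2 ≤ q) (hr : q ≤ r) (ht : 0 ≤ t) (hT : 0 < T) :
    t ^ q ≤ T ^ (q - r) * t ^ r + T ^ (q - 2) * t ^ 2 := by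
  rcases le_total t T with h | h
  · have : t ^ q ≤ T ^ (q - 2) * t ^ 2 := by
      have e : t ^ q = t ^ (q - 2) * t ^ (2 : ℕ) := by
        rw [← Real.rpow_natCast, ← Real.rpow_add_of_nonneg ht (by linarith) (by norm_num)]; norm_num
      rw [e]; gcongr
    have : 0 ≤ T ^ (q - r) * t ^ r := by positivity
    linarith
  · have ht' : 0 < t := hT.trans_le h
    have : t ^ q ≤ T ^ (q - r) * t ^ r := by
      have e : t ^ q = t ^ (q - r) * t ^ r := by
        rw [← Real.rpow_add ht']; norm_num
      rw [e]; gcongr ?_ * _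
      exact Real.rpow_le_rpow_of_nonpos hT h (by linarith)
    have : 0 ≤ T ^ (q - 2) * t ^ 2 := by positivity
    linarith

lemma interp {q r : ℝ≥0} (h2 : 2 ≤ q) (hr : q < r) {μ : Measure (EE N)} {v : ℕ → EE N → ℝ} (hv : ∀ n, MemLp (v n) 2 μ) (hvr : ∀ n, MemLp (v n) r μ) {M : ℝ≥0}
    (hM : ∀ n, eLpNorm (v n) r μ ≤ M) (h : Tendsto (fun n => eLpNorm (v n) 2 μ) atTop (𝓝 0)) (hvq : ∀ n, MemLp (v n) q μ) :
    Tendsto (fun n => eLpNorm (v n) q μ) atTop (𝓝 0) := by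
  have h2' : (2 : ℝ) ≤ q := by exact_mod_cast h2
  have hr' : (q : ℝ) < r := by exact_mod_cast hr
  have hq0 : q ≠ 0 := (zero_lt_two.trans_le h2).ne'
  have hr0 : r ≠ 0 := ((zero_lt_two.trans_le h2).trans hr).ne'
  have key : ∀ n (T : ℝ), 0 < T → ∫ z, ‖v n z‖ ^ (q : ℝ) ∂μ ≤ T ^ ((q : ℝ) - r) * (M : ℝ) ^ (r : ℝ) + T ^ ((q : ℝ) - 2) * (eLpNorm (v n) 2 μ).toReal ^ 2 := fun n T hT => by
    have i1 := (hvr n).integrable_norm_rpow (by exact_mod_cast hr0) (by simp)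
    have i2 := (hv n).integrable_norm_pow two_ne_zero
    have i3 := (hvq n).integrable_norm_rpow (by exact_mod_cast hq0) (by simp)
    simp only [ENNReal.coe_toReal] at i1 i3
    calc ∫ z, ‖v n z‖ ^ (q : ℝ) ∂μ ≤ ∫ z, (T ^ ((q : ℝ) - r) * ‖v n z‖ ^ (r : ℝ) + T ^ ((q : ℝ) - 2) * ‖v n z‖ ^ 2) ∂μ :=
          integral_mono i3 ((i1.const_mul _).add (i2.const_mul _)) fun z => split_rpow h2' hr'.le (norm_nonneg _) hT
      _ = T ^ ((q : ℝ) - r) * (eLpNorm (v n) r μ).toReal ^ (r : ℝ) + T ^ ((q : ℝ) - 2) * (eLpNorm (v n) 2 μ).toReal ^ 2 := by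
          rw [integral_add (i1.const_mul _) (i2.const_mul _), integral_const_mul, integral_const_mul, int_sq (hv n), int_rpow hr0 (hvr n)]
      _ ≤ _ := by
          gcongr
          exact ENNReal.toReal_le_coe_of_le_coe (hM n)
  have hlim2 : Tendsto (fun n => (eLpNorm (v n) 2 μ).toReal ^ 2) atTop (𝓝 0) := by
    simpa using ((ENNReal.tendsto_toReal ENNReal.zero_ne_top).comp h).pow 2
  have hIntg : Tendsto (fun n => ∫ z, ‖v n z‖ ^ (q : ℝ) ∂μ) atTop (𝓝 0) := by
    rw [Metric.tendsto_atTop']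
    intro ε hε
    have t1 : Tendsto (fun T : ℝ => T ^ ((q : ℝ) - r) * (M : ℝ) ^ (r : ℝ)) atTop (𝓝 (0 * (M : ℝ) ^ (r : ℝ))) := by
      refine Tendsto.mul_const _ ?_
      have := tendsto_rpow_neg_atTop (y := (r : ℝ) - q) (by linarith)
      simpa using this
    rw [zero_mul] at t1
    obtain ⟨T, hT1, hT2⟩ := ((t1.eventually (gt_mem_nhds (half_pos hε))).and (eventually_gt_atTop 0)).exists
    have t2 : Tendsto (fun n => T ^ ((q : ℝ) - 2) * (eLpNorm (v n) 2 μ).toReal ^ 2) atTop (𝓝 0) := by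
      simpa using hlim2.const_mul (T ^ ((q : ℝ) - 2))
    obtain ⟨n0, hn0⟩ := eventually_atTop.1 (t2.eventually (gt_mem_nhds (half_pos hε)))
    refine ⟨n0, fun n hn => ?_⟩
    have : 0 ≤ ∫ z, ‖v n z‖ ^ (q : ℝ) ∂μ := integral_nonneg fun x => by positivity
    rw [dist_zero_right, Real.norm_of_nonneg this]
    have := key n T hT2
    have := hn0 n hn.le
    linarith
  have e : ∀ n, eLpNorm (v n) q μ = ENNReal.ofReal ((∫ z, ‖v n z‖ ^ (q : ℝ) ∂μ) ^ (q : ℝ)⁻¹) := fun n => by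
    have := (hvq n).eLpNorm_eq_integral_rpow_norm (by exact_mod_cast hq0) (by simp)
    simpa using this
  simp_rw [e]
  have hq' : (0 : ℝ) < q := by linarith
  have := ENNReal.tendsto_ofReal (hIntg.rpow_const (p := (q : ℝ)⁻¹) (Or.inr (by positivity)))
  simpa [Real.zero_rpow (inv_pos.2 hq').ne'] using this

/-- the critical exponent -/
def sst (N : ℕ) : ℝ≥0 := (2 * (N : ℝ) / ((N : ℝ) - 2)).toNNReal

lemma sst_coe (hN : 3 ≤ N) : (sst N : ℝ) = 2 * (N : ℝ) / ((N : ℝ) - 2) := by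
  have : (3 : ℝ) ≤ N := by exact_mod_cast hN
  exact Real.coe_toNNReal _ (div_nonneg (by linarith) (by linarith))

lemma sst_inv (hN : 3 ≤ N) : (sst N : ℝ)⁻¹ = (2 : ℝ)⁻¹ - (N : ℝ)⁻¹ := by
  have : (3 : ℝ) ≤ N := by exact_mod_cast hN
  rw [sst_coe hN]
  have h1 : (N : ℝ) - 2 ≠ 0 := by linarith
  have h2 : (N : ℝ) ≠ 0 := by linarith
  field_simp

lemma sst_gt (hN : 3 ≤ N) : (2 : ℝ) < sst N := by
  have : (3 : ℝ) ≤ N := by exact_mod_cast hN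
  rw [sst_coe hN, lt_div_iff₀ (by linarith)]
  linarith

lemma sob_q (hN : 3 ≤ N) (hD : IsOpen D) (hb : Bornology.IsBounded D) {q : ℝ≥0} (hq0 : 0 < q) (hq : q ≤ sst N) :
    ∃ C : ℝ≥0, ∀ u g, IsW D u g →
      eLpNorm u q (volume.restrict D) ≤ C * eLpNorm g 2 (volume.restrict D) := by
  refine sobolev_W hN hD hb ?_
  rw [← sst_inv hN]
  have : (q : ℝ) ≤ sst N := by exact_mod_cast hq
  have : (0 : ℝ) < q := by exact_mod_cast hq0
  gcongr

lemma IsW.memLp_q (hN : 3 ≤ N) (hD : IsOpen D) (hb : Bornology.IsBounded D) {u : EE N → ℝ} {g : EE N → EE N} (h : IsW D u g)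
    {q : ℝ≥0} (hq0 : 0 < q) (hq : q ≤ sst N) : MemLp u q (volume.restrict D) := by
  obtain ⟨C, hC⟩ := sob_q hN hD hb hq0 hq
  exact ⟨h.1.1, (hC u g h).trans_lt (ENNReal.mul_lt_top ENNReal.coe_lt_top h.2.1.2)⟩

theorem compact_W (hN : 3 ≤ N) (hD : IsOpen D) (hb : Bornology.IsBounded D) {u : ℕ → EE N → ℝ} {g : ℕ → EE N → EE N} (h : ∀ n, IsW D (u n) (g n)) {M : ℝ≥0}
    (hg : ∀ n, eLpNorm (g n) 2 (volume.restrict D) ≤ M) :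
    ∃ u0 g0, ∃ k : ℕ → ℕ, StrictMono k ∧ IsW D u0 g0 ∧
      (∀ᵐ z ∂(volume.restrict D), Tendsto (fun n => u (k n) z) atTop (𝓝 (u0 z))) ∧
      (∀ q : ℝ≥0, 2 ≤ q → q < sst N → Tendsto (fun n => eLpNorm (u (k n) - u0) q (volume.restrict D)) atTop (𝓝 0)) ∧
      (∀ w, MemLp w 2 (volume.restrict D) → Tendsto (fun n => ∫ z in D, inner ℝ (g (k n) z) (w z)) atTop (𝓝 (∫ z in D, inner ℝ (g0 z) (w z)))) := by
  have h2s : (2 : ℝ≥0) < sst N := by exact_mod_cast sst_gt hN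
  obtain ⟨C2, hC2⟩ := sob_q hN hD hb (q := 2) (by norm_num) h2s.le
  obtain ⟨Cs, hCs⟩ := sob_q hN hD hb (q := sst N) (by linarith [h2s, (zero_lt_two : (0 : ℝ≥0) < 2)]) le_rfl
  have b1 : ∀ n, eLpNorm (u n) 2 (volume.restrict D) ≤ ((max 1 C2 * M : ℝ≥0) : ℝ≥0∞) := fun n => by
    refine (hC2 _ _ (h n)).trans ?_
    push_cast
    gcongr
    · exact le_max_right _ _
    · exact hg n
  have b2 : ∀ n, eLpNorm (g n) 2 (volume.restrict D) ≤ ((max 1 C2 * M : ℝ≥0) : ℝ≥0∞) := fun n => by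
    refine (hg n).trans ?_
    rw [ENNReal.coe_le_coe]
    exact le_mul_of_one_le_left (zero_le) (le_max_left _ _)
  obtain ⟨u0, g0, k, hk, hw, hl1, hl2⟩ := weak_compact_W h b1 b2
  have hs : ∀ n, IsW D (u (k n) - u0) (g (k n) - g0) := fun n => (h (k n)).sub hw
  have bg : ∀ n, eLpNorm (g (k n) - g0) 2 (volume.restrict D) ≤ ((M + (eLpNorm g0 2 (volume.restrict D)).toNNReal : ℝ≥0) : ℝ≥0∞) := fun n => by
    refine (eLpNorm_sub_le (h (k n)).2.1.1 hw.2.1.1 (by norm_num)).trans ?_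
    push_cast
    rw [ENNReal.coe_toNNReal hw.2.1.2.ne]
    gcongr
    exact hg _
  set M' := (M + (eLpNorm g0 2 (volume.restrict D)).toNNReal : ℝ≥0)
  have t2 : Tendsto (fun n => eLpNorm (u (k n) - u0) 2 (volume.restrict D)) atTop (𝓝 0) := by
    refine rellich hD hb hs (M := max 1 C2 * M') (fun n => ?_) (fun n => ?_) ?_
    · refine (hC2 _ _ (hs n)).trans ?_
      push_cast
      gcongr
      · exact le_max_right _ _
      · exact bg n
    · refine (bg n).trans ?_
      rw [ENNReal.coe_le_coe]
      exact le_mul_of_one_le_left (zero_le) (le_max_left _ _)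
    · intro w hww
      have e : ∀ n, ∫ z in D, (u (k n) - u0) z * w z = (∫ z in D, u (k n) z * w z) - ∫ z in D, u0 z * w z := fun n => by
        have := integral_sub ((h (k n)).1.integrable_mul hww) (hw.1.integrable_mul hww)
        simp only [Pi.mul_apply] at this
        rw [← this]
        simp [sub_mul]
      simp_rw [e]
      have := (hl1 w hww).sub_const (∫ z in D, u0 z * w z)
      simpa using this
  have tq : ∀ q : ℝ≥0, 2 ≤ q → q < sst N → Tendsto (fun n => eLpNorm (u (k n) - u0) q (volume.restrict D)) atTop (𝓝 0) := fun q h2q hqs => by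
    have hq0 : 0 < q := zero_lt_two.trans_le h2q
    refine interp (M := Cs * M') h2q hqs (fun n => (hs n).1) (fun n => (hs n).memLp_q hN hD hb (hq0.trans hqs) le_rfl) (fun n => ?_) t2 (fun n => (hs n).memLp_q hN hD hb hq0 hqs.le)
    refine (hCs _ _ (hs n)).trans ?_
    push_cast
    gcongr
    exact bg n
  obtain ⟨j, hj, hae⟩ := (tendstoInMeasure_of_tendsto_eLpNorm (by norm_num : (2 : ℝ≥0∞) ≠ 0) (fun n => (h (k n)).1.1) hw.1.1 t2).exists_seq_tendsto_ae
  exact ⟨u0, g0, k ∘ j, hk.comp hj, hw, hae, fun q h1 h2 => (tq q h1 h2).comp hj.tendsto_atTop, fun w hw => (hl2 w hw).comp hj.tendsto_atTop⟩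

end P4sec


section P5sec
open scoped ENNReal NNReal Topology
variable {N : ℕ} {D : Set (EE N)}

/-- data of the variational problem -/
structure Prob (N : ℕ) (D : Set (EE N)) (wt : EE N → ℝ) (a0 a1 p lam : ℝ) : Prop where
  hN : 3 ≤ N
  hD : IsOpen D
  hb : Bornology.IsBounded D
  hne : D.Nonempty
  hwm : Measurable wt
  ha0 : 0 < a0
  hw0 : ∀ z ∈ D, a0 ≤ wt z
  hw1 : ∀ z ∈ D, wt z ≤ a1
  hp : 1 < p
  hp' : p + 1 < sst N
  hlam : 0 < lam

def Af (D : Set (EE N)) (wt : EE N → ℝ) (lam : ℝ) (u : EE N → ℝ) (g : EE N → EE N) : ℝ :=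
  (∫ z in D, ‖g z‖ ^ 2) + lam * ∫ z in D, wt z * u z ^ 2

def Bf (D : Set (EE N)) (wt : EE N → ℝ) (p : ℝ) (u : EE N → ℝ) : ℝ :=
  ∫ z in D, wt z * |u z| ^ (p + 1)

def Ff (p A B : ℝ) : ℝ := (A / B) ^ ((p + 1) / (p - 1)) * B

variable {wt : EE N → ℝ} {a0 a1 p lam : ℝ}

lemma Prob.aew (P : Prob N D wt a0 a1 p lam) : ∀ᵐ z ∂(volume.restrict D), a0 ≤ wt z ∧ wt z ≤ a1 := by
  filter_upwards [ae_restrict_mem P.hD.measurableSet] with z hz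
  exact ⟨P.hw0 z hz, P.hw1 z hz⟩

lemma Prob.a1pos (P : Prob N D wt a0 a1 p lam) : 0 < a1 := by
  obtain ⟨z, hz⟩ := P.hne
  linarith [P.ha0, P.hw0 z hz, P.hw1 z hz]

/-- multiplication by the weight preserves integrability -/
lemma Prob.wint (P : Prob N D wt a0 a1 p lam) {f : EE N → ℝ} (hf : Integrable f (volume.restrict D)) :
    Integrable (fun z => wt z * f z) (volume.restrict D) := by
  refine (hf.norm.const_mul a1).mono' (P.hwm.aestronglyMeasurable.mul hf.1) ?_
  filter_upwards [P.aew] with z hz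
  rw [norm_mul, Real.norm_of_nonneg (P.ha0.le.trans hz.1)]
  gcongr
  exact hz.2

/-- exponent as NNReal -/
def qq (p : ℝ) : ℝ≥0 := (p + 1).toNNReal

lemma Prob.qq_coe (P : Prob N D wt a0 a1 p lam) : (qq p : ℝ) = p + 1 := Real.coe_toNNReal _ (by linarith [P.hp])
lemma Prob.qq2 (P : Prob N D wt a0 a1 p lam) : 2 ≤ qq p := by
  rw [← NNReal.coe_le_coe, P.qq_coe]; push_cast; linarith [P.hp]
lemma Prob.qqs (P : Prob N D wt a0 a1 p lam) : qq p < sst N := by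
  rw [← NNReal.coe_lt_coe, P.qq_coe]; exact P.hp'
lemma Prob.qq0 (P : Prob N D wt a0 a1 p lam) : 0 < qq p := zero_lt_two.trans_le P.qq2

lemma Prob.memq (P : Prob N D wt a0 a1 p lam) {u : EE N → ℝ} {g : EE N → EE N} (h : IsW D u g) :
    MemLp u (qq p) (volume.restrict D) := h.memLp_q P.hN P.hD P.hb P.qq0 P.qqs.le

lemma Prob.iq (P : Prob N D wt a0 a1 p lam) {u : EE N → ℝ} {g : EE N → EE N} (h : IsW D u g) :
    Integrable (fun z => |u z| ^ (p + 1)) (volume.restrict D) := by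
  have := (P.memq h).integrable_norm_rpow (by exact_mod_cast P.qq0.ne') (by simp)
  simpa [P.qq_coe] using this

lemma Prob.i2 {u : EE N → ℝ} {g : EE N → EE N} (h : IsW D u g) :
    Integrable (fun z => (u z) ^ 2) (volume.restrict D) := by
  simpa using h.1.integrable_norm_pow two_ne_zero

lemma Prob.ig {u : EE N → ℝ} {g : EE N → EE N} (h : IsW D u g) :
    Integrable (fun z => ‖g z‖ ^ 2) (volume.restrict D) := h.2.1.integrable_norm_pow two_ne_zero

lemma Af_smul (t : ℝ) (u : EE N → ℝ) (g : EE N → EE N) : Af D wt lam (t • u) (t • g) = t ^ 2 * Af D wt lam u g := by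
  simp only [Af, Pi.smul_apply, norm_smul, mul_pow, smul_eq_mul, integral_const_mul, Real.norm_eq_abs, sq_abs]
  rw [show (∫ z in D, wt z * (t ^ 2 * u z ^ 2)) = t ^ 2 * ∫ z in D, wt z * u z ^ 2 by
    rw [← integral_const_mul]; congr 1; ext z; ring]
  ring

lemma Bf_smul {t : ℝ} (ht : 0 ≤ t) (u : EE N → ℝ) : Bf D wt p (t • u) = t ^ (p + 1) * Bf D wt p u := by
  simp only [Bf, Pi.smul_apply, smul_eq_mul]
  rw [← integral_const_mul]; congr 1; ext z
  rw [abs_mul, abs_of_nonneg ht, Real.mul_rpow ht (abs_nonneg _)]; ring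

lemma Bf_congr {u u' : EE N → ℝ} (h : u =ᵐ[volume.restrict D] u') : Bf D wt p u = Bf D wt p u' := by
  refine integral_congr_ae ?_
  filter_upwards [h] with z hz
  rw [hz]

lemma Af_congr {u u' : EE N → ℝ} {g g' : EE N → EE N} (h : u =ᵐ[volume.restrict D] u') (h' : g =ᵐ[volume.restrict D] g') :
    Af D wt lam u g = Af D wt lam u' g' := by
  unfold Af
  congr 1
  · refine integral_congr_ae ?_
    filter_upwards [h'] with z hz
    rw [hz]
  · congr 1
    refine integral_congr_ae ?_
    filter_upwards [h] with z hz
    rw [hz]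

lemma Prob.sob (P : Prob N D wt a0 a1 p lam) : ∃ C : ℝ, 0 < C ∧ ∀ u g, IsW D u g →
    Bf D wt p u ≤ C * (∫ z in D, ‖g z‖ ^ 2) ^ ((p + 1) / 2) := by
  obtain ⟨C, hC⟩ := sob_q P.hN P.hD P.hb P.qq0 P.qqs.le
  have hp := P.hp
  refine ⟨a1 * (C + 1 : ℝ) ^ (p + 1), mul_pos P.a1pos (by positivity), fun u g h => ?_⟩
  have e1 := int_rpow P.qq0.ne' (P.memq h)
  have e2 := int_sq h.2.1
  have e3 : (eLpNorm u (qq p) (volume.restrict D)).toReal ≤ (C + 1) * (eLpNorm g 2 (volume.restrict D)).toReal := by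
    have := ENNReal.toReal_mono (ENNReal.mul_ne_top ENNReal.coe_ne_top h.2.1.2.ne) (hC u g h)
    rw [ENNReal.toReal_mul, ENNReal.coe_toReal] at this
    refine this.trans ?_
    gcongr; linarith
  have e4 : ((eLpNorm g 2 (volume.restrict D)).toReal ^ 2) ^ ((p + 1) / 2) = (eLpNorm g 2 (volume.restrict D)).toReal ^ (p + 1) := by
    rw [← Real.rpow_natCast, ← Real.rpow_mul ENNReal.toReal_nonneg]
    congr 1; push_cast; ring
  calc Bf D wt p u ≤ ∫ z in D, a1 * |u z| ^ (p + 1) := by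
        refine integral_mono_ae (P.wint (P.iq h)) ((P.iq h).const_mul _) ?_
        filter_upwards [P.aew] with z hz
        gcongr
        exact hz.2
    _ = a1 * (eLpNorm u (qq p) (volume.restrict D)).toReal ^ (p + 1) := by
        rw [integral_const_mul, ← P.qq_coe, ← e1]; simp
    _ ≤ a1 * ((C + 1) * (eLpNorm g 2 (volume.restrict D)).toReal) ^ (p + 1) := by
        have := P.a1pos
        gcongr
    _ = _ := by
        rw [Real.mul_rpow (by positivity) ENNReal.toReal_nonneg, e2, e4]; ring

lemma Prob.Ag (P : Prob N D wt a0 a1 p lam) (u : EE N → ℝ) (g : EE N → EE N) : ∫ z in D, ‖g z‖ ^ 2 ≤ Af D wt lam u g := by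
  have : 0 ≤ ∫ z in D, wt z * u z ^ 2 := by
    refine integral_nonneg_of_ae ?_
    filter_upwards [P.aew] with z hz
    have := P.ha0.le.trans hz.1
    simp only [Pi.zero_apply]
    positivity
  have := mul_nonneg P.hlam.le this
  unfold Af; linarith

lemma Prob.A0 (P : Prob N D wt a0 a1 p lam) (u : EE N → ℝ) (g : EE N → EE N) : 0 ≤ Af D wt lam u g :=
  (integral_nonneg fun z => by positivity).trans (P.Ag u g)

lemma Prob.B0 (P : Prob N D wt a0 a1 p lam) (u : EE N → ℝ) : 0 ≤ Bf D wt p u := by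
  refine integral_nonneg_of_ae ?_
  filter_upwards [P.aew] with z hz
  have := P.ha0.le.trans hz.1
  simp only [Pi.zero_apply]
  positivity

lemma Prob.Apos (P : Prob N D wt a0 a1 p lam) {u : EE N → ℝ} {g : EE N → EE N} (h : IsW D u g) (hB : 0 < Bf D wt p u) : 0 < Af D wt lam u g := by
  obtain ⟨C, hC, hs⟩ := P.sob
  have hp := P.hp
  by_contra hA
  have h1 : ∫ z in D, ‖g z‖ ^ 2 = 0 := le_antisymm ((P.Ag u g).trans (not_lt.1 hA)) (integral_nonneg fun z => by positivity)
  have := hs u g h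
  rw [h1, Real.zero_rpow (by linarith)] at this
  linarith

lemma Prob.delta (P : Prob N D wt a0 a1 p lam) : ∃ δ : ℝ, 0 < δ ∧ ∀ u g, IsW D u g → 0 < Bf D wt p u → Af D wt lam u g ≤ Bf D wt p u → δ ≤ Bf D wt p u := by
  obtain ⟨C, hC, hs⟩ := P.sob
  have hp := P.hp
  refine ⟨(1 / (C + 1)) ^ (2 / (p - 1)), by positivity, fun u g h hB hA => ?_⟩
  by_contra hlt
  push Not at hlt
  set B := Bf D wt p u
  have h1 : B ≤ C * B ^ ((p + 1) / 2) := by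
    refine (hs u g h).trans ?_
    gcongr
    exact (P.Ag u g).trans hA
  have h2 : B ^ ((p - 1) / 2) ≤ 1 / (C + 1) := by
    have := Real.rpow_le_rpow hB.le hlt.le (by linarith : 0 ≤ (p - 1) / 2)
    rw [← Real.rpow_mul (by positivity)] at this
    have e : 2 / (p - 1) * ((p - 1) / 2) = 1 := by field_simp [(by linarith : p - 1 ≠ 0)]
    rwa [e, Real.rpow_one] at this
  have h3 : B ^ ((p + 1) / 2) = B * B ^ ((p - 1) / 2) := by
    rw [← Real.rpow_one_add' hB.le (by linarith)]; congr 1; ring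
  rw [h3] at h1
  have h4 : C * (B * B ^ ((p - 1) / 2)) ≤ C * (B * (1 / (C + 1))) := by gcongr
  have h5 : C * (B * (1 / (C + 1))) < B := by
    have : C / (C + 1) < 1 := by rw [div_lt_one (by positivity)]; linarith
    calc C * (B * (1 / (C + 1))) = B * (C / (C + 1)) := by ring
      _ < B * 1 := by gcongr
      _ = B := mul_one _
  linarith

/-- rescaling to the Nehari set -/
lemma scale {A B p : ℝ} (hp : 1 < p) (hA : 0 < A) (hB : 0 < B) :
    ((A / B) ^ (1 / (p - 1))) ^ 2 * A = Ff p A B ∧ ((A / B) ^ (1 / (p - 1))) ^ (p + 1) * B = Ff p A B := by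
  have hAB : 0 < A / B := div_pos hA hB
  have hp1 : p - 1 ≠ 0 := by linarith
  constructor
  · unfold Ff
    rw [← Real.rpow_natCast, ← Real.rpow_mul hAB.le]
    have : (p + 1) / (p - 1) = 1 / (p - 1) * (2 : ℕ) + 1 := by push_cast; field_simp; ring
    rw [this, Real.rpow_add hAB, Real.rpow_one]
    field_simp
  · unfold Ff
    rw [← Real.rpow_mul hAB.le]
    congr 2; field_simp

lemma Prob.Bpos (P : Prob N D wt a0 a1 p lam) {u : EE N → ℝ} {g : EE N → EE N} (h : IsW D u g) (hu : ¬ (u =ᵐ[volume.restrict D] 0)) : 0 < Bf D wt p u := by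
  have hp := P.hp
  rcases (P.B0 u).lt_or_eq with h0 | h0
  · exact h0
  exfalso; apply hu
  have hnn : 0 ≤ᵐ[volume.restrict D] fun z => wt z * |u z| ^ (p + 1) := by
    filter_upwards [P.aew] with z hz
    have := P.ha0.le.trans hz.1
    simp only [Pi.zero_apply]
    positivity
  have := (integral_eq_zero_iff_of_nonneg_ae hnn (P.wint (P.iq h))).1 h0.symm
  filter_upwards [this, P.aew] with z hz hz2
  have h1 : 0 < wt z := P.ha0.trans_le hz2.1
  simp only [Pi.zero_apply, mul_eq_zero] at hz
  rcases hz with hz | hz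
  · linarith
  · rw [Real.rpow_eq_zero (abs_nonneg _) (by linarith)] at hz
    simpa using hz

lemma not_ae_zero (hD : IsOpen D) {u : EE N → ℝ} {U : Set (EE N)} (hU : IsOpen U) (hne : U.Nonempty) (hUD : U ⊆ D) (hu : ∀ z ∈ U, u z ≠ 0) :
    ¬ (u =ᵐ[volume.restrict D] 0) := by
  intro h0
  have h1 : volume.restrict D U = 0 := by
    refine measure_mono_null ?_ h0
    intro z hz
    exact hu z hz
  rw [Measure.restrict_apply hU.measurableSet, Set.inter_eq_left.2 hUD] at h1
  exact (hU.measure_pos volume hne).ne' h1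

lemma bump_TF {z : EE N} {r : ℝ} (hr : 0 < r) (hrD : Metric.closedBall z r ⊆ D) :
    ∃ φ, TF D φ ∧ (∀ x, 0 ≤ φ x) ∧ (∀ x ∈ Metric.ball z r, φ x ≠ 0) ∧ ∀ x ∉ Metric.ball z r, φ x = 0 := by
  let f : ContDiffBump z := ⟨r / 2, r, by linarith, by linarith⟩
  refine ⟨f, ⟨f.contDiff, f.hasCompactSupport, ?_⟩, fun x => f.nonneg, ?_, ?_⟩
  · rw [f.tsupport_eq]; exact hrD
  · intro x hx
    rw [← Function.mem_support, f.support_eq]; exact hx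
  · intro x hx
    rw [← Function.notMem_support, f.support_eq]; exact hx

/-- feasible pairs -/
def Feas (D : Set (EE N)) (wt : EE N → ℝ) (p lam : ℝ) (a : EE N → ℝ) (ga : EE N → EE N) (b : EE N → ℝ) (gb : EE N → EE N) : Prop :=
  IsW D a ga ∧ IsW D b gb ∧ (∀ᵐ z ∂(volume.restrict D), 0 ≤ a z ∧ 0 ≤ b z ∧ a z * b z = 0) ∧
  0 < Bf D wt p a ∧ 0 < Bf D wt p b ∧ Af D wt lam a ga = Bf D wt p a ∧ Af D wt lam b gb = Bf D wt p b

lemma Prob.feas_scale (P : Prob N D wt a0 a1 p lam) {a b : EE N → ℝ} {ga gb : EE N → EE N} (ha : IsW D a ga) (hb : IsW D b gb)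
    (hz : ∀ᵐ z ∂(volume.restrict D), 0 ≤ a z ∧ 0 ≤ b z ∧ a z * b z = 0) (hBa : 0 < Bf D wt p a) (hBb : 0 < Bf D wt p b) :
    ∃ s t : ℝ, 0 < s ∧ 0 < t ∧ Feas D wt p lam (s • a) (s • ga) (t • b) (t • gb) ∧ Bf D wt p (s • a) = Ff p (Af D wt lam a ga) (Bf D wt p a)
      ∧ Bf D wt p (t • b) = Ff p (Af D wt lam b gb) (Bf D wt p b) := by
  have hA := P.Apos ha hBa
  have hB := P.Apos hb hBb
  have s0 := Real.rpow_pos_of_pos (div_pos hA hBa) (1 / (p - 1))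
  have t0 := Real.rpow_pos_of_pos (div_pos hB hBb) (1 / (p - 1))
  obtain ⟨e1, e2⟩ := scale P.hp hA hBa
  obtain ⟨e3, e4⟩ := scale P.hp hB hBb
  refine ⟨(Af D wt lam a ga / Bf D wt p a) ^ (1 / (p - 1)), (Af D wt lam b gb / Bf D wt p b) ^ (1 / (p - 1)), s0, t0, ⟨ha.smul _, hb.smul _, ?_, ?_, ?_, ?_, ?_⟩, ?_, ?_⟩
  · filter_upwards [hz] with z hz
    refine ⟨mul_nonneg s0.le hz.1, mul_nonneg t0.le hz.2.1, ?_⟩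
    simp only [Pi.smul_apply, smul_eq_mul]
    rw [mul_mul_mul_comm, hz.2.2, mul_zero]
  · rw [Bf_smul s0.le]; positivity
  · rw [Bf_smul t0.le]; positivity
  · rw [Bf_smul s0.le, Af_smul, e1, e2]
  · rw [Bf_smul t0.le, Af_smul, e3, e4]
  · rw [Bf_smul s0.le, e2]
  · rw [Bf_smul t0.le, e4]

lemma Prob.feas_nonempty (P : Prob N D wt a0 a1 p lam) : ∃ a ga b gb, Feas D wt p lam a ga b gb := by
  obtain ⟨z0, hz0⟩ := P.hne
  obtain ⟨r, hr, hrD⟩ := Metric.isOpen_iff.1 P.hD z0 hz0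
  have hN := P.hN
  let e : EE N := EuclideanSpace.single ⟨0, by omega⟩ (1 : ℝ)
  have he : ‖e‖ = 1 := by simp [e]
  let z1 := z0 + (r / 2) • e
  have hz1 : dist z1 z0 = r / 2 := by simp [z1, norm_smul, he, abs_of_pos hr]
  obtain ⟨a, ha, ha0, ha1, ha2⟩ := bump_TF (D := D) (z := z0) (r := r / 8) (by linarith) ((Metric.closedBall_subset_ball (by linarith)).trans hrD)
  obtain ⟨b, hb, hb0, hb1, hb2⟩ := bump_TF (D := D) (z := z1) (r := r / 8) (by linarith) (by
    refine Set.Subset.trans ?_ hrD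
    intro x hx
    simp only [Metric.mem_closedBall, Metric.mem_ball] at hx ⊢
    linarith [dist_triangle x z1 z0])
  have h1 : ∀ᵐ z ∂(volume.restrict D), 0 ≤ a z ∧ 0 ≤ b z ∧ a z * b z = 0 := by
    refine Eventually.of_forall fun z => ⟨ha0 z, hb0 z, ?_⟩
    by_cases h : z ∈ Metric.ball z0 (r / 8)
    · rw [hb2 z, mul_zero]
      intro h'
      simp only [Metric.mem_ball] at h h'
      rw [dist_comm] at h'
      linarith [dist_triangle z1 z z0]
    · rw [ha2 z h, zero_mul]
  obtain ⟨s, t, -, -, h, -⟩ := P.feas_scale (IsW.of_TF ha) (IsW.of_TF hb) h1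
    (P.Bpos (IsW.of_TF ha) (not_ae_zero P.hD Metric.isOpen_ball ⟨z0, Metric.mem_ball_self (by linarith)⟩ (by
      intro x hx; by_contra h'; exact ha1 x hx (image_eq_zero_of_notMem_tsupport fun h'' => h' (ha.2.2 h''))) ha1))
    (P.Bpos (IsW.of_TF hb) (not_ae_zero P.hD Metric.isOpen_ball ⟨z1, Metric.mem_ball_self (by linarith)⟩ (by
      intro x hx; by_contra h'; exact hb1 x hx (image_eq_zero_of_notMem_tsupport fun h'' => h' (hb.2.2 h''))) hb1))
  exact ⟨_, _, _, _, h⟩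

/-- limits of bounded Nehari sequences -/
lemma Prob.limit (P : Prob N D wt a0 a1 p lam) {u : ℕ → EE N → ℝ} {g : ℕ → EE N → EE N} (h : ∀ n, IsW D (u n) (g n)) {M : ℝ} (hB : ∀ n, 0 < Bf D wt p (u n))
    (hM : ∀ n, Bf D wt p (u n) ≤ M) (hA : ∀ n, Af D wt lam (u n) (g n) = Bf D wt p (u n)) :
    ∃ u0 g0, ∃ k : ℕ → ℕ, StrictMono k ∧ IsW D u0 g0 ∧ (∀ᵐ z ∂(volume.restrict D), Tendsto (fun n => u (k n) z) atTop (𝓝 (u0 z))) ∧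
      Tendsto (fun n => Bf D wt p (u (k n))) atTop (𝓝 (Bf D wt p u0)) ∧ Af D wt lam u0 g0 ≤ Bf D wt p u0 ∧ 0 < Bf D wt p u0 := by
  have hM0 : 0 ≤ M := (hB 0).le.trans (hM 0)
  have hgM : ∀ n, ∫ z in D, ‖g n z‖ ^ 2 ≤ M := fun n => (P.Ag _ _).trans ((hA n).le.trans (hM n))
  have hg : ∀ n, eLpNorm (g n) 2 (volume.restrict D) ≤ ((√M).toNNReal : ℝ≥0∞) := fun n => by
    have := hgM n
    rw [int_sq (h n).2.1] at this
    rw [← ENNReal.ofReal_toReal (h n).2.1.2.ne, ← ENNReal.ofReal]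
    exact ENNReal.ofReal_le_ofReal (Real.le_sqrt_of_sq_le this)
  obtain ⟨u0, g0, k, hk, hw, hae, hq, hwk⟩ := compact_W P.hN P.hD P.hb h hg
  have hww : ∀ᵐ z ∂(volume.restrict D), 0 ≤ wt z ∧ wt z ≤ a1 := by
    filter_upwards [P.aew] with z hz
    exact ⟨P.ha0.le.trans hz.1, hz.2⟩
  have tB : Tendsto (fun n => Bf D wt p (u (k n))) atTop (𝓝 (Bf D wt p u0)) := by
    have := tendsto_int_wt (q := qq p) (one_le_two.trans P.qq2) P.hwm.aestronglyMeasurable hww (fun n => P.memq (h (k n))) (P.memq hw) (hq _ P.qq2 P.qqs)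
    simpa [P.qq_coe, Bf] using this
  have t2 : Tendsto (fun n => ∫ z in D, wt z * (u (k n) z) ^ 2) atTop (𝓝 (∫ z in D, wt z * (u0 z) ^ 2)) := by
    have := tendsto_int_wt (q := 2) one_le_two P.hwm.aestronglyMeasurable hww (fun n => (h (k n)).1) hw.1 (hq 2 le_rfl (P.qq2.trans_lt P.qqs))
    simpa using this
  refine ⟨u0, g0, k, hk, hw, hae, tB, ?_, ?_⟩
  · have := lsc_W (g := fun n => g (k n)) (fun n => (h (k n)).2.1) hw.2.1 (hwk g0 hw.2.1) (a := fun n => Bf D wt p (u (k n)) - lam * ∫ z in D, wt z * (u (k n) z) ^ 2)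
      (fun n => by have := hA (k n); unfold Af at this; linarith) (tB.sub (t2.const_mul lam))
    unfold Af; linarith
  · obtain ⟨δ, hδ, hd⟩ := P.delta
    exact hδ.trans_le (ge_of_tendsto' tB fun n => hd _ _ (h (k n)) (hB _) (hA _).le)

theorem Prob.exists_min (P : Prob N D wt a0 a1 p lam) : ∃ a ga b gb, Feas D wt p lam a ga b gb ∧
    ∀ a' ga' b' gb', Feas D wt p lam a' ga' b' gb' → Bf D wt p a + Bf D wt p b ≤ Bf D wt p a' + Bf D wt p b' := by
  let S : Set ℝ := {x | ∃ a ga b gb, Feas D wt p lam a ga b gb ∧ x = Bf D wt p a + Bf D wt p b}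
  have hSne : S.Nonempty := by
    obtain ⟨a, ga, b, gb, h⟩ := P.feas_nonempty
    exact ⟨_, a, ga, b, gb, h, rfl⟩
  have hSb : BddBelow S := ⟨0, by rintro x ⟨a, ga, b, gb, h, rfl⟩; exact add_nonneg (P.B0 a) (P.B0 b)⟩
  obtain ⟨x, hxa, hxl, hxS⟩ := exists_seq_tendsto_sInf hSne hSb
  choose a ga b gb hf hx using hxS
  obtain ⟨M, hM⟩ := hxl.bddAbove_range
  have hxM : ∀ n, Bf D wt p (a n) + Bf D wt p (b n) ≤ M := fun n => by rw [← hx]; exact hM ⟨n, rfl⟩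
  obtain ⟨a', ga', k, hk, hwa, haea, tBa, hAa, hBa⟩ := P.limit (fun n => (hf n).1) (M := M) (fun n => (hf n).2.2.2.1) (fun n => by linarith [hxM n, P.B0 (b n)]) (fun n => (hf n).2.2.2.2.2.1)
  obtain ⟨b', gb', j, hj, hwb, haeb, tBb, hAb, hBb⟩ := P.limit (fun n => (hf (k n)).2.1) (M := M) (fun n => (hf _).2.2.2.2.1) (fun n => by linarith [hxM (k n), P.B0 (a (k n))]) (fun n => (hf _).2.2.2.2.2.2)
  have hz : ∀ᵐ z ∂(volume.restrict D), 0 ≤ a' z ∧ 0 ≤ b' z ∧ a' z * b' z = 0 := by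
    have hall : ∀ᵐ z ∂(volume.restrict D), ∀ n, 0 ≤ a n z ∧ 0 ≤ b n z ∧ a n z * b n z = 0 := ae_all_iff.2 fun n => (hf n).2.2.1
    filter_upwards [hall, haea, haeb] with z h1 h2 h3
    refine ⟨ge_of_tendsto' h2 fun n => (h1 _).1, ge_of_tendsto' h3 fun n => (h1 _).2.1, ?_⟩
    refine tendsto_nhds_unique ((h2.comp hj.tendsto_atTop).mul h3) ?_
    simp only [Function.comp_def]
    exact tendsto_const_nhds.congr fun n => ((h1 _).2.2).symm
  have hsum : Bf D wt p a' + Bf D wt p b' = sInf S := by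
    refine tendsto_nhds_unique ((tBa.comp hj.tendsto_atTop).add tBb) ?_
    have := hxl.comp (hk.comp hj).tendsto_atTop
    refine this.congr fun n => ?_
    simp [hx]
  have hp := P.hp
  have hF : ∀ A B : ℝ, 0 < A → 0 < B → A ≤ B → Ff p A B ≤ B := fun A B hA hB hAB => by
    unfold Ff
    refine mul_le_of_le_one_left hB.le (Real.rpow_le_one (by positivity) ((div_le_one hB).2 hAB) (div_nonneg (by linarith) (by linarith)))
  obtain ⟨s, t, -, -, h, e1, e2⟩ := P.feas_scale hwa hwb hz hBa hBb
  refine ⟨_, _, _, _, h, fun a'' ga'' b'' gb'' h'' => ?_⟩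
  rw [e1, e2]
  have : sInf S ≤ Bf D wt p a'' + Bf D wt p b'' := csInf_le hSb ⟨_, _, _, _, h'', rfl⟩
  have := hF _ _ (P.Apos hwa hBa) hBa hAa
  have := hF _ _ (P.Apos hwb hBb) hBb hAb
  linarith

end P5sec


section P6sec
open scoped ENNReal NNReal Topology
variable {N : ℕ} {D : Set (EE N)}
variable {wt : EE N → ℝ} {a0 a1 p lam : ℝ}

def uP (u : EE N → ℝ) : EE N → ℝ := fun z => max (u z) 0
def uM (u : EE N → ℝ) : EE N → ℝ := fun z => max (-u z) 0
def gP (u : EE N → ℝ) (g : EE N → EE N) : EE N → EE N := fun z => if 0 < u z then g z else 0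
def gM (u : EE N → ℝ) (g : EE N → EE N) : EE N → EE N := fun z => if u z < 0 then - g z else 0

/-- scale-free minimality -/
structure IsMinz (D : Set (EE N)) (wt : EE N → ℝ) (p lam : ℝ) (u : EE N → ℝ) (g : EE N → EE N) : Prop where
  hW : IsW D u g
  hBp : 0 < Bf D wt p (uP u)
  hBm : 0 < Bf D wt p (uM u)
  hAp : Af D wt lam (uP u) (gP u g) = Bf D wt p (uP u)
  hAm : Af D wt lam (uM u) (gM u g) = Bf D wt p (uM u)
  hmin : ∀ v gv, IsW D v gv → 0 < Bf D wt p (uP v) → 0 < Bf D wt p (uM v) →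
    Bf D wt p (uP u) + Bf D wt p (uM u) ≤
      Ff p (Af D wt lam (uP v) (gP v gv)) (Bf D wt p (uP v)) + Ff p (Af D wt lam (uM v) (gM v gv)) (Bf D wt p (uM v))

lemma Prob.exists_minz (P : Prob N D wt a0 a1 p lam) : ∃ u g, IsMinz D wt p lam u g := by
  obtain ⟨a, ga, b, gb, ⟨ha, hb, hab, hBa, hBb, hA, hB⟩, hmin⟩ := P.exists_min
  have := finMeas P.hb
  have hW : IsW D (a - b) (ga - gb) := ha.sub hb
  have e1 : a =ᵐ[volume.restrict D] uP (a - b) := by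
    filter_upwards [hab] with z hz
    simp only [uP, Pi.sub_apply]
    rcases mul_eq_zero.1 hz.2.2 with h | h
    · rw [h, max_eq_right]; linarith
    · rw [h, max_eq_left]; linarith
      linarith
  have e2 : b =ᵐ[volume.restrict D] uM (a - b) := by
    filter_upwards [hab] with z hz
    simp only [uM, Pi.sub_apply]
    rcases mul_eq_zero.1 hz.2.2 with h | h
    · rw [h, max_eq_left]; linarith
      linarith
    · rw [h, max_eq_right]; linarith
  have hpp : IsW D (uP (a - b)) (gP (a - b) (ga - gb)) := hW.pos_part
  have hpm : IsW D (uM (a - b)) (gM (a - b) (ga - gb)) := hW.neg_part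
  have g1 := ha.unique P.hD (hpp.congr e1.symm EventuallyEq.rfl)
  have g2 := hb.unique P.hD (hpm.congr e2.symm EventuallyEq.rfl)
  refine ⟨a - b, ga - gb, hW, ?_, ?_, ?_, ?_, ?_⟩
  · rwa [← Bf_congr e1]
  · rwa [← Bf_congr e2]
  · rw [← Bf_congr e1, ← Af_congr e1 g1, hA]
  · rw [← Bf_congr e2, ← Af_congr e2 g2, hB]
  · intro v gv hv h1 h2
    have hvp : IsW D (uP v) (gP v gv) := hv.pos_part
    have hvm : IsW D (uM v) (gM v gv) := hv.neg_part
    obtain ⟨s, t, hs, ht, hf, e3, e4⟩ := P.feas_scale (lam := lam) hvp hvm (Eventually.of_forall fun z => by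
      refine ⟨le_max_right _ _, le_max_right _ _, ?_⟩
      simp only [uP, uM]
      rcases le_total (v z) 0 with h | h
      · rw [max_eq_right h]; simp
      · rw [max_eq_right (show -v z ≤ 0 by linarith)]; simp) h1 h2
    rw [← Bf_congr e1, ← Bf_congr e2, ← e3, ← e4]
    exact hmin _ _ _ _ hf

lemma Ff_hasFDerivAt {p b : ℝ} (hp : 1 < p) (hb : 0 < b) :
    HasFDerivAt (fun q : ℝ × ℝ => Ff p q.1 q.2)
      (((p + 1) / (p - 1)) • ContinuousLinearMap.fst ℝ ℝ ℝ + (1 - (p + 1) / (p - 1)) • ContinuousLinearMap.snd ℝ ℝ ℝ) (b, b) := by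
  have h1 : HasFDerivAt (fun q : ℝ × ℝ => q.1) (ContinuousLinearMap.fst ℝ ℝ ℝ) (b, b) := hasFDerivAt_fst
  have h2 : HasFDerivAt (fun q : ℝ × ℝ => q.2) (ContinuousLinearMap.snd ℝ ℝ ℝ) (b, b) := hasFDerivAt_snd
  have h3 := h1.fun_mul ((hasDerivAt_inv (show (b, b).2 ≠ 0 from hb.ne')).comp_hasFDerivAt _ h2)
  have h4 := h3.rpow_const (p := (p + 1) / (p - 1)) (Or.inl (by simp [hb.ne']))
  have h5 := h4.fun_mul h2
  refine HasFDerivAt.congr_fderiv h5 ?_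
  ext <;> simp [hb.ne'] <;> field_simp <;> ring

/-- value at the linearised scale -/
lemma Ff_seq {p b C : ℝ} (hp : 1 < p) (hb : 0 < b) {e x y : ℕ → ℝ} (he : ∀ n, 0 < e n) (he0 : Tendsto e atTop (𝓝 0))
    (hx : ∀ n, |x n| ≤ C * e n) (hy : ∀ n, |y n| ≤ C * e n) :
    Tendsto (fun n => (Ff p (b + x n) (b + y n) - b - ((p + 1) / (p - 1)) * x n - (1 - (p + 1) / (p - 1)) * y n) / e n) atTop (𝓝 0) := by
  have hF := (Ff_hasFDerivAt hp hb).isLittleO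
  have hx0 : Tendsto x atTop (𝓝 0) := squeeze_zero_norm hx (by simpa using he0.const_mul C)
  have hy0 : Tendsto y atTop (𝓝 0) := squeeze_zero_norm hy (by simpa using he0.const_mul C)
  have ht : Tendsto (fun n => (b + x n, b + y n)) atTop (𝓝 (b, b)) := by
    have h1 : Tendsto (fun n => b + x n) atTop (𝓝 b) := by simpa using hx0.const_add b
    have h2 : Tendsto (fun n => b + y n) atTop (𝓝 b) := by simpa using hy0.const_add b
    exact h1.prodMk_nhds h2
  have h2 := hF.comp_tendsto ht
  have h3 : ((fun x' : ℝ × ℝ => x' - (b, b)) ∘ fun n => (b + x n, b + y n)) =O[atTop] e := by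
    refine Asymptotics.IsBigO.of_bound C (Eventually.of_forall fun n => ?_)
    simp only [Function.comp, Prod.mk_sub_mk, add_sub_cancel_left, Prod.norm_mk, Real.norm_eq_abs, abs_of_pos (he n)]
    exact max_le (hx n) (hy n)
  have h4 := (h2.trans_isBigO h3).tendsto_div_nhds_zero
  refine h4.congr fun n => ?_
  have : Ff p b b = b := by simp [Ff, hb.ne']
  simp only [Function.comp, this, Prod.mk_sub_mk, add_sub_cancel_left]
  simp
  ring

lemma abs_rpow_sub_le {q : ℝ} (hq : 1 < q) (x y M : ℝ) (hx : |x| ≤ M) (hy : |y| ≤ M) :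
    |(|x| ^ q) - |y| ^ q| ≤ q * M ^ (q - 1) * |x - y| := by
  have := Convex.norm_image_sub_le_of_norm_hasDerivWithin_le (f := fun x : ℝ => |x| ^ q) (f' := fun x => q * |x| ^ (q - 2) * x)
    (s := Set.Icc (-M) M) (C := q * M ^ (q - 1)) (fun t _ => (hasDerivAt_abs_rpow t hq).hasDerivWithinAt) ?_ (convex_Icc _ _)
    (abs_le.1 hy) (abs_le.1 hx)
  · simpa using this
  · intro t ht
    have ht' := abs_le.2 ht
    rw [norm_mul, norm_mul, Real.norm_of_nonneg (by linarith : (0:ℝ) ≤ q), Real.norm_of_nonneg (by positivity), Real.norm_eq_abs]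
    rcases eq_or_ne t 0 with rfl | h0
    · simp
      have : 0 ≤ M := (abs_nonneg _).trans hx
      positivity
    · have e : |t| ^ (q - 2) * |t| = |t| ^ (q - 1) := by
        rw [← Real.rpow_add_one (by positivity)]; congr 1; ring
      rw [mul_assoc, e]
      gcongr

/-- `B` along a segment -/
lemma Prob.B_bound (P : Prob N D wt a0 a1 p lam) {u φ : EE N → ℝ} {g η : EE N → EE N} (h : IsW D u g) (hφ : IsW D φ η) :
    Integrable (fun z => wt z * (|u z| + |φ z|) ^ (p + 1)) (volume.restrict D) := by
  refine P.wint ?_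
  have := ((P.memq h).norm.add (P.memq hφ).norm).integrable_norm_rpow (by exact_mod_cast P.qq0.ne') (by simp)
  refine this.congr (Eventually.of_forall fun z => ?_)
  simp only [ENNReal.coe_toReal, P.qq_coe, Pi.add_apply, Real.norm_eq_abs]
  rw [abs_of_nonneg (by positivity)]

lemma rpow_aux {p e x y f : ℝ} (hp : 1 < p) (he : 0 < e) (he1 : e < 1) {u : ℝ} (hx : |x| ≤ |u| + |f|) (hy : |y| ≤ |u| + |f|) (hxy : |x - y| ≤ e * |f|) :
    |(|x| ^ (p + 1)) - |y| ^ (p + 1)| ≤ e * ((p + 1) * (|u| + |f|) ^ (p + 1)) := by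
  have h1 := abs_rpow_sub_le (q := p + 1) (by linarith) x y (|u| + |f|) hx hy
  refine h1.trans ?_
  have h2 : (|u| + |f|) ^ (p + 1) = (|u| + |f|) ^ p * (|u| + |f|) := by
    rcases eq_or_ne (|u| + |f|) 0 with h | h
    · rw [h, Real.zero_rpow (by linarith)]; simp
    · rw [Real.rpow_add_one h]
  rw [h2]
  have h3 : |x - y| ≤ e * (|u| + |f|) := hxy.trans (by gcongr; linarith [abs_nonneg u])
  calc (p + 1) * (|u| + |f|) ^ (p + 1 - 1) * |x - y| ≤ (p + 1) * (|u| + |f|) ^ (p + 1 - 1) * (e * (|u| + |f|)) := by gcongr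
    _ = _ := by rw [add_sub_cancel_right]; ring

lemma Prob.y_bound (P : Prob N D wt a0 a1 p lam) {u φ x y : EE N → ℝ} {g η gx gy : EE N → EE N} (h : IsW D u g) (hφ : IsW D φ η)
    (hwx : IsW D x gx) (hwy : IsW D y gy)
    {e : ℝ} (he : 0 < e) (he1 : e < 1)
    (hx : ∀ z, |x z| ≤ |u z| + |φ z|) (hy : ∀ z, |y z| ≤ |u z| + |φ z|) (hxy : ∀ z, |x z - y z| ≤ e * |φ z|) :
    |Bf D wt p x - Bf D wt p y| ≤ ((p + 1) * ∫ z in D, wt z * (|u z| + |φ z|) ^ (p + 1)) * e := by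
  unfold Bf
  rw [← integral_sub (P.wint (P.iq hwx)) (P.wint (P.iq hwy)), ← integral_const_mul, ← integral_mul_const]
  refine (abs_integral_le_integral_abs).trans (integral_mono_ae ((P.wint (P.iq hwx)).sub (P.wint (P.iq hwy))).abs (((P.B_bound h hφ).const_mul _).mul_const _) ?_)
  filter_upwards [P.aew] with z hz
  have hw := P.ha0.le.trans hz.1
  have := rpow_aux P.hp he he1 (hx z) (hy z) (hxy z)
  rw [← mul_sub, abs_mul, abs_of_nonneg hw]
  calc _ ≤ wt z * (e * ((p + 1) * (|u z| + |φ z|) ^ (p + 1))) := by gcongr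
    _ = _ := by ring

lemma Prob.B_split (P : Prob N D wt a0 a1 p lam) {v : EE N → ℝ} {g : EE N → EE N} (h : IsW D v g) :
    Bf D wt p (uP v) + Bf D wt p (uM v) = Bf D wt p v := by
  have := finMeas P.hb
  have h1 : IsW D (uP v) _ := h.pos_part
  have h2 : IsW D (uM v) _ := h.neg_part
  have hp := P.hp
  unfold Bf
  rw [← integral_add (P.wint (P.iq h1)) (P.wint (P.iq h2))]
  congr 1; ext z
  rw [← mul_add]; congr 1
  simp only [uP, uM]
  rcases le_total (v z) 0 with h | h
  · rw [max_eq_right h, max_eq_left (by linarith), abs_zero, Real.zero_rpow (by linarith)]; simp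
  · rw [max_eq_left h, max_eq_right (by linarith), abs_zero, Real.zero_rpow (by linarith)]; simp

lemma Prob.A_split (P : Prob N D wt a0 a1 p lam) {v : EE N → ℝ} {g : EE N → EE N} (h : IsW D v g) :
    Af D wt lam (uP v) (gP v g) + Af D wt lam (uM v) (gM v g) = Af D wt lam v g := by
  have := finMeas P.hb
  have h1 : IsW D (uP v) (gP v g) := h.pos_part
  have h2 : IsW D (uM v) (gM v g) := h.neg_part
  unfold Af
  have e1 : (∫ z in D, ‖gP v g z‖ ^ 2) + (∫ z in D, ‖gM v g z‖ ^ 2) = ∫ z in D, ‖g z‖ ^ 2 := by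
    rw [← integral_add (Prob.ig h1) (Prob.ig h2)]
    refine integral_congr_ae ?_
    filter_upwards [h.grad_zero P.hD] with z hz
    simp only [gP, gM]
    rcases lt_trichotomy (v z) 0 with h | h | h
    · simp [h, h.not_gt]
    · simp [h, hz h]
    · simp [h, h.not_gt]
  have e2 : (∫ z in D, wt z * uP v z ^ 2) + (∫ z in D, wt z * uM v z ^ 2) = ∫ z in D, wt z * v z ^ 2 := by
    rw [← integral_add (P.wint (Prob.i2 h1)) (P.wint (Prob.i2 h2))]
    congr 1; ext z
    simp only [uP, uM]
    rcases le_total (v z) 0 with h | h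
    · rw [max_eq_right h, max_eq_left (by linarith)]; ring
    · rw [max_eq_left h, max_eq_right (by linarith)]; ring
  rw [← e1, ← e2]; ring

lemma int_add3 {α : Type*} [MeasurableSpace α] {μ : Measure α} {f g h : α → ℝ} (hf : Integrable f μ) (hg : Integrable g μ) (hh : Integrable h μ) (c d : ℝ) :
    (∫ z, f z ∂μ) + c * (∫ z, g z ∂μ) + d * (∫ z, h z ∂μ) = ∫ z, (f z + c * g z + d * h z) ∂μ := by
  rw [integral_add (hf.fun_add (hg.const_mul c)) (hh.const_mul d), integral_add hf (hg.const_mul c), integral_const_mul, integral_const_mul]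

lemma int_inner {α : Type*} [MeasurableSpace α] {μ : Measure α} {f g : α → EE N} (hf : MemLp f 2 μ) (hg : MemLp g 2 μ) :
    Integrable (fun z => inner ℝ (f z) (g z)) μ := by
  refine (hf.norm.integrable_mul hg.norm).mono' (hf.1.inner hg.1) (Eventually.of_forall fun z => ?_)
  exact norm_inner_le_norm _ _

lemma Prob.A_expand (P : Prob N D wt a0 a1 p lam) {u φ : EE N → ℝ} {g η : EE N → EE N} (h : IsW D u g) (hφ : IsW D φ η) (e : ℝ) :
    Af D wt lam (u + e • φ) (g + e • η) - Af D wt lam u g =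
      e * (2 * ((∫ z in D, inner ℝ (g z) (η z)) + lam * ∫ z in D, wt z * (u z * φ z))) + e ^ 2 * Af D wt lam φ η := by
  have i1 : Integrable (fun z => inner ℝ (g z) (η z)) (volume.restrict D) := int_inner h.2.1 hφ.2.1
  have i2 : Integrable (fun z => wt z * (u z * φ z)) (volume.restrict D) := P.wint (h.1.integrable_mul hφ.1)
  have e1 : (∫ z in D, ‖(g + e • η) z‖ ^ 2) = (∫ z in D, ‖g z‖ ^ 2) + 2 * e * (∫ z in D, inner ℝ (g z) (η z)) + e ^ 2 * ∫ z in D, ‖η z‖ ^ 2 := by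
    rw [int_add3 (Prob.ig h) i1 (Prob.ig hφ)]
    congr 1; ext z
    simp only [Pi.add_apply, Pi.smul_apply]
    rw [norm_add_sq_real, norm_smul, inner_smul_right, mul_pow, Real.norm_eq_abs, sq_abs]; ring
  have e2 : (∫ z in D, wt z * (u + e • φ) z ^ 2) = (∫ z in D, wt z * u z ^ 2) + 2 * e * (∫ z in D, wt z * (u z * φ z)) + e ^ 2 * ∫ z in D, wt z * φ z ^ 2 := by
    rw [int_add3 (P.wint (Prob.i2 h)) i2 (P.wint (Prob.i2 hφ))]
    congr 1; ext z
    simp only [Pi.add_apply, Pi.smul_apply, smul_eq_mul]; ring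
  unfold Af
  rw [e1, e2]; ring

def Sfun (u φ : EE N → ℝ) (g : EE N → EE N) (e : ℝ) : EE N → ℝ := fun z => if u z * (u z + e * φ z) ≤ 0 then ‖g z‖ ^ 2 else 0

lemma Sfun_int {u φ : EE N → ℝ} {g η : EE N → EE N} (h : IsW D u g) (hφ : IsW D φ η) (e : ℝ) :
    Integrable (Sfun u φ g e) (volume.restrict D) := by
  have hm : NullMeasurableSet {z | u z * (u z + e * φ z) ≤ 0} (volume.restrict D) := by
    refine nullMeasurableSet_le (f := fun z => u z * (u z + e * φ z)) ?_ aemeasurable_const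
    exact h.1.1.aemeasurable.mul (h.1.1.aemeasurable.add (hφ.1.1.aemeasurable.const_mul e))
  refine ((Prob.ig h).indicator₀ hm).congr (Eventually.of_forall fun z => ?_)
  simp only [Sfun, Set.indicator_apply, Set.mem_setOf_eq]

lemma Prob.x_bound (P : Prob N D wt a0 a1 p lam) {u φ x y : EE N → ℝ} {g η gx gy : EE N → EE N} (h : IsW D u g) (hφ : IsW D φ η)
    (hwx : IsW D x gx) (hwy : IsW D y gy)
    {e C : ℝ} (hC : ∫ z in D, Sfun u φ g e z ≤ C * e)
    (hxy : ∀ z, |x z ^ 2 - y z ^ 2| ≤ e * (u z ^ 2 + 2 * φ z ^ 2))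
    (hg : ∀ z, |‖gx z‖ ^ 2 - ‖gy z‖ ^ 2| ≤ e * (‖g z‖ ^ 2 + 2 * ‖η z‖ ^ 2) + Sfun u φ g e z) :
    |Af D wt lam x gx - Af D wt lam y gy| ≤ (C + (∫ z in D, (‖g z‖ ^ 2 + 2 * ‖η z‖ ^ 2)) + lam * ∫ z in D, wt z * (u z ^ 2 + 2 * φ z ^ 2)) * e := by
  have i1 : Integrable (fun z => ‖g z‖ ^ 2 + 2 * ‖η z‖ ^ 2) (volume.restrict D) := (Prob.ig h).add ((Prob.ig hφ).const_mul 2)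
  have i2 : Integrable (fun z => wt z * (u z ^ 2 + 2 * φ z ^ 2)) (volume.restrict D) := P.wint ((Prob.i2 h).add ((Prob.i2 hφ).const_mul 2))
  have h1 : |(∫ z in D, ‖gx z‖ ^ 2) - ∫ z in D, ‖gy z‖ ^ 2| ≤ e * (∫ z in D, (‖g z‖ ^ 2 + 2 * ‖η z‖ ^ 2)) + C * e := by
    refine le_trans ?_ (add_le_add_right hC _)
    rw [← integral_sub (Prob.ig hwx) (Prob.ig hwy), ← integral_const_mul, ← integral_add (i1.const_mul e) (Sfun_int h hφ e)]
    refine (abs_integral_le_integral_abs).trans (integral_mono ((Prob.ig hwx).sub (Prob.ig hwy)).abs ((i1.const_mul e).add (Sfun_int h hφ e)) ?_)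
    exact hg
  have h2 : |(∫ z in D, wt z * x z ^ 2) - ∫ z in D, wt z * y z ^ 2| ≤ e * ∫ z in D, wt z * (u z ^ 2 + 2 * φ z ^ 2) := by
    rw [← integral_sub (P.wint (Prob.i2 hwx)) (P.wint (Prob.i2 hwy)), ← integral_const_mul]
    refine (abs_integral_le_integral_abs).trans (integral_mono_ae ((P.wint (Prob.i2 hwx)).sub (P.wint (Prob.i2 hwy))).abs (i2.const_mul e) ?_)
    filter_upwards [P.aew] with z hz
    have hw := P.ha0.le.trans hz.1
    rw [← mul_sub, abs_mul, abs_of_nonneg hw]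
    calc _ ≤ wt z * (e * (u z ^ 2 + 2 * φ z ^ 2)) := by gcongr; exact hxy z
      _ = _ := by ring
  unfold Af
  have h3 := mul_le_mul_of_nonneg_left h2 P.hlam.le
  rw [← abs_of_pos P.hlam, ← abs_mul, abs_of_pos P.hlam] at h3
  rw [abs_le] at h1 h3 ⊢
  constructor <;> nlinarith

lemma sq_aux {u v f e x y : ℝ} (he : 0 < e) (he1 : e < 1) (hv : v = u + e * f) (hx : |x| ≤ |v|) (hy : |y| ≤ |u|) (hxy : |x - y| ≤ |v - u|) :
    |x ^ 2 - y ^ 2| ≤ e * (u ^ 2 + 2 * f ^ 2) := by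
  have h1 : |v - u| = e * |f| := by rw [hv, add_sub_cancel_left, abs_mul, abs_of_pos he]
  have h2 : |v| ≤ |u| + |f| := by
    rw [hv]; refine (abs_add_le _ _).trans ?_
    rw [abs_mul, abs_of_pos he]; nlinarith [abs_nonneg f]
  rw [show x ^ 2 - y ^ 2 = (x - y) * (x + y) by ring, abs_mul]
  calc _ ≤ (e * |f|) * ((|u| + |f|) + |u|) := by
        gcongr
        · linarith
        · exact (abs_add_le _ _).trans (by linarith)
    _ = e * (|f| * (2 * |u| + |f|)) := by ring
    _ ≤ _ := by
      gcongr
      nlinarith [sq_nonneg (|u| - |f|), sq_abs u, sq_abs f]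

lemma grad_aux {g η : EE N} {e : ℝ} (he : 0 < e) (he1 : e < 1) : |‖g + e • η‖ ^ 2 - ‖g‖ ^ 2| ≤ e * (‖g‖ ^ 2 + 2 * ‖η‖ ^ 2) := by
  rw [norm_add_sq_real, norm_smul, inner_smul_right, mul_pow, Real.norm_eq_abs, sq_abs]
  have h1 := abs_real_inner_le_norm g η
  have h2 : |inner ℝ g η| * 2 ≤ ‖g‖ ^ 2 + ‖η‖ ^ 2 := by nlinarith [sq_nonneg (‖g‖ - ‖η‖)]
  have h3 : e ^ 2 * ‖η‖ ^ 2 ≤ e * ‖η‖ ^ 2 := by gcongr; nlinarith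
  have h4 := mul_le_mul_of_nonneg_left h2 he.le
  have h5 : 0 ≤ e ^ 2 * ‖η‖ ^ 2 := by positivity
  have h6 := mul_le_mul_of_nonneg_left (neg_abs_le (inner ℝ g η)) he.le
  have h7 := mul_le_mul_of_nonneg_left (le_abs_self (inner ℝ g η)) he.le
  rw [abs_le]
  constructor <;> nlinarith

lemma Prob.B_deriv (P : Prob N D wt a0 a1 p lam) {u φ : EE N → ℝ} {g η : EE N → EE N} (h : IsW D u g) (hφ : IsW D φ η)
    {e : ℕ → ℝ} (he : ∀ n, 0 < e n) (he1 : ∀ n, e n < 1) (he0 : Tendsto e atTop (𝓝 0)) :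
    Tendsto (fun n => (Bf D wt p (u + e n • φ) - Bf D wt p u) / e n) atTop (𝓝 ((p + 1) * ∫ z in D, wt z * (|u z| ^ (p - 1) * u z * φ z))) := by
  have hp := P.hp
  have e1 : ∀ n, (Bf D wt p (u + e n • φ) - Bf D wt p u) / e n = ∫ z in D, wt z * ((|(u + e n • φ) z| ^ (p + 1) - |u z| ^ (p + 1)) / e n) := by
    intro n
    unfold Bf
    rw [← integral_sub (P.wint (P.iq (h.add (hφ.smul _)))) (P.wint (P.iq h)), ← integral_div]
    congr 1; ext z; ring
  simp_rw [e1]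
  rw [← integral_const_mul]
  refine tendsto_integral_of_dominated_convergence (fun z => (p + 1) * (wt z * (|u z| + |φ z|) ^ (p + 1))) (fun n => ?_) ((P.B_bound h hφ).const_mul _) (fun n => ?_) ?_
  · have := (P.wint (((P.iq (h.add (hφ.smul (e n)))).sub (P.iq h)).div_const (e n))).1
    exact this
  · filter_upwards [P.aew] with z hz
    have hw := P.ha0.le.trans hz.1
    have := rpow_aux (x := (u + e n • φ) z) (y := u z) (f := φ z) (u := u z) P.hp (he n) (he1 n) (by
      simp only [Pi.add_apply, Pi.smul_apply, smul_eq_mul]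
      refine (abs_add_le _ _).trans ?_
      rw [abs_mul, abs_of_pos (he n)]
      nlinarith [abs_nonneg (φ z), he1 n]) (by linarith [abs_nonneg (φ z)]) (by simp [abs_mul, abs_of_pos (he n)])
    rw [norm_mul, norm_div, Real.norm_of_nonneg hw, Real.norm_of_nonneg (he n).le, Real.norm_eq_abs]
    rw [show (p + 1) * (wt z * (|u z| + |φ z|) ^ (p + 1)) = wt z * ((p + 1) * (|u z| + |φ z|) ^ (p + 1)) by ring]
    gcongr
    rw [div_le_iff₀ (he n)]
    linarith
  · refine Eventually.of_forall fun z => ?_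
    have hd := (hasDerivAt_abs_rpow (u z) (show 1 < p + 1 by linarith))
    have hd2 : HasDerivAt (fun t => |u z + t * φ z| ^ (p + 1)) ((p + 1) * |u z| ^ (p + 1 - 2) * u z * φ z) 0 := by
      have h0 : HasDerivAt (fun t => u z + t * φ z) (φ z) 0 := by simpa using ((hasDerivAt_id (0:ℝ)).mul_const (φ z)).const_add (u z)
      exact HasDerivAt.comp (0:ℝ) (h₂ := fun x : ℝ => |x| ^ (p + 1)) (h := fun t => u z + t * φ z) (by simpa using hd) h0
    have ht : Tendsto e atTop (𝓝[≠] 0) := tendsto_nhdsWithin_iff.2 ⟨he0, Eventually.of_forall fun n => (he n).ne'⟩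
    have := ((hasDerivAt_iff_tendsto_slope.1 hd2).comp ht).const_mul (wt z)
    convert this using 1
    · ext n
      simp [slope_def_field]
    · congr 1
      rw [show p + 1 - 2 = p - 1 by ring]; ring

lemma max_sub_le (x y : ℝ) : |max x 0 - max y 0| ≤ |x - y| := abs_max_sub_max_le_abs _ _ _

lemma max_abs_le (x : ℝ) : |max x 0| ≤ |x| := by simpa using max_sub_le x 0

lemma gP_aux {u φ : EE N → ℝ} {g η : EE N → EE N} {e : ℝ} (he : 0 < e) (he1 : e < 1) (z : EE N) :
    |‖gP (u + e • φ) (g + e • η) z‖ ^ 2 - ‖gP u g z‖ ^ 2| ≤ e * (‖g z‖ ^ 2 + 2 * ‖η z‖ ^ 2) + Sfun u φ g e z := by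
  have h1 := grad_aux (g := g z) (η := η z) he he1
  have h0 : 0 ≤ e * (‖g z‖ ^ 2 + 2 * ‖η z‖ ^ 2) := by positivity
  simp only [gP, Sfun, Pi.add_apply, Pi.smul_apply, smul_eq_mul]
  by_cases hv : 0 < u z + e * φ z <;> by_cases hu : 0 < u z
  · simp only [hv, hu, if_true]
    split_ifs <;> nlinarith [sq_nonneg ‖g z‖]
  · have : u z * (u z + e * φ z) ≤ 0 := by nlinarith
    simp only [hv, hu, this, if_true, if_false]
    rw [abs_le] at h1 ⊢
    constructor <;> simp <;> nlinarith [sq_nonneg ‖g z + e • η z‖, sq_nonneg ‖g z‖]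
  · have : u z * (u z + e * φ z) ≤ 0 := by nlinarith
    simp only [hv, hu, this, if_true, if_false]
    simp; linarith
  · simp only [hv, hu, if_false]
    split_ifs <;> simp <;> positivity

lemma uM_eq (u : EE N → ℝ) : uM u = uP (-u) := rfl
lemma gM_eq (u : EE N → ℝ) (g : EE N → EE N) : gM u g = gP (-u) (-g) := by
  ext1 z; simp [gM, gP]
lemma Sfun_neg (u φ : EE N → ℝ) (g : EE N → EE N) (e : ℝ) : Sfun (-u) (-φ) (-g) e = Sfun u φ g e := by
  ext1 z
  simp only [Sfun, Pi.neg_apply, norm_neg]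
  rw [show -u z * (-u z + e * -φ z) = u z * (u z + e * φ z) by ring]

lemma Prob.half (P : Prob N D wt a0 a1 p lam) {u φ : EE N → ℝ} {g η : EE N → EE N} (h : IsW D u g) (hφ : IsW D φ η)
    {C : ℝ} (hC : ∀ e, 0 < e → e < 1 → ∫ z in D, Sfun u φ g e z ≤ C * e) :
    ∃ C' : ℝ, ∀ e, 0 < e → e < 1 → |Af D wt lam (uP (u + e • φ)) (gP (u + e • φ) (g + e • η)) - Af D wt lam (uP u) (gP u g)| ≤ C' * e ∧
      |Bf D wt p (uP (u + e • φ)) - Bf D wt p (uP u)| ≤ C' * e := by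
  have := finMeas P.hb
  refine ⟨max (C + (∫ z in D, (‖g z‖ ^ 2 + 2 * ‖η z‖ ^ 2)) + lam * ∫ z in D, wt z * (u z ^ 2 + 2 * φ z ^ 2)) ((p + 1) * ∫ z in D, wt z * (|u z| + |φ z|) ^ (p + 1)), fun e he he1 => ⟨?_, ?_⟩⟩
  · refine (P.x_bound h hφ (h.add (hφ.smul e)).pos_part h.pos_part (hC e he he1) ?_ (gP_aux he he1)).trans ?_
    · intro z
      exact sq_aux (v := (u + e • φ) z) he he1 (by simp) (max_abs_le _) (max_abs_le _) (max_sub_le _ _)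
    · gcongr
      exact le_max_left _ _
  · refine (P.y_bound h hφ (h.add (hφ.smul e)).pos_part h.pos_part he he1 ?_ ?_ ?_).trans ?_
    · intro z
      refine (max_abs_le _).trans ?_
      simp only [Pi.add_apply, Pi.smul_apply, smul_eq_mul]
      refine (abs_add_le _ _).trans ?_
      rw [abs_mul, abs_of_pos he]
      nlinarith [abs_nonneg (φ z)]
    · intro z
      exact (max_abs_le _).trans (by linarith [abs_nonneg (φ z)])
    · intro z
      refine (max_sub_le _ _).trans ?_
      simp [abs_mul, abs_of_pos he]
    · gcongr
      exact le_max_right _ _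

lemma Prob.EL_ineq (P : Prob N D wt a0 a1 p lam) {u φ : EE N → ℝ} {g η : EE N → EE N} (h : IsMinz D wt p lam u g) (hφ : IsW D φ η)
    {C : ℝ} (hC : ∀ e, 0 < e → e < 1 → ∫ z in D, Sfun u φ g e z ≤ C * e) :
    (∫ z in D, wt z * (|u z| ^ (p - 1) * u z * φ z)) ≤ (∫ z in D, inner ℝ (g z) (η z)) + lam * ∫ z in D, wt z * (u z * φ z) := by
  have hp := P.hp
  have hW := h.hW
  obtain ⟨C1, h1⟩ := P.half hW hφ hC
  obtain ⟨C2, h2⟩ := P.half hW.neg hφ.neg (C := C) (by simpa only [Sfun_neg] using hC)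
  have h2' : ∀ e, 0 < e → e < 1 → |Af D wt lam (uM (u + e • φ)) (gM (u + e • φ) (g + e • η)) - Af D wt lam (uM u) (gM u g)| ≤ C2 * e ∧
      |Bf D wt p (uM (u + e • φ)) - Bf D wt p (uM u)| ≤ C2 * e := by
    intro e he he1
    have := h2 e he he1
    rw [smul_neg, smul_neg, ← neg_add, ← neg_add, ← uM_eq, ← uM_eq, ← gM_eq, ← gM_eq] at this
    exact this
  let e : ℕ → ℝ := fun n => 1 / ((n : ℝ) + 1 + 1)
  have he : ∀ n, 0 < e n := fun n => by positivity
  have he1 : ∀ n, e n < 1 := fun n => by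
    simp only [e]; rw [div_lt_one (by positivity)]; linarith [(Nat.cast_nonneg n : (0:ℝ) ≤ n)]
  have he0 : Tendsto e atTop (𝓝 0) := by
    have := (tendsto_add_atTop_iff_nat 1).2 (tendsto_one_div_add_atTop_nhds_zero_nat (𝕜 := ℝ))
    simpa [e] using this
  let v : ℕ → EE N → ℝ := fun n => u + e n • φ
  let gv : ℕ → EE N → EE N := fun n => g + e n • η
  have hv : ∀ n, IsW D (v n) (gv n) := fun n => hW.add (hφ.smul _)
  have F1 := Ff_seq (b := Bf D wt p (uP u)) (C := C1) hp h.hBp (x := fun n => Af D wt lam (uP (v n)) (gP (v n) (gv n)) - Bf D wt p (uP u))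
    (y := fun n => Bf D wt p (uP (v n)) - Bf D wt p (uP u)) he he0 (fun n => by rw [← h.hAp]; exact (h1 _ (he n) (he1 n)).1) (fun n => (h1 _ (he n) (he1 n)).2)
  have F2 := Ff_seq (b := Bf D wt p (uM u)) (C := C2) hp h.hBm (x := fun n => Af D wt lam (uM (v n)) (gM (v n) (gv n)) - Bf D wt p (uM u))
    (y := fun n => Bf D wt p (uM (v n)) - Bf D wt p (uM u)) he he0 (fun n => by rw [← h.hAm]; exact (h2' _ (he n) (he1 n)).1) (fun n => (h2' _ (he n) (he1 n)).2)
  simp only [add_sub_cancel] at F1 F2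
  have B1 : Tendsto (fun n => Bf D wt p (uP (v n))) atTop (𝓝 (Bf D wt p (uP u))) := by
    rw [tendsto_iff_norm_sub_tendsto_zero]
    exact squeeze_zero (fun n => norm_nonneg _) (fun n => (h1 _ (he n) (he1 n)).2) (by simpa using he0.const_mul C1)
  have B2 : Tendsto (fun n => Bf D wt p (uM (v n))) atTop (𝓝 (Bf D wt p (uM u))) := by
    rw [tendsto_iff_norm_sub_tendsto_zero]
    exact squeeze_zero (fun n => norm_nonneg _) (fun n => (h2' _ (he n) (he1 n)).2) (by simpa using he0.const_mul C2)
  have BD := P.B_deriv hW hφ he he1 he0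
  have AD : Tendsto (fun n => (Af D wt lam (v n) (gv n) - Af D wt lam u g) / e n) atTop (𝓝 (2 * ((∫ z in D, inner ℝ (g z) (η z)) + lam * ∫ z in D, wt z * (u z * φ z)))) := by
    have := (he0.mul_const (Af D wt lam φ η)).const_add (2 * ((∫ z in D, inner ℝ (g z) (η z)) + lam * ∫ z in D, wt z * (u z * φ z)))
    simp only [zero_mul, add_zero] at this
    refine this.congr fun n => ?_
    have h0 := (he n).ne'
    simp only [v, gv]
    rw [P.A_expand hW hφ]
    field_simp
  have tot := ((F1.add F2).add (AD.const_mul ((p + 1) / (p - 1)))).add (BD.const_mul (1 - (p + 1) / (p - 1)))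
  have key := ge_of_tendsto (b := 0) tot (by
    filter_upwards [B1.eventually (lt_mem_nhds h.hBp), B2.eventually (lt_mem_nhds h.hBm)] with n hn1 hn2
    have hm := h.hmin (v n) (gv n) (hv n) hn1 hn2
    have s1 := P.A_split (hv n)
    have s2 := P.A_split hW
    have s3 := P.B_split (hv n)
    have s4 := P.B_split hW
    rw [h.hAp, h.hAm] at s2
    rw [← s1, ← s2, show u + e n • φ = v n from rfl, ← s3, ← s4, mul_div_assoc', mul_div_assoc', ← add_div, ← add_div, ← add_div]
    refine div_nonneg ?_ (he n).le
    linarith)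
  have hp1 : 0 < p - 1 := by linarith
  set E1 := (∫ z in D, inner ℝ (g z) (η z)) + lam * ∫ z in D, wt z * (u z * φ z)
  set E2 := ∫ z in D, wt z * (|u z| ^ (p - 1) * u z * φ z)
  have e3 : 0 + 0 + (p + 1) / (p - 1) * (2 * E1) + (1 - (p + 1) / (p - 1)) * ((p + 1) * E2) = (2 * (p + 1) / (p - 1)) * (E1 - E2) := by
    field_simp; ring
  rw [e3] at key
  have := nonneg_of_mul_nonneg_right key (by positivity)
  linarith

def Tr (δ : ℝ) (u : EE N → ℝ) : EE N → ℝ := fun z => max (-δ) (min (u z) δ)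
def gTr (δ : ℝ) (u : EE N → ℝ) (g : EE N → EE N) : EE N → EE N := fun z => if |u z| ≤ δ then g z else 0

lemma IsW.trunc [IsFiniteMeasure ((volume : Measure (EE N)).restrict D)] {u : EE N → ℝ} {g : EE N → EE N} (h : IsW D u g) {δ : ℝ} (hδ : 0 ≤ δ) :
    IsW D (Tr δ u) (gTr δ u g) := by
  refine ((h.sub (h.pos hδ)).add (h.neg.pos hδ)).congr (Eventually.of_forall fun z => ?_) (Eventually.of_forall fun z => ?_)
  · simp only [Pi.add_apply, Pi.sub_apply, Pi.neg_apply, Tr]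
    rcases le_total (u z) δ with h1 | h1
    · rw [max_eq_right (by linarith), min_eq_left h1]
      rcases le_total (-δ) (u z) with h2 | h2
      · rw [max_eq_right (by linarith), max_eq_right h2]; ring
      · rw [max_eq_left (by linarith), max_eq_left h2]; ring
    · rw [max_eq_left (by linarith), min_eq_right h1, max_eq_right (by linarith), max_eq_right (by linarith)]; ring
  · simp only [Pi.add_apply, Pi.sub_apply, Pi.neg_apply, gTr, abs_le]
    by_cases h1 : δ < u z
    · simp [h1, h1.not_ge, show ¬ (δ < - u z) by linarith]
    · by_cases h2 : δ < - u z
      · simp [h1, h2, show ¬ (-δ ≤ u z) by linarith]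
      · simp [h1, h2, show (-δ ≤ u z) by linarith, not_lt.1 h1]

lemma Tr_abs {δ : ℝ} (hδ : 0 ≤ δ) (u : EE N → ℝ) (z : EE N) : |Tr δ u z| ≤ δ :=
  abs_le.2 ⟨le_max_left _ _, max_le (by linarith) (min_le_right _ _)⟩

lemma Tr_mul {δ : ℝ} (hδ : 0 ≤ δ) (u : EE N → ℝ) (z : EE N) : 0 ≤ u z * Tr δ u z ∧ u z * Tr δ u z ≤ u z ^ 2 ∧ |Tr δ u z| ≤ |u z| := by
  simp only [Tr]
  rcases le_total (u z) δ with h1 | h1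
  · rw [min_eq_left h1]
    rcases le_total (-δ) (u z) with h2 | h2
    · rw [max_eq_right h2]; exact ⟨by nlinarith, by nlinarith, le_rfl⟩
    · rw [max_eq_left h2, abs_of_nonpos (by linarith : -δ ≤ 0), abs_of_nonpos (by linarith : u z ≤ 0)]; exact ⟨by nlinarith, by nlinarith, by linarith⟩
  · rw [min_eq_right h1, max_eq_right (by linarith), abs_of_nonneg hδ, abs_of_nonneg (by linarith)]; exact ⟨by nlinarith, by nlinarith, h1⟩

lemma Prob.i3 (P : Prob N D wt a0 a1 p lam) {u φ : EE N → ℝ} {g η : EE N → EE N} (h : IsW D u g) (hφ : IsW D φ η) :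
    Integrable (fun z => |u z| ^ (p - 1) * |u z| * |φ z|) (volume.restrict D) := by
  have hp := P.hp
  have h0 := ((P.memq h).norm.add (P.memq hφ).norm).integrable_norm_rpow (by exact_mod_cast P.qq0.ne') (by simp)
  simp only [ENNReal.coe_toReal, P.qq_coe] at h0
  refine h0.mono' ?_ (Eventually.of_forall fun z => ?_)
  · have m1 := h.1.1.aemeasurable.abs
    have m2 := hφ.1.1.aemeasurable.abs
    exact ((((m1.pow_const (p - 1))).mul m1).mul m2).aestronglyMeasurable
  · rw [Real.norm_of_nonneg (by positivity), Pi.add_apply, Real.norm_of_nonneg (by positivity : (0:ℝ) ≤ ‖u z‖ + ‖φ z‖)]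
    simp only [Real.norm_eq_abs]
    rcases eq_or_ne (|u z| + |φ z|) 0 with h | h
    · have h1 : |u z| = 0 := by linarith [abs_nonneg (u z), abs_nonneg (φ z)]
      rw [h, h1]; simp; positivity
    · rw [show p + 1 = (p - 1) + 1 + 1 by ring, Real.rpow_add_one h, Real.rpow_add_one h]
      have a1 := abs_nonneg (u z)
      have a2 := abs_nonneg (φ z)
      gcongr
      · linarith
      · linarith
      · linarith

lemma Prob.i3' (P : Prob N D wt a0 a1 p lam) {u φ : EE N → ℝ} {g η : EE N → EE N} (h : IsW D u g) (hφ : IsW D φ η) :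
    Integrable (fun z => |u z| ^ (p - 1) * u z * φ z) (volume.restrict D) := by
  refine (P.i3 h hφ).mono' ?_ (Eventually.of_forall fun z => ?_)
  · have m1 := h.1.1.aemeasurable
    exact ((((m1.abs.pow_const (p - 1))).mul m1).mul hφ.1.1.aemeasurable).aestronglyMeasurable
  · rw [norm_mul, norm_mul, Real.norm_of_nonneg (by positivity)]; rfl

lemma Prob.i4 (P : Prob N D wt a0 a1 p lam) {u : EE N → ℝ} {g : EE N → EE N} (h : IsW D u g) :
    Integrable (fun z => |u z| ^ (p - 1) * |u z|) (volume.restrict D) := by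
  have := finMeas P.hb
  have hp := P.hp
  refine ((integrable_const (1:ℝ)).add (P.iq h)).mono' ?_ (Eventually.of_forall fun z => ?_)
  · have m1 := h.1.1.aemeasurable.abs
    exact (((m1.pow_const (p - 1))).mul m1).aestronglyMeasurable
  · rw [Real.norm_of_nonneg (by positivity), Pi.add_apply]
    rcases eq_or_ne (|u z|) 0 with h | h
    · rw [h]; simp; positivity
    · rw [show p + 1 = (p - 1) + 1 + 1 by ring, Real.rpow_add_one h, ← Real.rpow_add_one h]
      rcases le_total (|u z|) 1 with h1 | h1
      · have := Real.rpow_le_one (abs_nonneg _) h1 (by linarith : 0 ≤ p - 1 + 1)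
        nlinarith [Real.rpow_nonneg (abs_nonneg (u z)) (p - 1 + 1), abs_nonneg (u z)]
      · nlinarith [Real.rpow_nonneg (abs_nonneg (u z)) (p - 1 + 1), abs_nonneg (u z)]

lemma Prob.level (P : Prob N D wt a0 a1 p lam) {u : EE N → ℝ} {g : EE N → EE N} (h : IsMinz D wt p lam u g) :
    ∃ C : ℝ, ∀ δ, 0 < δ → ∫ z in D, ‖gTr δ u g z‖ ^ 2 ≤ C * δ := by
  have := finMeas P.hb
  have hW := h.hW
  refine ⟨∫ z in D, wt z * (|u z| ^ (p - 1) * |u z|), fun δ hδ => ?_⟩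
  have hT := hW.trunc hδ.le
  have key := P.EL_ineq h hT.neg (C := 0) (fun e he he1 => by
    rw [zero_mul]
    refine le_of_eq (integral_eq_zero_of_ae ?_)
    filter_upwards [hW.grad_zero P.hD] with z hz
    simp only [Sfun, Pi.neg_apply, Pi.zero_apply]
    rcases eq_or_ne (u z) 0 with h0 | h0
    · simp [hz h0]
    · have h1 : 0 < u z ^ 2 := by positivity
      have h2 := (Tr_mul hδ.le u z).2.1
      rw [if_neg]
      nlinarith)
  have e1 : (∫ z in D, inner ℝ (g z) ((-gTr δ u g) z)) = - ∫ z in D, ‖gTr δ u g z‖ ^ 2 := by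
    rw [← integral_neg]; congr 1; ext z
    simp only [Pi.neg_apply, inner_neg_right, gTr]
    split_ifs
    · rw [real_inner_self_eq_norm_sq]
    · simp
  have e2 : (∫ z in D, wt z * (u z * (-Tr δ u) z)) ≤ 0 := by
    refine integral_nonpos_of_ae ?_
    filter_upwards [P.aew] with z hz
    have hw := P.ha0.le.trans hz.1
    have := (Tr_mul hδ.le u z).1
    simp only [Pi.neg_apply, Pi.zero_apply]
    have := mul_nonneg hw this
    linarith
  have e3 : - ((∫ z in D, wt z * (|u z| ^ (p - 1) * |u z|)) * δ) ≤ ∫ z in D, wt z * (|u z| ^ (p - 1) * u z * (-Tr δ u) z) := by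
    rw [← integral_mul_const, ← integral_neg]
    refine integral_mono_ae ((P.wint (P.i4 hW)).mul_const δ).neg (P.wint (P.i3' hW hT.neg)) ?_
    filter_upwards [P.aew] with z hz
    have hw := P.ha0.le.trans hz.1
    have h1 := Tr_abs hδ.le u z
    have h2 : |u z| ^ (p - 1) * u z * Tr δ u z ≤ |u z| ^ (p - 1) * |u z| * δ := by
      refine (le_abs_self _).trans ?_
      rw [abs_mul, abs_mul, abs_of_nonneg (by positivity)]
      gcongr
    have := mul_le_mul_of_nonneg_left h2 hw
    simp only [Pi.neg_apply]
    linarith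
  rw [e1] at key
  have := mul_le_mul_of_nonneg_left e2 P.hlam.le
  linarith

lemma Prob.EL_half (P : Prob N D wt a0 a1 p lam) {u φ : EE N → ℝ} {g η : EE N → EE N} (h : IsMinz D wt p lam u g) (hφ : IsW D φ η) {K : ℝ} (hK : 0 < K) (hb : ∀ z, |φ z| ≤ K) :
    (∫ z in D, wt z * (|u z| ^ (p - 1) * u z * φ z)) ≤ (∫ z in D, inner ℝ (g z) (η z)) + lam * ∫ z in D, wt z * (u z * φ z) := by
  have := finMeas P.hb
  obtain ⟨C, hC⟩ := P.level h
  refine P.EL_ineq h hφ (C := C * K) fun e he he1 => ?_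
  refine le_trans ?_ ((hC (e * K) (by positivity)).trans (by linarith))
  refine integral_mono (Sfun_int h.hW hφ e) (Prob.ig (h.hW.trunc (by positivity))) fun z => ?_
  simp only [Sfun, gTr]
  split_ifs with h1 h2 h3
  · exact le_rfl
  · exfalso
    apply h2
    have h4 : |u z| * |u z| ≤ |u z| * (e * K) := by
      have : -(u z * (e * φ z)) ≤ |u z| * (e * K) := by
        refine (neg_le_abs _).trans ?_
        rw [abs_mul, abs_mul, abs_of_pos he]
        gcongr
        exact hb z
      rw [abs_mul_abs_self]; nlinarith
    rcases eq_or_ne (u z) 0 with h0 | h0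
    · rw [h0]; simp; positivity
    · exact le_of_mul_le_mul_left h4 (by positivity)
  · positivity
  · simp

def WeakEq (D : Set (EE N)) (wt : EE N → ℝ) (p lam : ℝ) (u : EE N → ℝ) (g : EE N → EE N) : Prop :=
  ∀ φ η, IsW D φ η → (∫ z in D, inner ℝ (g z) (η z)) + lam * (∫ z in D, wt z * (u z * φ z)) = ∫ z in D, wt z * (|u z| ^ (p - 1) * u z * φ z)

lemma Prob.EL_bdd (P : Prob N D wt a0 a1 p lam) {u φ : EE N → ℝ} {g η : EE N → EE N} (h : IsMinz D wt p lam u g) (hφ : IsW D φ η) {K : ℝ} (hK : 0 < K) (hb : ∀ z, |φ z| ≤ K) :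
    (∫ z in D, inner ℝ (g z) (η z)) + lam * (∫ z in D, wt z * (u z * φ z)) = ∫ z in D, wt z * (|u z| ^ (p - 1) * u z * φ z) := by
  refine le_antisymm ?_ (P.EL_half h hφ hK hb)
  have := P.EL_half h hφ.neg hK (by simpa using hb)
  simp only [Pi.neg_apply, inner_neg_right, mul_neg, integral_neg] at this
  linarith

lemma Tr_tendsto (φ : EE N → ℝ) (z : EE N) : ∀ᶠ n : ℕ in atTop, |φ z| ≤ (n:ℝ) + 1 := by
  obtain ⟨m, hm⟩ := exists_nat_ge (|φ z|)
  filter_upwards [eventually_ge_atTop m] with n hn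
  have : (m : ℝ) ≤ n := by exact_mod_cast hn
  linarith

theorem Prob.EL (P : Prob N D wt a0 a1 p lam) {u : EE N → ℝ} {g : EE N → EE N} (h : IsMinz D wt p lam u g) : WeakEq D wt p lam u g := by
  intro φ η hφ
  have := finMeas P.hb
  have hW := h.hW
  have hT : ∀ n : ℕ, IsW D (Tr ((n:ℝ) + 1) φ) (gTr ((n:ℝ) + 1) φ η) := fun n => hφ.trunc (by positivity)
  have eq : ∀ n : ℕ, _ := fun n => P.EL_bdd h (hT n) (K := (n:ℝ) + 1) (by positivity) (Tr_abs (by positivity) φ)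
  have Teq : ∀ z, ∀ n : ℕ, |φ z| ≤ (n:ℝ) + 1 → Tr ((n:ℝ) + 1) φ z = φ z := fun z n hn => by
    rw [abs_le] at hn
    simp only [Tr]; rw [min_eq_left hn.2, max_eq_right hn.1]
  have t1 : Tendsto (fun n : ℕ => ∫ z in D, inner ℝ (g z) (gTr ((n:ℝ) + 1) φ η z)) atTop (𝓝 (∫ z in D, inner ℝ (g z) (η z))) := by
    refine tendsto_integral_of_dominated_convergence (fun z => ‖g z‖ * ‖η z‖) (fun n => (int_inner hW.2.1 (hT n).2.1).1) (hW.2.1.norm.integrable_mul hφ.2.1.norm) (fun n => Eventually.of_forall fun z => ?_) (Eventually.of_forall fun z => ?_)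
    · refine (norm_inner_le_norm _ _).trans ?_
      gcongr
      simp only [gTr]; split_ifs
      · exact le_rfl
      · simp
    · refine tendsto_const_nhds.congr' ?_
      filter_upwards [Tr_tendsto φ z] with n hn
      simp [gTr, hn]
  have t2 : Tendsto (fun n : ℕ => ∫ z in D, wt z * (u z * Tr ((n:ℝ) + 1) φ z)) atTop (𝓝 (∫ z in D, wt z * (u z * φ z))) := by
    refine tendsto_integral_of_dominated_convergence (fun z => wt z * (|u z| * |φ z|)) (fun n => (P.wint (hW.1.integrable_mul (hT n).1)).1) (P.wint (hW.1.norm.integrable_mul hφ.1.norm)) (fun n => ?_) (Eventually.of_forall fun z => ?_)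
    · filter_upwards [P.aew] with z hz
      have hw := P.ha0.le.trans hz.1
      rw [norm_mul, norm_mul, Real.norm_of_nonneg hw, Real.norm_eq_abs, Real.norm_eq_abs]
      have h5 := (Tr_mul (by positivity : (0:ℝ) ≤ (n:ℝ) + 1) φ z).2.2
      gcongr
    · refine tendsto_const_nhds.congr' ?_
      filter_upwards [Tr_tendsto φ z] with n hn
      rw [Teq z n hn]
  have t3 : Tendsto (fun n : ℕ => ∫ z in D, wt z * (|u z| ^ (p - 1) * u z * Tr ((n:ℝ) + 1) φ z)) atTop (𝓝 (∫ z in D, wt z * (|u z| ^ (p - 1) * u z * φ z))) := by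
    refine tendsto_integral_of_dominated_convergence (fun z => wt z * (|u z| ^ (p - 1) * |u z| * |φ z|)) (fun n => (P.wint (P.i3' hW (hT n))).1) (P.wint (P.i3 hW hφ)) (fun n => ?_) (Eventually.of_forall fun z => ?_)
    · filter_upwards [P.aew] with z hz
      have hw := P.ha0.le.trans hz.1
      rw [norm_mul, norm_mul, norm_mul, Real.norm_of_nonneg hw, Real.norm_of_nonneg (by positivity : (0:ℝ) ≤ |u z| ^ (p - 1)), Real.norm_eq_abs, Real.norm_eq_abs]
      have h5 := (Tr_mul (by positivity : (0:ℝ) ≤ (n:ℝ) + 1) φ z).2.2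
      gcongr
    · refine tendsto_const_nhds.congr' ?_
      filter_upwards [Tr_tendsto φ z] with n hn
      rw [Teq z n hn]
  refine tendsto_nhds_unique ((t1.add (t2.const_mul lam)).congr fun n => eq n) t3

end P6sec


section P7sec
open scoped ENNReal NNReal Topology
variable {N : ℕ} {D : Set (EE N)}
variable {wt : EE N → ℝ} {a0 a1 p lam : ℝ}

/-- fast geometric convergence -/
lemma fastgeo {Y : ℕ → ℝ} {C b β : ℝ} (hC : 0 < C) (hb : 1 < b) (hβ : 0 < β) (hY : ∀ j, 0 ≤ Y j)
    (hrec : ∀ j, Y (j + 1) ≤ C * b ^ j * (Y j) ^ (1 + β)) :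
    ∀ θ : ℝ, 0 < θ → C * θ ^ β ≤ b ^ (-(1 / β)) → Y 0 ≤ θ → ∀ j, Y j ≤ θ * (b ^ (-(1 / β))) ^ j := by
  intro θ hθ hCθ h0 j
  set r := b ^ (-(1 / β)) with hr
  have hr0 : 0 < r := by positivity
  have hbr : b * r ^ β = 1 := by
    rw [hr, ← Real.rpow_mul (by linarith), show -(1 / β) * β = -1 by field_simp, Real.rpow_neg_one]
    exact mul_inv_cancel₀ (by linarith)
  induction j with
  | zero => simpa using h0
  | succ j ih =>
    calc Y (j + 1) ≤ C * b ^ j * (Y j) ^ (1 + β) := hrec j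
      _ ≤ C * b ^ j * (θ * r ^ j) ^ (1 + β) := by
        have := hY j
        gcongr
      _ = (θ * r ^ j) * (C * θ ^ β) * (b * r ^ β) ^ j := by
        rw [Real.rpow_add (by positivity), Real.rpow_one, Real.mul_rpow hθ.le (by positivity), mul_pow, ← Real.rpow_natCast r j, ← Real.rpow_mul hr0.le,
          mul_comm (j:ℝ) β, Real.rpow_mul hr0.le β j, Real.rpow_natCast (r ^ β) j]
        ring
      _ = (θ * r ^ j) * (C * θ ^ β) := by rw [hbr]; simp
      _ ≤ (θ * r ^ j) * r := by gcongr
      _ = _ := by ring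

lemma degiorgi {Y : ℝ → ℝ} {C s p : ℝ} (hC : 0 < C) (hp : 1 < p) (hs : 2 < s) (hps : p + 1 < s) (hY : ∀ k, 0 ≤ Y k) (hanti : Antitone Y)
    (h0 : Tendsto Y atTop (𝓝 0))
    (hrec : ∀ h k, 0 < h → h < k → Y k ≤ C * (k ^ p * (k - h) ^ (-(s - 1)) * Y h) ^ (s / 2)) : ∃ M, 0 < M ∧ Y M = 0 := by
  set β := s / 2 - 1 with hβd
  have hβ : 0 < β := by linarith
  set b : ℝ := (2 ^ (s - 1)) ^ (s / 2) with hbd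
  have hb : 1 < b := Real.one_lt_rpow (Real.one_lt_rpow (by norm_num) (by linarith)) (by linarith)
  set C1 : ℝ := C * (2 ^ p * 2 ^ (s - 1)) ^ (s / 2) with hC1
  have hC1p : 0 < C1 := by positivity
  have : ∃ θ : ℝ, 0 < θ ∧ C1 * θ ^ β ≤ b ^ (-(1 / β)) := by
    refine ⟨(b ^ (-(1 / β)) / C1) ^ (1 / β), by positivity, ?_⟩
    rw [← Real.rpow_mul (by positivity), one_div_mul_cancel hβ.ne', Real.rpow_one]
    field_simp
    exact le_rfl
  obtain ⟨θ, hθ, hθ'⟩ := this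
  obtain ⟨M, hM1, hM2⟩ := ((h0.eventually (gt_mem_nhds hθ)).and (eventually_ge_atTop 1)).exists
  let k : ℕ → ℝ := fun j => M * (2 - (1 / 2) ^ j)
  have hk1 : ∀ j, k (j + 1) - k j = M * (1 / 2) ^ (j + 1) := fun j => by simp only [k]; rw [pow_succ]; ring
  have hkp : ∀ j, 0 < k j := fun j => by
    have : (1 / 2 : ℝ) ^ j ≤ 1 := pow_le_one₀ (by norm_num) (by norm_num)
    simp only [k]; apply mul_pos <;> linarith
  have hk2 : ∀ j, k j ≤ 2 * M := fun j => by
    have : (0:ℝ) < (1 / 2 : ℝ) ^ j := by positivity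
    simp only [k]; nlinarith
  have fg := fastgeo (Y := fun j => Y (k j)) hC1p hb hβ (fun j => hY _) (fun j => by
    have hlt : k j < k (j + 1) := by
      have : 0 < M * (1 / 2 : ℝ) ^ (j + 1) := by positivity
      linarith [hk1 j]
    refine (hrec _ _ (hkp j) hlt).trans ?_
    rw [hk1]
    have hYj := hY (k j)
    have e1 : (1 : ℝ) + β = s / 2 := by rw [hβd]; ring
    have e3 : b ^ j = (((2:ℝ) ^ (s - 1)) ^ (j:ℝ)) ^ (s / 2) := by
      rw [hbd, ← Real.rpow_natCast, ← Real.rpow_mul (by positivity), mul_comm (s / 2) (j : ℝ), Real.rpow_mul (by positivity)]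
    rw [e1, hC1, e3, mul_assoc C, mul_assoc C, ← Real.mul_rpow (by positivity) (by positivity), ← Real.mul_rpow (by positivity) (by positivity)]
    have hM0 : 0 < M := by linarith
    suffices hh : k (j + 1) ^ p * (M * (1 / 2) ^ (j + 1)) ^ (-(s - 1)) ≤ (2:ℝ) ^ p * 2 ^ (s - 1) * ((2:ℝ) ^ (s - 1)) ^ (j : ℝ) by
      have := hkp (j + 1)
      gcongr
    calc k (j + 1) ^ p * (M * (1 / 2) ^ (j + 1)) ^ (-(s - 1)) ≤ (2 * M) ^ p * (M * (1 / 2) ^ (j + 1)) ^ (-(s - 1)) := by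
          have := hkp (j + 1)
          have := hk2 (j + 1)
          gcongr
      _ = (M ^ p * M ^ (-(s - 1))) * (2 ^ p * 2 ^ (s - 1) * ((2:ℝ) ^ (s - 1)) ^ (j : ℝ)) := by
          have e2 : ((1 / 2 : ℝ) ^ (j + 1)) ^ (-(s - 1)) = 2 ^ (s - 1) * ((2:ℝ) ^ (s - 1)) ^ (j : ℝ) := by
            rw [← Real.rpow_one_add' (by positivity) (by positivity), one_div, inv_pow, Real.inv_rpow (by positivity), Real.rpow_neg (by positivity), inv_inv, ← Real.rpow_natCast, ← Real.rpow_mul (by positivity), ← Real.rpow_mul (by positivity)]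
            congr 1; push_cast; ring
          rw [Real.mul_rpow (by norm_num) hM0.le, Real.mul_rpow hM0.le (by positivity), e2]; ring
      _ ≤ 1 * (2 ^ p * 2 ^ (s - 1) * ((2:ℝ) ^ (s - 1)) ^ (j : ℝ)) := by
          gcongr
          rw [← Real.rpow_add hM0]
          exact Real.rpow_le_one_of_one_le_of_nonpos hM2 (by linarith)
      _ = _ := by ring) θ hθ hθ' (by
        have : k 0 = M := by simp [k]; ring
        simp only [this]; exact hM1.le)
  refine ⟨2 * M, by linarith, le_antisymm ?_ (hY _)⟩
  have hr1 : b ^ (-(1 / β)) < 1 := Real.rpow_lt_one_of_one_lt_of_neg hb (by rw [neg_lt_zero]; positivity)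
  have hlim := (tendsto_pow_atTop_nhds_zero_of_lt_one (by positivity) hr1).const_mul θ
  rw [mul_zero] at hlim
  exact ge_of_tendsto' hlim fun j => (hanti (hk2 j)).trans (fg j)

lemma dg_point {p s h k t : ℝ} (hp : 1 < p) (hps : p + 1 < s) (hh : 0 < h) (hhk : h < k) :
    |t| ^ (p - 1) * t * max (t - k) 0 ≤ k ^ p * (k - h) ^ (-(s - 1)) * |max (t - h) 0| ^ s := by
  have hkh : 0 < k - h := by linarith
  rcases le_total t k with ht | ht
  · rw [max_eq_right (by linarith : t - k ≤ 0), mul_zero]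
    have : 0 < k := by linarith
    positivity
  · have hw : 0 < t - h := by linarith
    rw [max_eq_left (by linarith : 0 ≤ t - k), max_eq_left hw.le, abs_of_pos (by linarith : 0 < t), abs_of_pos hw]
    have ht0 : 0 < t := by linarith
    have hk0 : 0 < k := by linarith
    rw [← Real.rpow_add_one ht0.ne', sub_add_cancel]
    have h1 : t ≤ k * (t - h) / (k - h) := by
      rw [le_div_iff₀ hkh]; nlinarith
    have h2 : (t - h) ^ (p + 1) ≤ (t - h) ^ s * (k - h) ^ (-(s - p - 1)) := by
      rw [show (t - h) ^ (p + 1) = (t - h) ^ s * (t - h) ^ (-(s - p - 1)) by rw [← Real.rpow_add hw]; congr 1; ring]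
      gcongr ?_ * ?_
      exact Real.rpow_le_rpow_of_nonpos hkh (by linarith) (by linarith)
    calc t ^ p * (t - k) ≤ (k * (t - h) / (k - h)) ^ p * (t - h) := by
          gcongr
      _ = k ^ p * (k - h) ^ (-p) * (t - h) ^ (p + 1) := by
          rw [Real.div_rpow (by positivity) hkh.le, Real.mul_rpow hk0.le hw.le, Real.rpow_neg hkh.le, Real.rpow_add_one hw.ne']; field_simp
      _ ≤ k ^ p * (k - h) ^ (-p) * ((t - h) ^ s * (k - h) ^ (-(s - p - 1))) := by gcongr
      _ = _ := by
          rw [show (k - h) ^ (-(s - 1)) = (k - h) ^ (-p) * (k - h) ^ (-(s - p - 1)) by rw [← Real.rpow_add hkh]; congr 1; ring]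
          ring

lemma Prob.memS (P : Prob N D wt a0 a1 p lam) {u : EE N → ℝ} {g : EE N → EE N} (h : IsW D u g) :
    MemLp u (sst N) (volume.restrict D) := h.memLp_q P.hN P.hD P.hb (P.qq0.trans P.qqs) le_rfl

lemma Prob.iS (P : Prob N D wt a0 a1 p lam) {u : EE N → ℝ} {g : EE N → EE N} (h : IsW D u g) :
    Integrable (fun z => |u z| ^ (sst N : ℝ)) (volume.restrict D) := by
  have := (P.memS h).integrable_norm_rpow (by exact_mod_cast (P.qq0.trans P.qqs).ne') (by simp)
  simpa using this

lemma Prob.sobS (P : Prob N D wt a0 a1 p lam) : ∃ C : ℝ, 0 < C ∧ ∀ u g, IsW D u g →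
    ∫ z in D, |u z| ^ (sst N : ℝ) ≤ C * (∫ z in D, ‖g z‖ ^ 2) ^ ((sst N : ℝ) / 2) := by
  obtain ⟨C, hC⟩ := sob_q P.hN P.hD P.hb (P.qq0.trans P.qqs) le_rfl
  have hp := P.hp
  have hs := sst_gt P.hN
  refine ⟨(C + 1 : ℝ) ^ (sst N : ℝ), (by positivity), fun u g h => ?_⟩
  have e1 := int_rpow (P.qq0.trans P.qqs).ne' (P.memS h)
  have e2 := int_sq h.2.1
  have e3 : (eLpNorm u (sst N) (volume.restrict D)).toReal ≤ (C + 1) * (eLpNorm g 2 (volume.restrict D)).toReal := by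
    have := ENNReal.toReal_mono (ENNReal.mul_ne_top ENNReal.coe_ne_top h.2.1.2.ne) (hC u g h)
    rw [ENNReal.toReal_mul, ENNReal.coe_toReal] at this
    refine this.trans ?_
    gcongr; linarith
  have e4 : ((eLpNorm g 2 (volume.restrict D)).toReal ^ 2) ^ ((sst N : ℝ) / 2) = (eLpNorm g 2 (volume.restrict D)).toReal ^ (sst N : ℝ) := by
    rw [← Real.rpow_natCast, ← Real.rpow_mul ENNReal.toReal_nonneg]
    congr 1; push_cast; ring
  calc _ = (eLpNorm u (sst N) (volume.restrict D)).toReal ^ (sst N : ℝ) := by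
        rw [← e1]; simp
    _ ≤ ((C + 1) * (eLpNorm g 2 (volume.restrict D)).toReal) ^ (sst N : ℝ) := by
        gcongr
    _ = _ := by
        rw [Real.mul_rpow (by positivity) ENNReal.toReal_nonneg, e2, e4]

lemma Prob.bdd_above (P : Prob N D wt a0 a1 p lam) {u : EE N → ℝ} {g : EE N → EE N} (hW : IsW D u g) (h : WeakEq D wt p lam u g) :
    ∃ M, 0 < M ∧ ∀ᵐ z ∂(volume.restrict D), u z ≤ M := by
  have := finMeas P.hb
  have hp := P.hp
  have hs := sst_gt P.hN
  obtain ⟨C, hC, hsob⟩ := P.sobS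
  set s : ℝ := ((sst N : ℝ≥0) : ℝ) with hsdef
  let w : ℝ → EE N → ℝ := fun k z => max (u z - k) 0
  let Y : ℝ → ℝ := fun k => ∫ z in D, |w (max k 0) z| ^ s
  have hw : ∀ k, 0 ≤ k → IsW D (w k) (fun z => if k < u z then g z else 0) := fun k hk => hW.pos hk
  have hwi : ∀ k, 0 ≤ k → Integrable (fun z => |w k z| ^ s) (volume.restrict D) := fun k hk => P.iS (hw k hk)
  have mono : ∀ k k' z, k ≤ k' → |w k' z| ^ s ≤ |w k z| ^ s := fun k k' z hkk => by
    have : w k' z ≤ w k z := max_le_max (by linarith) le_rfl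
    have h0 : 0 ≤ w k' z := le_max_right _ _
    rw [abs_of_nonneg h0, abs_of_nonneg (h0.trans this)]
    gcongr
  obtain ⟨M, hM, hYM⟩ := degiorgi (Y := Y) (C := C * a1 ^ (s / 2)) (s := s) (p := p) (by have := P.a1pos; positivity) hp hs P.hp'
    (fun k => integral_nonneg fun z => by positivity)
    (fun k k' hkk => integral_mono (hwi _ (le_max_right _ _)) (hwi _ (le_max_right _ _)) fun z => mono _ _ z (max_le_max hkk le_rfl))
    (by
      have : (0:ℝ) = ∫ z in D, (fun _ => (0:ℝ)) z := by simp
      rw [this]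
      refine tendsto_integral_filter_of_dominated_convergence (fun z => |w 0 z| ^ s) (Eventually.of_forall fun k => (hwi _ (le_max_right _ _)).1) (Eventually.of_forall fun k => Eventually.of_forall fun z => ?_) (hwi 0 le_rfl) (Eventually.of_forall fun z => ?_)
      · rw [Real.norm_of_nonneg (by positivity)]
        exact mono _ _ z (le_max_right _ _)
      · refine tendsto_const_nhds.congr' ?_
        filter_upwards [eventually_ge_atTop (u z)] with k hk
        simp only [w]
        rw [max_eq_right (a := u z - max k 0) (by linarith [le_max_left k 0]), abs_zero, Real.zero_rpow (by linarith)])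
    (by
      intro h' k hh hk
      have hk0 : 0 ≤ k := by linarith
      have e0 : Y k = ∫ z in D, |w k z| ^ s := by simp only [Y]; rw [max_eq_left hk0]
      have e1 : Y h' = ∫ z in D, |w h' z| ^ s := by simp only [Y]; rw [max_eq_left hh.le]
      rw [e0, e1]
      refine (hsob _ _ (hw k hk0)).trans ?_
      rw [mul_assoc C, ← Real.mul_rpow P.a1pos.le (by
        have : 0 < k - h' := by linarith
        have : 0 ≤ ∫ z in D, |w h' z| ^ s := integral_nonneg fun z => by positivity
        positivity)]
      gcongr
      have eq := h _ _ (hw k hk0)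
      have l1 : (∫ z in D, inner ℝ (g z) (if k < u z then g z else 0)) = ∫ z in D, ‖(if k < u z then g z else 0)‖ ^ 2 := by
        congr 1; ext z
        split_ifs
        · rw [real_inner_self_eq_norm_sq]
        · simp
      have l2 : 0 ≤ lam * (∫ z in D, wt z * (u z * w k z)) := by
        refine mul_nonneg P.hlam.le (integral_nonneg_of_ae ?_)
        filter_upwards [P.aew] with z hz
        have hwz := P.ha0.le.trans hz.1
        refine mul_nonneg hwz ?_
        simp only [w]
        rcases le_total (u z) k with hu | hu
        · rw [max_eq_right (by linarith)]; simp
        · exact mul_nonneg (by linarith) (le_max_right _ _)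
      have l3 : (∫ z in D, wt z * (|u z| ^ (p - 1) * u z * w k z)) ≤ a1 * (k ^ p * (k - h') ^ (-(s - 1)) * ∫ z in D, |w h' z| ^ s) := by
        rw [← integral_const_mul, ← integral_const_mul]
        refine integral_mono_ae (P.wint (P.i3' hW (hw k hk0))) (((hwi h' hh.le).const_mul _).const_mul _) ?_
        filter_upwards [P.aew] with z hz
        have hwz := P.ha0.le.trans hz.1
        have := dg_point (t := u z) hp P.hp' hh hk
        refine (mul_le_mul_of_nonneg_left this hwz).trans ?_
        have : 0 < k - h' := by linarith
        gcongr
        exact hz.2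
      linarith)
  refine ⟨M, hM, ?_⟩
  simp only [Y] at hYM
  rw [max_eq_left hM.le] at hYM
  rw [integral_eq_zero_iff_of_nonneg (fun z => by positivity) (hwi M hM.le)] at hYM
  filter_upwards [hYM] with z hz
  simp only [Pi.zero_apply] at hz
  rw [Real.rpow_eq_zero (abs_nonneg _) (by linarith), abs_eq_zero] at hz
  simp only [w] at hz
  linarith [le_max_left (u z - M) 0]

lemma WeakEq.neg {u : EE N → ℝ} {g : EE N → EE N} (h : WeakEq D wt p lam u g) : WeakEq D wt p lam (-u) (-g) := by
  intro φ η hφ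
  have := h φ η hφ
  simp only [Pi.neg_apply, inner_neg_left, abs_neg, neg_mul, mul_neg, integral_neg]
  linarith

theorem Prob.bdd (P : Prob N D wt a0 a1 p lam) {u : EE N → ℝ} {g : EE N → EE N} (hW : IsW D u g) (h : WeakEq D wt p lam u g) :
    ∃ M, 0 < M ∧ ∀ᵐ z ∂(volume.restrict D), |u z| ≤ M := by
  obtain ⟨M, hM, h1⟩ := P.bdd_above hW h
  obtain ⟨M', hM', h2⟩ := P.bdd_above hW.neg h.neg
  refine ⟨M + M', by positivity, ?_⟩
  filter_upwards [h1, h2] with z h3 h4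
  simp only [Pi.neg_apply] at h4
  exact abs_le.2 ⟨by linarith, by linarith⟩

end P7sec


section P8sec
open scoped ENNReal NNReal Topology ContDiff
variable {N : ℕ} {D : Set (EE N)}
variable {wt : EE N → ℝ} {a0 a1 p lam : ℝ}

/-- Laplacian of a radial function -/
lemma lapE_radial {q k k' : ℝ → ℝ} (hq : ∀ s, HasDerivAt q (k s) s) (hk : ∀ s, HasDerivAt k (k' s) s)
    (x : EE N) : lapE (fun y : EE N => q (‖y‖ ^ 2)) x = 4 * ‖x‖ ^ 2 * k' (‖x‖ ^ 2) + 2 * N * k (‖x‖ ^ 2) := by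
  have h1 : ∀ y : EE N, HasFDerivAt (fun y : EE N => ‖y‖ ^ 2) (2 • innerSL ℝ y) y := fun y => by
    simpa using (hasStrictFDerivAt_norm_sq y).hasFDerivAt
  have h2 : ∀ (y : EE N) (i : Fin N), fderiv ℝ (fun y : EE N => q (‖y‖ ^ 2)) y (EuclideanSpace.single i (1 : ℝ))
      = k (‖y‖ ^ 2) * (2 * y i) := by
    intro y i
    have := ((hq (‖y‖ ^ 2)).comp_hasFDerivAt y (h1 y)).fderiv
    rw [show (fun y : EE N => q (‖y‖ ^ 2)) = q ∘ (fun y : EE N => ‖y‖ ^ 2) from rfl, this]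
    simp [EuclideanSpace.inner_single_right]
  have h3 : ∀ i : Fin N, fderiv ℝ (fun y : EE N => fderiv ℝ (fun y : EE N => q (‖y‖ ^ 2)) y (EuclideanSpace.single i (1 : ℝ))) x
      (EuclideanSpace.single i (1 : ℝ)) = 4 * k' (‖x‖ ^ 2) * (x i) ^ 2 + 2 * k (‖x‖ ^ 2) := by
    intro i
    simp_rw [h2]
    have e1 := ((hk (‖x‖ ^ 2)).comp_hasFDerivAt x (h1 x))
    have e2 : HasFDerivAt (fun y : EE N => 2 * y i) ((2 : ℝ) • (EuclideanSpace.proj i : EE N →L[ℝ] ℝ)) x :=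
      ((EuclideanSpace.proj i : EE N →L[ℝ] ℝ).hasFDerivAt (x := x)).const_mul 2
    have e3 := (e1.mul e2).fderiv
    rw [show (fun y : EE N => k (‖y‖ ^ 2) * (2 * y i)) = (k ∘ fun y : EE N => ‖y‖ ^ 2) * (fun y : EE N => 2 * y i) from rfl, e3]
    simp [EuclideanSpace.inner_single_right]
    ring
  unfold lapE
  simp_rw [h3]
  rw [Finset.sum_add_distrib, ← Finset.mul_sum, ← EuclideanSpace.real_norm_sq_eq]
  simp
  ring

/-- a compactly supported function whose Laplacian is a difference of mollifiers -/
lemma exists_Z (hN : 3 ≤ N) : ∃ Z η : EE N → ℝ, ContDiff ℝ ∞ Z ∧ ContDiff ℝ ∞ η ∧ (∀ x, 1 ≤ ‖x‖ → Z x = 0) ∧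
    (∀ x, 1 ≤ ‖x‖ → η x = 0) ∧ (∀ x, 0 ≤ η x) ∧ ∫ x, η x = 1 ∧
    ∀ x, lapE Z x = η x - 2 ^ N * η ((2 : ℝ) • x) := by
  have : Nonempty (Fin N) := ⟨⟨0, by omega⟩⟩
  set θ : ℝ → ℝ := fun s => Real.smoothTransition (4 * s - 2) with hθ
  have hθs : ContDiff ℝ ∞ θ := Real.smoothTransition.contDiff.comp (by fun_prop)
  have hθ0 : ∀ s, s ≤ 1 / 2 → θ s = 0 := fun s hs => Real.smoothTransition.zero_of_nonpos (by linarith)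
  have hθ1 : ∀ s, 3 / 4 ≤ s → θ s = 1 := fun s hs => Real.smoothTransition.one_of_one_le (by linarith)
  have hθd : ∀ s, HasDerivAt θ (deriv θ s) s := fun s => ((hθs.differentiable (by simp)) s).hasDerivAt
  have hθm : Monotone θ := by
    intro a b hab
    exact Real.smoothTransition.monotone (by linarith)
  have hθ'0 : ∀ s, 0 ≤ deriv θ s := fun s => hθm.deriv_nonneg
  have hθ's : ∀ s, s < 1 / 2 → deriv θ s = 0 := by
    intro s hs
    have : θ =ᶠ[𝓝 s] fun _ => 0 := by
      filter_upwards [gt_mem_nhds hs] with t ht using hθ0 t ht.le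
    rw [this.deriv_eq]; simp
  have hθ'1 : ∀ s, 3 / 4 < s → deriv θ s = 0 := by
    intro s hs
    have : θ =ᶠ[𝓝 s] fun _ => 1 := by
      filter_upwards [lt_mem_nhds hs] with t ht using hθ1 t ht.le
    rw [this.deriv_eq]; simp
  have hθ'c : Continuous (deriv θ) := hθs.continuous_deriv (by simp)
  have hθ'ne : ∃ s, 0 < s ∧ deriv θ s ≠ 0 := by
    by_contra! h
    have h' : ∀ s, deriv θ s = 0 := fun s => by
      by_cases hs : 0 < s
      · exact h s hs
      · exact hθ's s (by linarith)
    have := is_const_of_deriv_eq_zero (hθs.differentiable (by simp)) h' 0 1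
    rw [hθ0 0 (by norm_num), hθ1 1 (by norm_num)] at this
    norm_num at this
  set n : ℝ := (N : ℝ) / 2 with hn
  -- mollifier before normalisation
  set ρ : ℝ → ℝ := fun s => s ^ (1 - n) * deriv θ s with hρ
  have hθdc : ContDiff ℝ ∞ (deriv θ) := (contDiff_infty_iff_deriv.1 hθs).2
  have hρs : ContDiff ℝ ∞ ρ := by
    rw [contDiff_iff_contDiffAt]
    intro s
    by_cases hs : s < 1 / 2
    · have : ρ =ᶠ[𝓝 s] fun _ => 0 := by
        filter_upwards [gt_mem_nhds hs] with t ht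
        simp [hρ, hθ's t ht]
      exact contDiffAt_const.congr_of_eventuallyEq this
    · exact (Real.contDiffAt_rpow_const_of_ne (by linarith)).mul hθdc.contDiffAt
  have hρc : Continuous ρ := hρs.continuous
  have hρ0 : ∀ s, 0 ≤ s → 0 ≤ ρ s := fun s hs => mul_nonneg (Real.rpow_nonneg hs _) (hθ'0 s)
  set H : EE N → ℝ := fun x => ρ (‖x‖ ^ 2) with hH
  have hHc : Continuous H := hρc.comp (by fun_prop)
  have hH0 : ∀ x, 0 ≤ H x := fun x => hρ0 _ (by positivity)
  have hH1 : ∀ x, 1 ≤ ‖x‖ → H x = 0 := fun x hx => by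
    simp only [hH, hρ]; rw [hθ'1 _ (by nlinarith)]; simp
  have hHcs : HasCompactSupport H := HasCompactSupport.intro (isCompact_closedBall (0 : EE N) 1) (fun x hx => hH1 x (by
    simp at hx; exact hx.le))
  have hHi : Integrable H := hHc.integrable_of_hasCompactSupport hHcs
  have hc : 0 < ∫ x, H x := by
    obtain ⟨s, hs, hs'⟩ := hθ'ne
    set x0 : EE N := EuclideanSpace.single (Classical.arbitrary (Fin N)) (√s)
    have hx0 : ‖x0‖ ^ 2 = s := by
      simp [x0, Real.sq_sqrt hs.le]
    exact hHc.integral_pos_of_hasCompactSupport_nonneg_nonzero hHcs hH0 (x := x0) (by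
      simp only [hH, hρ]
      rw [hx0]
      exact mul_ne_zero (by positivity) hs')
  set C : ℝ := (∫ x, H x)⁻¹ with hC
  set k : ℝ → ℝ := fun s => C / 4 * (s ^ (-n) * (θ s - θ (4 * s))) with hk
  have hks : ContDiff ℝ ∞ k := by
    rw [contDiff_iff_contDiffAt]
    intro s
    by_cases hs : s < 1 / 8
    · have : k =ᶠ[𝓝 s] fun _ => 0 := by
        filter_upwards [gt_mem_nhds hs] with t ht
        simp [hk, hθ0 t (by linarith), hθ0 (4 * t) (by linarith)]
      exact contDiffAt_const.congr_of_eventuallyEq this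
    · have h1 : ContDiffAt ℝ ∞ (fun s : ℝ => s ^ (-n)) s := Real.contDiffAt_rpow_const_of_ne (by linarith)
      have h2 : ContDiffAt ℝ ∞ (fun s : ℝ => θ s - θ (4 * s)) s :=
        (hθs.sub (hθs.comp (by fun_prop : ContDiff ℝ ∞ (fun s : ℝ => 4 * s)))).contDiffAt
      exact contDiffAt_const.mul (h1.mul h2)
  set q : ℝ → ℝ := fun s => ∫ t in (1:ℝ)..s, k t with hq
  have hqd : ∀ s, HasDerivAt q (k s) s := fun s =>
    intervalIntegral.integral_hasDerivAt_right (hks.continuous.intervalIntegrable _ _)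
      (hks.continuous.stronglyMeasurableAtFilter _ _) hks.continuous.continuousAt
  have hqs : ContDiff ℝ ∞ q := by
    rw [contDiff_infty_iff_deriv]
    refine ⟨fun s => (hqd s).differentiableAt, ?_⟩
    rwa [show deriv q = k from funext fun s => (hqd s).deriv]
  have hq1 : ∀ s, 1 ≤ s → q s = 0 := by
    intro s hs
    simp only [hq]
    rw [intervalIntegral.integral_congr (g := fun _ => 0)]
    · simp
    · intro t ht
      rw [Set.uIcc_of_le hs] at ht
      simp [hk, hθ1 t (by linarith [ht.1]), hθ1 (4 * t) (by linarith [ht.1])]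
  set k' : ℝ → ℝ := fun s => C / 4 * ((-n) * s ^ (-n - 1) * (θ s - θ (4 * s)) + s ^ (-n) * (deriv θ s - deriv θ (4 * s) * 4)) with hk'
  have hkd : ∀ s, HasDerivAt k (k' s) s := by
    intro s
    by_cases hs : s < 1 / 8
    · have : k =ᶠ[𝓝 s] fun _ => 0 := by
        filter_upwards [gt_mem_nhds hs] with t ht
        simp [hk, hθ0 t (by linarith), hθ0 (4 * t) (by linarith)]
      have h0 : k' s = 0 := by
        simp [hk', hθ0 s (by linarith), hθ0 (4 * s) (by linarith), hθ's s (by linarith), hθ's (4 * s) (by linarith)]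
      rw [h0]
      exact (hasDerivAt_const s 0).congr_of_eventuallyEq this
    · have h1 : HasDerivAt (fun s : ℝ => s ^ (-n)) ((-n) * s ^ (-n - 1)) s := Real.hasDerivAt_rpow_const (Or.inl (by linarith))
      have h2 : HasDerivAt (fun s : ℝ => θ (4 * s)) (deriv θ (4 * s) * 4) s := by
        exact ((hθd (4 * s)).comp s ((hasDerivAt_id s).const_mul 4)).congr_deriv (by simp)
      exact (h1.mul ((hθd s).sub h2)).const_mul _
  refine ⟨fun x => q (‖x‖ ^ 2), fun x => C * H x, hqs.comp (contDiff_norm_sq ℝ), contDiff_const.mul (hρs.comp (contDiff_norm_sq ℝ)),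
    fun x hx => hq1 _ (by nlinarith), fun x hx => by simp [hH1 x hx], fun x => mul_nonneg (inv_pos.2 hc).le (hH0 x), ?_, ?_⟩
  · rw [integral_const_mul]
    exact inv_mul_cancel₀ hc.ne'
  · intro x
    rw [lapE_radial hqd hkd]
    simp only [hH, hρ, norm_smul, Real.norm_ofNat, mul_pow]
    norm_num
    set s := ‖x‖ ^ 2 with hs
    by_cases hs8 : s < 1 / 8
    · simp [hk, hk', hθ0 s (by linarith), hθ0 (4 * s) (by linarith), hθ's s (by linarith), hθ's (4 * s) (by linarith)]
    · have hs0 : 0 < s := by linarith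
      have e1 : s ^ (-n - 1) = s ^ (-n) / s := by rw [Real.rpow_sub hs0, Real.rpow_one]
      have e2 : s ^ (1 - n) = s * s ^ (-n) := by rw [sub_eq_add_neg, Real.rpow_add hs0, Real.rpow_one]
      have e3 : (4 * s) ^ (1 - n) = 4 / 2 ^ N * (s * s ^ (-n)) := by
        rw [Real.mul_rpow (by norm_num) hs0.le, e2]
        congr 1
        rw [Real.rpow_sub (by norm_num), Real.rpow_one, hn, show (4:ℝ) = 2 ^ (2:ℝ) by norm_num, ← Real.rpow_mul (by norm_num)]
        rw [show (2:ℝ) * ((N:ℝ) / 2) = N by ring, Real.rpow_natCast]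
      simp only [hk, hk', e1, e2, e3]
      rw [show (N : ℝ) = 2 * n by rw [hn]; ring]
      field_simp
      ring

/-- very weak solutions of `-Δ u = f` in `U` -/
def VW (U : Set (EE N)) (u f : EE N → ℝ) : Prop :=
  ∀ φ : EE N → ℝ, ContDiff ℝ ∞ φ → HasCompactSupport φ → tsupport φ ⊆ U →
    ∫ y, u y * lapE φ y = -∫ y, f y * φ y

lemma lapE_affine {Z : EE N → ℝ} (hZ : ContDiff ℝ 2 Z) (c a : ℝ) (x y : EE N) :
    lapE (fun y => c * Z (a • (x - y))) y = c * a ^ 2 * lapE Z (a • (x - y)) := by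
  have hA : ∀ y : EE N, HasFDerivAt (fun y : EE N => a • (x - y)) (-(a • ContinuousLinearMap.id ℝ (EE N))) y := by
    intro y
    have := (((hasFDerivAt_id (𝕜 := ℝ) y).const_sub x).const_smul a)
    refine this.congr_fderiv ?_
    simp
  have hd : Differentiable ℝ Z := hZ.differentiable (by simp)
  have h1 : ∀ (i : Fin N) (y : EE N), fderiv ℝ (fun y => c * Z (a • (x - y))) y (EuclideanSpace.single i (1 : ℝ))
      = -(c * a) * fderiv ℝ Z (a • (x - y)) (EuclideanSpace.single i (1 : ℝ)) := by
    intro i y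
    have := (((hd (a • (x - y))).hasFDerivAt.comp y (hA y)).const_mul c).fderiv
    rw [show (fun y => c * Z (a • (x - y))) = fun y => c * (Z ∘ fun y => a • (x - y)) y from rfl, this]
    simp
    ring
  unfold lapE
  simp_rw [h1]
  rw [Finset.mul_sum]
  refine Finset.sum_congr rfl fun i _ => ?_
  have hd' : Differentiable ℝ (fun y => fderiv ℝ Z y (EuclideanSpace.single i (1 : ℝ))) := by
    have : ContDiff ℝ 1 (fderiv ℝ Z) := hZ.fderiv_right (by norm_num)
    exact (this.differentiable one_ne_zero).clm_apply (differentiable_const _)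
  have := (((hd' (a • (x - y))).hasFDerivAt.comp y (hA y)).const_mul (-(c * a))).fderiv
  rw [show (fun y => -(c * a) * fderiv ℝ Z (a • (x - y)) (EuclideanSpace.single i (1 : ℝ))) =
    fun y => -(c * a) * ((fun y => fderiv ℝ Z y (EuclideanSpace.single i (1 : ℝ))) ∘ fun y => a • (x - y)) y from rfl, this]
  simp
  ring

lemma conv_C1 {Z f : EE N → ℝ} (hZ : ContDiff ℝ 1 Z) (hc : HasCompactSupport Z) (hf : AEStronglyMeasurable f volume)
    {M : ℝ} (hM : ∀ x, |f x| ≤ M) :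
    ContDiff ℝ 1 (fun x => ∫ y, f y * Z (x - y)) ∧ (∀ x, ‖∫ y, f y * Z (x - y)‖ ≤ M * ∫ y, ‖Z y‖) ∧
    ∀ x, ‖fderiv ℝ (fun x => ∫ y, f y * Z (x - y)) x‖ ≤ M * ∫ y, ‖fderiv ℝ Z y‖ := by
  have hM0 : 0 ≤ M := (abs_nonneg _).trans (hM 0)
  have hli : LocallyIntegrable f volume := by
    refine LocallyIntegrable.mono (locallyIntegrable_const M) hf ?_
    refine Eventually.of_forall fun x => ?_
    rw [Real.norm_eq_abs, Real.norm_eq_abs]; exact (hM x).trans (le_abs_self M)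
  have hE : (fun x => ∫ y, f y * Z (x - y)) = convolution f Z (ContinuousLinearMap.mul ℝ ℝ) volume := by
    ext x; rfl
  refine ⟨?_, ?_, ?_⟩
  · rw [hE]
    exact hc.contDiff_convolution_right _ hli hZ
  · intro x
    have hi : Integrable (fun y => M * ‖Z y‖) := ((hZ.continuous.integrable_of_hasCompactSupport hc).norm).const_mul M
    have e : ∫ y, M * ‖Z (x - y)‖ = M * ∫ y, ‖Z y‖ := by
      rw [integral_const_mul, integral_sub_left_eq_self (fun y => ‖Z y‖) volume x]
    rw [← e]
    refine norm_integral_le_of_norm_le (hi.comp_sub_left x) (Eventually.of_forall fun y => ?_)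
    rw [norm_mul]
    gcongr
    exact hM y
  · intro x
    rw [hE, (hc.hasFDerivAt_convolution_right (ContinuousLinearMap.mul ℝ ℝ) hli hZ x).fderiv]
    have hcf : HasCompactSupport (fderiv ℝ Z) := hc.fderiv ℝ
    have hi : Integrable (fun y => M * ‖fderiv ℝ Z y‖) :=
      (((hZ.continuous_fderiv one_ne_zero).integrable_of_hasCompactSupport hcf).norm).const_mul M
    have e : ∫ y, M * ‖fderiv ℝ Z (x - y)‖ = M * ∫ y, ‖fderiv ℝ Z y‖ := by
      rw [integral_const_mul, integral_sub_left_eq_self (fun y => ‖fderiv ℝ Z y‖) volume x]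
    rw [← e, convolution]
    refine norm_integral_le_of_norm_le (hi.comp_sub_left x) (Eventually.of_forall fun y => ?_)
    have : ((ContinuousLinearMap.precompR (EE N) (ContinuousLinearMap.mul ℝ ℝ)) (f y)) (fderiv ℝ Z (x - y)) = f y • fderiv ℝ Z (x - y) := by
      ext e
      simp [ContinuousLinearMap.precompR]
    rw [this, norm_smul]
    gcongr
    exact hM y

end P8sec


section P9sec
open scoped ENNReal NNReal Topology ContDiff
variable {N : ℕ} {D : Set (EE N)}
variable {wt : EE N → ℝ} {a0 a1 p lam : ℝ}

lemma int_scale (g : EE N → ℝ) {t : ℝ} (ht : 0 < t) : ∫ y, g (t⁻¹ • y) = t ^ N * ∫ y, g y := by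
  rw [Measure.integral_comp_smul]
  simp [abs_of_pos ht]

/-- interior regularity for very weak solutions -/
lemma reg1 (hN : 3 ≤ N) {U S : Set (EE N)} {u f : EE N → ℝ} (hu : AEStronglyMeasurable u volume)
    (hf : AEStronglyMeasurable f volume) {M : ℝ} (hMu : ∀ x, |u x| ≤ M) (hMf : ∀ x, |f x| ≤ M)
    (hV : VW U u f) {r : ℝ} (hr : 0 < r) (hS : ∀ x ∈ S, Metric.closedBall x r ⊆ U) :
    ∃ v : EE N → ℝ, ContDiff ℝ 1 v ∧ ∀ᵐ x, x ∈ S → v x = u x := by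
  obtain ⟨Z, η, hZ, hη, hZ0, hη0, hη1, hηi, hlap⟩ := exists_Z (N := N) hN
  have hM0 : 0 ≤ M := (abs_nonneg _).trans (hMu 0)
  have hZc : HasCompactSupport Z := HasCompactSupport.intro (isCompact_closedBall (0 : EE N) 1) (fun x hx => hZ0 x (by
    simp at hx; exact hx.le))
  have hηc : HasCompactSupport η := HasCompactSupport.intro (isCompact_closedBall (0 : EE N) 1) (fun x hx => hη0 x (by
    simp at hx; exact hx.le))
  set t : ℕ → ℝ := fun k => r * (1 / 2) ^ k with ht
  have ht0 : ∀ k, 0 < t k := fun k => by positivity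
  have htr : ∀ k, t k ≤ r := fun k => by
    have : ((1:ℝ) / 2) ^ k ≤ 1 := pow_le_one₀ (by norm_num) (by norm_num)
    simp only [ht]; nlinarith
  have hts : ∀ k, (t (k + 1))⁻¹ = 2 * (t k)⁻¹ := fun k => by simp only [ht]; field_simp; ring
  have htl : Tendsto t atTop (𝓝 0) := by
    have := (tendsto_pow_atTop_nhds_zero_of_lt_one (r := (1:ℝ)/2) (by norm_num) (by norm_num)).const_mul r
    rwa [mul_zero] at this
  set Zk : ℕ → EE N → ℝ := fun k x => (t k) ^ 2 * ((t k)⁻¹) ^ N * Z ((t k)⁻¹ • x) with hZk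
  set E : ℕ → EE N → ℝ := fun k x => ((t k)⁻¹) ^ N * η ((t k)⁻¹ • x) with hE
  have supp : ∀ (g : EE N → ℝ), (∀ x, 1 ≤ ‖x‖ → g x = 0) → ∀ k x, t k ≤ ‖x‖ → g ((t k)⁻¹ • x) = 0 := by
    intro g hg k x hx
    refine hg _ ?_
    rw [norm_smul, norm_inv, Real.norm_of_nonneg (ht0 k).le, inv_mul_eq_div, le_div_iff₀ (ht0 k)]
    simpa using hx
  have hZks : ∀ k, ContDiff ℝ ∞ (Zk k) := fun k => contDiff_const.mul (hZ.comp (contDiff_const_smul _))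
  have hEs : ∀ k, ContDiff ℝ ∞ (E k) := fun k => contDiff_const.mul (hη.comp (contDiff_const_smul _))
  have hZk0 : ∀ k x, t k ≤ ‖x‖ → Zk k x = 0 := fun k x hx => by simp [hZk, supp Z hZ0 k x hx]
  have hE0 : ∀ k x, t k ≤ ‖x‖ → E k x = 0 := fun k x hx => by simp [hE, supp η hη0 k x hx]
  have hZkc : ∀ k, HasCompactSupport (Zk k) := fun k =>
    HasCompactSupport.intro (isCompact_closedBall (0 : EE N) (t k)) (fun x hx => hZk0 k x (by simp at hx; exact hx.le))
  have hEc : ∀ k, HasCompactSupport (E k) := fun k =>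
    HasCompactSupport.intro (isCompact_closedBall (0 : EE N) (t k)) (fun x hx => hE0 k x (by simp at hx; exact hx.le))
  set F : ℕ → EE N → ℝ := fun k x => ∫ y, f y * Zk k (x - y) with hF
  set I : ℕ → EE N → ℝ := fun k x => ∫ y, u y * E k (x - y) with hI
  have intg : ∀ (g h : EE N → ℝ) (x : EE N), AEStronglyMeasurable g volume → (∀ x, |g x| ≤ M) → ContDiff ℝ ∞ h → HasCompactSupport h →
      Integrable (fun y => g y * h (x - y)) := by
    intro g h x hg hgM hh hhc
    have h1 : Integrable (fun y => h (x - y)) := (hh.continuous.integrable_of_hasCompactSupport hhc).comp_sub_left x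
    exact h1.bdd_mul hg (c := M) (Eventually.of_forall fun y => by simpa using hgM y)
  -- the telescoping step
  have step : ∀ x ∈ S, ∀ k, I (k + 1) x = I k x + F k x := by
    intro x hx k
    have h1 := hV (fun y => (t k) ^ 2 * ((t k)⁻¹) ^ N * Z ((t k)⁻¹ • (x - y)))
      ((hZks k).comp (contDiff_const.sub contDiff_id)) ?_ ?_
    · have h2 : ∀ y, lapE (fun y => (t k) ^ 2 * ((t k)⁻¹) ^ N * Z ((t k)⁻¹ • (x - y))) y = E k (x - y) - E (k + 1) (x - y) := by
        intro y
        rw [lapE_affine (by exact_mod_cast contDiff_infty.1 hZ 2), hlap]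
        simp only [hE, hts, mul_pow, smul_smul]
        have := (ht0 k).ne'
        field_simp
      simp_rw [h2, mul_sub] at h1
      rw [integral_sub (intg _ _ x hu hMu (hEs k) (hEc k)) (intg _ _ x hu hMu (hEs _) (hEc _))] at h1
      change I k x - I (k + 1) x = - F k x at h1
      linarith
    · refine HasCompactSupport.intro (isCompact_closedBall x (t k)) fun y hy => ?_
      rw [supp Z hZ0 k, mul_zero]
      simp [dist_eq_norm] at hy
      rw [norm_sub_rev]; exact hy.le
    · refine subset_trans (closure_minimal ?_ Metric.isClosed_closedBall) (hS x hx)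
      intro y hy
      by_contra h
      refine hy ?_
      simp only
      rw [supp Z hZ0 k, mul_zero]
      simp [dist_eq_norm] at h
      rw [norm_sub_rev]; linarith [htr k]
  have sum : ∀ x ∈ S, ∀ n, I n x = I 0 x + ∑ k ∈ Finset.range n, F k x := by
    intro x hx n
    induction n with
    | zero => simp
    | succ n ih => rw [step x hx, ih, Finset.sum_range_succ]; ring
  -- bounds
  have hFC := fun k => conv_C1 (by exact_mod_cast contDiff_infty.1 (hZks k) 1) (hZkc k) hf hMf
  have hIC := fun k => conv_C1 (by exact_mod_cast contDiff_infty.1 (hEs k) 1) (hEc k) hu hMu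
  have n1 : ∀ k, ∫ y, ‖Zk k y‖ = t k ^ 2 * ∫ y, ‖Z y‖ := by
    intro k
    have := int_scale (fun y => ‖Z y‖) (ht0 k)
    simp only [hZk, norm_mul, norm_pow, norm_inv, Real.norm_of_nonneg (ht0 k).le]
    rw [integral_const_mul, this]
    have := (ht0 k).ne'
    rw [inv_pow]
    field_simp
  have n2 : ∀ k, ∫ y, ‖fderiv ℝ (Zk k) y‖ = t k * ∫ y, ‖fderiv ℝ Z y‖ := by
    intro k
    have := int_scale (fun y => ‖fderiv ℝ Z y‖) (ht0 k)
    have e : ∀ y, ‖fderiv ℝ (Zk k) y‖ = t k ^ 2 * ((t k)⁻¹) ^ N * (t k)⁻¹ * ‖fderiv ℝ Z ((t k)⁻¹ • y)‖ := by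
      intro y
      have hd : Differentiable ℝ Z := hZ.differentiable (by simp)
      have h3 := (((hd ((t k)⁻¹ • y)).hasFDerivAt.comp y ((hasFDerivAt_id (𝕜 := ℝ) y).const_smul ((t k)⁻¹))).const_mul (t k ^ 2 * ((t k)⁻¹) ^ N)).fderiv
      rw [show Zk k = fun y => t k ^ 2 * ((t k)⁻¹) ^ N * (Z ∘ fun z => (t k)⁻¹ • z) y from rfl]
      erw [h3]
      rw [norm_smul]
      simp [norm_smul, abs_of_pos (ht0 k)]
      ring
    simp_rw [e]
    rw [integral_const_mul, this]
    have := (ht0 k).ne'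
    rw [inv_pow]
    field_simp
  have s1 : Summable fun k => t k := by
    exact (summable_geometric_of_lt_one (by norm_num) (by norm_num)).mul_left r
  have s2 : Summable fun k => t k ^ 2 := by
    refine Summable.of_nonneg_of_le (fun k => by positivity) (fun k => ?_) (s1.mul_left r)
    nlinarith [htr k, ht0 k]
  have b0 : ∀ k x, ‖F k x‖ ≤ M * (∫ y, ‖Z y‖) * t k ^ 2 := by
    intro k x
    have := (hFC k).2.1 x
    rw [n1] at this
    calc _ ≤ _ := this
      _ = _ := by ring
  have b1 : ∀ k x, ‖fderiv ℝ (F k) x‖ ≤ M * (∫ y, ‖fderiv ℝ Z y‖) * t k := by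
    intro k x
    have := (hFC k).2.2 x
    rw [n2] at this
    calc _ ≤ _ := this
      _ = _ := by ring
  have hFs : ContDiff ℝ 1 fun x => ∑' k, F k x := by
    refine contDiff_tsum (N := 1) (v := fun j k => if j = 0 then M * (∫ y, ‖Z y‖) * t k ^ 2 else M * (∫ y, ‖fderiv ℝ Z y‖) * t k)
      (fun k => (hFC k).1) ?_ ?_
    · intro j hj
      by_cases h : j = 0
      · simp only [h, if_true]; exact s2.mul_left _
      · simp only [h, if_false]; exact s1.mul_left _
    · intro j k x hj
      have hj : j ≤ 1 := by exact_mod_cast hj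
      interval_cases j
      · simpa using b0 k x
      · rw [norm_iteratedFDeriv_one]; simpa using b1 k x
  refine ⟨fun x => I 0 x + ∑' k, F k x, (hIC 0).1.add hFs, ?_⟩
  have hli : LocallyIntegrable u volume := by
    refine LocallyIntegrable.mono (locallyIntegrable_const M) hu ?_
    refine Eventually.of_forall fun x => ?_
    rw [Real.norm_eq_abs, Real.norm_eq_abs]; exact (hMu x).trans (le_abs_self M)
  obtain ⟨Cη, hCη⟩ : ∃ C, ∀ x, ‖η x‖ ≤ C := hη.continuous.bounded_above_of_compact_support hηc
  filter_upwards [(Besicovitch.vitaliFamily (volume : Measure (EE N))).ae_tendsto_average_norm_sub hli] with x hx hxS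
  have htl' : Tendsto t atTop (𝓝[>] 0) := tendsto_nhdsWithin_iff.2 ⟨htl, Eventually.of_forall ht0⟩
  have hx2 := (hx.comp (Besicovitch.tendsto_filterAt volume x)).comp htl'
  have L1 : Tendsto (fun n => I n x) atTop (𝓝 (u x)) := by
    have := tendsto_integral_smul_of_tendsto_average_norm_sub (g := fun n y => E n (x - y)) (Cη * volume.real (Metric.closedBall (0 : EE N) 1)) hx2 ?_ ?_ ?_ ?_
    · refine this.congr fun n => ?_
      refine integral_congr_ae (Eventually.of_forall fun y => ?_)
      simp [mul_comm]
    · exact Eventually.of_forall fun n => hli.integrableOn_isCompact (isCompact_closedBall _ _)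
    · refine tendsto_const_nhds.congr fun n => ?_
      rw [integral_sub_left_eq_self (fun y => E n y) volume x]
      simp only [hE]
      rw [integral_const_mul, int_scale η (ht0 n), hηi]
      have := (ht0 n).ne'
      rw [inv_pow]
      field_simp
    · refine Eventually.of_forall fun n y hy => ?_
      by_contra h
      refine hy (hE0 n _ ?_)
      simp [dist_eq_norm] at h
      rw [norm_sub_rev]; exact h.le
    · refine Eventually.of_forall fun n y => ?_
      have hv : volume.real (Metric.closedBall x (t n)) = t n ^ N * volume.real (Metric.closedBall (0 : EE N) 1) := by
        rw [Measure.addHaar_real_closedBall' volume x (ht0 n).le]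
        simp
      have hv1 : 0 < volume.real (Metric.closedBall (0 : EE N) 1) := by
        exact ENNReal.toReal_pos (Metric.measure_closedBall_pos volume _ one_pos).ne' (isCompact_closedBall _ _).measure_lt_top.ne
      rw [hv, mul_div_mul_right _ _ hv1.ne']
      simp only [hE]
      rw [abs_mul, abs_of_pos (pow_pos (inv_pos.2 (ht0 n)) N), inv_pow, inv_mul_eq_div]
      have := hCη ((t n)⁻¹ • (x - y))
      rw [Real.norm_eq_abs] at this
      gcongr
  have L2 : Tendsto (fun n => I 0 x + ∑ k ∈ Finset.range n, F k x) atTop (𝓝 (I 0 x + ∑' k, F k x)) := by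
    refine tendsto_const_nhds.add ?_
    refine (Summable.hasSum ?_).tendsto_sum_nat
    exact Summable.of_norm_bounded (s2.mul_left _) (fun k => b0 k x)
  exact tendsto_nhds_unique L2 (L1.congr (sum x hxS))

end P9sec


section P10sec
open scoped ENNReal NNReal Topology ContDiff
variable {N : ℕ} {D : Set (EE N)}
variable {wt : EE N → ℝ} {a0 a1 p lam : ℝ}

/-- partial derivative -/
def pd (i : Fin N) (φ : EE N → ℝ) : EE N → ℝ := fun y => fderiv ℝ φ y (EuclideanSpace.single i (1 : ℝ))

lemma lapE_pd (φ : EE N → ℝ) : lapE φ = fun z => ∑ i, pd i (pd i φ) z := rfl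

lemma pd_smooth {φ : EE N → ℝ} (h : ContDiff ℝ ∞ φ) (i : Fin N) : ContDiff ℝ ∞ (pd i φ) :=
  (h.fderiv_right (m := ∞) (by simp)).clm_apply contDiff_const

lemma pd_C {φ : EE N → ℝ} {n : ℕ} (h : ContDiff ℝ (n + 1) φ) (i : Fin N) : ContDiff ℝ n (pd i φ) :=
  (h.fderiv_right (m := n) le_rfl).clm_apply contDiff_const

lemma pd_cs {φ : EE N → ℝ} (h : HasCompactSupport φ) (i : Fin N) : HasCompactSupport (pd i φ) :=
  h.fderiv_apply ℝ _

lemma pd_ts (φ : EE N → ℝ) (i : Fin N) : tsupport (pd i φ) ⊆ tsupport φ := tsupport_fderiv_apply_subset ℝ _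

lemma pd_comm {φ : EE N → ℝ} (h : ContDiff ℝ 2 φ) (i j : Fin N) : pd i (pd j φ) = pd j (pd i φ) := by
  ext y
  have hs : IsSymmSndFDerivAt ℝ φ y := h.contDiffAt.isSymmSndFDerivAt (by simp)
  have hd : DifferentiableAt ℝ (fderiv ℝ φ) y :=
    ((h.fderiv_right (m := 1) (by norm_num)).differentiable one_ne_zero) y
  have key : ∀ i j : Fin N, pd i (pd j φ) y = fderiv ℝ (fderiv ℝ φ) y (EuclideanSpace.single i (1 : ℝ)) (EuclideanSpace.single j (1 : ℝ)) := by
    intro i j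
    unfold pd
    rw [fderiv_clm_apply hd (differentiableAt_const _)]
    simp
  rw [key, key]
  exact hs.eq _ _

lemma lapE_smooth {φ : EE N → ℝ} (h : ContDiff ℝ ∞ φ) : ContDiff ℝ ∞ (lapE φ) := by
  rw [lapE_pd]
  exact ContDiff.sum fun i _ => pd_smooth (pd_smooth h i) i

lemma lapE_pd_comm {φ : EE N → ℝ} (h : ContDiff ℝ ∞ φ) (i : Fin N) : pd i (lapE φ) = lapE (pd i φ) := by
  ext y
  rw [lapE_pd, lapE_pd]
  change fderiv ℝ (fun z => ∑ j, pd j (pd j φ) z) y _ = _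
  rw [fderiv_fun_sum (fun j _ => ((pd_smooth (pd_smooth h j) j).differentiable (by simp)) y)]
  rw [sum_apply]
  refine Finset.sum_congr rfl fun j _ => ?_
  change pd i (pd j (pd j φ)) y = pd j (pd j (pd i φ)) y
  have h2 : ∀ {ψ : EE N → ℝ}, ContDiff ℝ ∞ ψ → ContDiff ℝ 2 ψ := fun h => by exact_mod_cast contDiff_infty.1 h 2
  rw [pd_comm (h2 (pd_smooth h j)) i j, pd_comm (h2 h) i j]

lemma ibpC {u φ : EE N → ℝ} (hu : ContDiff ℝ 1 u) (hφ : ContDiff ℝ 1 φ) (hc : HasCompactSupport φ) (i : Fin N) :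
    ∫ y, u y * pd i φ y = -∫ y, pd i u y * φ y := by
  have c1 : Continuous (pd i u) := (pd_C (n := 0) (by simpa using hu) i).continuous
  have c2 : Continuous (pd i φ) := (pd_C (n := 0) (by simpa using hφ) i).continuous
  exact integral_mul_fderiv_eq_neg_fderiv_mul_of_integrable
    ((c1.mul hφ.continuous).integrable_of_hasCompactSupport hc.mul_left)
    ((hu.continuous.mul c2).integrable_of_hasCompactSupport (pd_cs hc i).mul_left)
    ((hu.continuous.mul hφ.continuous).integrable_of_hasCompactSupport hc.mul_left)
    (fun x _ => hu.differentiable one_ne_zero x) (fun x _ => hφ.differentiable one_ne_zero x)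

lemma lapE_cs {φ : EE N → ℝ} (h : HasCompactSupport φ) : HasCompactSupport (lapE φ) := by
  refine HasCompactSupport.intro h.isCompact fun x hx => ?_
  rw [lapE_pd]
  refine Finset.sum_eq_zero fun i _ => ?_
  exact image_eq_zero_of_notMem_tsupport fun h' => hx (pd_ts _ _ (pd_ts _ _ h'))

lemma VW.pd {U : Set (EE N)} {u f : EE N → ℝ} (hu : ContDiff ℝ 1 u) (hf : ContDiff ℝ 1 f) (h : VW U u f) (i : Fin N) :
    VW U (pd i u) (pd i f) := by
  intro φ hφ hc hs
  have h1 : ∀ {ψ : EE N → ℝ}, ContDiff ℝ ∞ ψ → ContDiff ℝ 1 ψ := fun h => by exact_mod_cast contDiff_infty.1 h 1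
  have e1 := ibpC hu (h1 (lapE_smooth hφ)) (lapE_cs hc) i
  rw [lapE_pd_comm hφ, h _ (pd_smooth hφ i) (pd_cs hc i) ((pd_ts _ _).trans hs), ibpC hf (h1 hφ) hc i] at e1
  linarith

/-- second interior regularity step -/
lemma reg2 (hN : 3 ≤ N) {U S : Set (EE N)} {v F : EE N → ℝ} (hv : ContDiff ℝ 1 v) (hF : ContDiff ℝ 1 F)
    (hvc : HasCompactSupport v) (hFc : HasCompactSupport F) (hV : VW U v F) {r : ℝ} (hr : 0 < r) (hSo : IsOpen S)
    (hS : ∀ x ∈ S, Metric.closedBall x r ⊆ U) :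
    ContDiffOn ℝ 2 v S ∧ ∀ x ∈ S, -lapE v x = F x := by
  have hSU : S ⊆ U := fun x hx => hS x hx (Metric.mem_closedBall_self hr.le)
  have hw : ∀ i : Fin N, ∃ w : EE N → ℝ, ContDiff ℝ 1 w ∧ ∀ x ∈ S, pd i v x = w x := by
    intro i
    have c1 : Continuous (pd i v) := (pd_C (n := 0) (by simpa using hv) i).continuous
    have c2 : Continuous (pd i F) := (pd_C (n := 0) (by simpa using hF) i).continuous
    obtain ⟨M1, hM1⟩ := c1.bounded_above_of_compact_support (pd_cs hvc i)
    obtain ⟨M2, hM2⟩ := c2.bounded_above_of_compact_support (pd_cs hFc i)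
    obtain ⟨w, hw, he⟩ := reg1 hN c1.aestronglyMeasurable c2.aestronglyMeasurable (M := max M1 M2)
      (fun x => (hM1 x).trans (le_max_left _ _)) (fun x => (hM2 x).trans (le_max_right _ _)) (hV.pd hv hF i) hr hS
    refine ⟨w, hw, ?_⟩
    have h2 : w =ᵐ[volume.restrict S] pd i v := (ae_restrict_iff' hSo.measurableSet).2 he
    exact fun x hx => (Measure.eqOn_open_of_ae_eq h2 hSo hw.continuous.continuousOn c1.continuousOn hx).symm
  choose w hw he using hw
  have h2 : ContDiffOn ℝ 2 v S := by
    rw [show (2 : WithTop ℕ∞) = 1 + 1 by norm_num, contDiffOn_succ_iff_fderiv_of_isOpen hSo]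
    refine ⟨(hv.differentiable one_ne_zero).differentiableOn, by simp, ?_⟩
    have hg : ContDiff ℝ 1 (fun x => ∑ i, w i x • (EuclideanSpace.proj i : EE N →L[ℝ] ℝ)) :=
      ContDiff.sum fun i _ => (hw i).smul contDiff_const
    refine hg.contDiffOn.congr fun x hx => ?_
    ext e
    conv_lhs => rw [← (EuclideanSpace.basisFun (Fin N) ℝ).sum_repr e]
    simp only [map_sum, map_smul, EuclideanSpace.basisFun_repr, EuclideanSpace.basisFun_apply, smul_eq_mul,
      sum_apply, smul_apply]
    refine Finset.sum_congr rfl fun i _ => ?_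
    rw [← he i x hx, mul_comm]; rfl
  refine ⟨h2, ?_⟩
  have hlap : ∀ x ∈ S, lapE v x = ∑ i, pd i (w i) x := by
    intro x hx
    rw [lapE_pd]
    refine Finset.sum_congr rfl fun i _ => ?_
    have : pd i v =ᶠ[𝓝 x] w i := by
      filter_upwards [hSo.mem_nhds hx] with y hy using he i y hy
    change fderiv ℝ (pd i v) x _ = fderiv ℝ (w i) x _
    rw [this.fderiv_eq]
  have hcw : ∀ i, Continuous (pd i (w i)) := fun i => (pd_C (n := 0) (by simpa using hw i) i).continuous
  have hcs : Continuous fun x => (∑ i, pd i (w i) x) + F x := (continuous_finsetSum _ fun i _ => hcw i).add hF.continuous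
  have hae := hSo.ae_eq_zero_of_integral_contDiff_smul_eq_zero ((hcs.locallyIntegrable (μ := volume)).locallyIntegrableOn _) ?_
  · have h3 : (fun x => (∑ i, pd i (w i) x) + F x) =ᵐ[volume.restrict S] fun _ => 0 := (ae_restrict_iff' hSo.measurableSet).2 hae
    intro x hx
    have := Measure.eqOn_open_of_ae_eq h3 hSo hcs.continuousOn continuousOn_const hx
    simp only at this
    rw [hlap x hx]; linarith
  · intro φ hφ hc hs
    have h1 : ∀ {ψ : EE N → ℝ}, ContDiff ℝ ∞ ψ → ContDiff ℝ 1 ψ := fun h => by exact_mod_cast contDiff_infty.1 h 1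
    have e0 := hV φ hφ hc (hs.trans hSU)
    have cpi : ∀ i, Continuous (pd i v) := fun i => (pd_C (n := 0) (by simpa using hv) i).continuous
    have e1 : ∫ y, v y * lapE φ y = ∑ i, ∫ y, pd i (w i) y * φ y := by
      simp_rw [lapE_pd, Finset.mul_sum]
      rw [integral_finsetSum]
      · refine Finset.sum_congr rfl fun i _ => ?_
        rw [ibpC hv (h1 (pd_smooth hφ i)) (pd_cs hc i) i]
        have : ∫ y, pd i v y * pd i φ y = ∫ y, w i y * pd i φ y := by
          refine integral_congr_ae (Eventually.of_forall fun y => ?_)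
          by_cases hy : y ∈ S
          · simp only; rw [he i y hy]
          · have : pd i φ y = 0 := image_eq_zero_of_notMem_tsupport fun h' => hy (hs (pd_ts _ _ h'))
            simp [this]
        rw [this, ibpC (hw i) (h1 hφ) hc i, neg_neg]
      · intro i _
        exact (hv.continuous.mul (pd_smooth (pd_smooth hφ i) i).continuous).integrable_of_hasCompactSupport
          (pd_cs (pd_cs hc i) i).mul_left
    have i1 : ∀ i, Integrable fun y => pd i (w i) y * φ y := fun i =>
      ((hcw i).mul hφ.continuous).integrable_of_hasCompactSupport hc.mul_left
    have i2 : Integrable fun y => F y * φ y := (hF.continuous.mul hφ.continuous).integrable_of_hasCompactSupport hc.mul_left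
    have e2 : ∀ y, φ y • ((∑ i, pd i (w i) y) + F y) = (∑ i, pd i (w i) y * φ y) + F y * φ y := by
      intro y; rw [smul_eq_mul, mul_add, Finset.mul_sum]
      congr 1
      · exact Finset.sum_congr rfl fun i _ => mul_comm _ _
      · ring
    simp_rw [e2]
    rw [integral_add (integrable_finsetSum _ fun i _ => i1 i) i2, integral_finsetSum _ fun i _ => i1 i, ← e1, e0]
    ring

/-- interior regularity: `C^1` very weak solutions are classical -/
lemma reg3 (hN : 3 ≤ N) (hD : IsOpen D) {v F : EE N → ℝ} (hv : ContDiff ℝ 1 v) (hF : ContDiffOn ℝ 1 F D)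
    (hV : VW D v F) : ContDiffOn ℝ 2 v D ∧ ∀ x ∈ D, -lapE v x = F x := by
  have key : ∀ x ∈ D, ContDiffAt ℝ 2 v x ∧ -lapE v x = F x := by
    intro x hx
    obtain ⟨r, hr, hrD⟩ := Metric.isOpen_iff.1 hD x hx
    set b : ContDiffBump x := ⟨r / 2, r * (3 / 4), by positivity, by linarith⟩ with hb
    have hbs : ContDiff ℝ 1 b := b.contDiff
    have hbc : HasCompactSupport b := b.hasCompactSupport
    have hbt : tsupport b ⊆ D := by
      rw [b.tsupport_eq]
      exact (Metric.closedBall_subset_ball (by change r * (3 / 4) < r; linarith)).trans hrD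
    have h1 : ∀ y ∈ Metric.ball x (r / 2), b y = 1 := fun y hy =>
      b.one_of_mem_closedBall (Metric.ball_subset_closedBall hy)
    have hF' : ContDiff ℝ 1 (fun y => b y * F y) := by
      rw [contDiff_iff_contDiffAt]
      intro y
      by_cases hy : y ∈ tsupport b
      · exact hbs.contDiffAt.mul ((hF y (hbt hy)).contDiffAt (hD.mem_nhds (hbt hy)))
      · have : (fun y => b y * F y) =ᶠ[𝓝 y] fun _ => 0 := by
          filter_upwards [(isClosed_tsupport b).isOpen_compl.mem_nhds hy] with z hz
          simp [image_eq_zero_of_notMem_tsupport hz]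
        exact contDiffAt_const.congr_of_eventuallyEq this
    have hball : Metric.ball x (r / 2) ⊆ D := (Metric.ball_subset_ball (by linarith)).trans hrD
    have hV' : VW (Metric.ball x (r / 2)) (fun y => b y * v y) (fun y => b y * F y) := by
      intro φ hφ hc hs
      have := hV φ hφ hc (hs.trans hball)
      have e1 : ∀ y, b y * F y * φ y = F y * φ y := by
        intro y
        by_cases hy : y ∈ Metric.ball x (r / 2)
        · rw [h1 y hy]; ring
        · rw [image_eq_zero_of_notMem_tsupport fun h' => hy (hs h')]; ring
      have e2 : ∀ y, b y * v y * lapE φ y = v y * lapE φ y := by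
        intro y
        by_cases hy : y ∈ Metric.ball x (r / 2)
        · rw [h1 y hy]; ring
        · have : lapE φ y = 0 := by
            rw [lapE_pd]
            exact Finset.sum_eq_zero fun i _ => image_eq_zero_of_notMem_tsupport fun h' => hy (hs (pd_ts _ _ (pd_ts _ _ h')))
          rw [this]; ring
      simp_rw [e1, e2]
      exact this
    obtain ⟨h2, h3⟩ := reg2 hN (S := Metric.ball x (r / 4)) (hbs.mul hv) hF' hbc.mul_right hbc.mul_right hV' (r := r / 4) (by positivity) Metric.isOpen_ball (by
      intro y hy z hz
      rw [Metric.mem_ball] at *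
      rw [Metric.mem_closedBall] at hz
      linarith [dist_triangle z y x])
    have hxm : x ∈ Metric.ball x (r / 4) := Metric.mem_ball_self (by positivity)
    have hev : (fun y => b y * v y) =ᶠ[𝓝 x] v := by
      filter_upwards [Metric.ball_mem_nhds x (half_pos hr)] with y hy
      rw [h1 y hy, one_mul]
    constructor
    · exact ((h2 x hxm).contDiffAt (Metric.ball_mem_nhds x (by positivity))).congr_of_eventuallyEq hev.symm
    · have h4 := h3 x hxm
      have h5 : lapE (fun y => b y * v y) x = lapE v x := by
        rw [lapE_pd, lapE_pd]
        refine Finset.sum_congr rfl fun i _ => ?_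
        have : pd i (fun y => b y * v y) =ᶠ[𝓝 x] pd i v := by
          filter_upwards [hev.eventuallyEq_nhds] with y hy
          unfold pd; rw [hy.fderiv_eq]
        change fderiv ℝ (pd i _) x _ = fderiv ℝ (pd i v) x _
        rw [this.fderiv_eq]
      rw [h1 x (Metric.mem_ball_self (by positivity)), one_mul, h5] at h4
      exact h4
  exact ⟨fun x hx => (key x hx).1.contDiffWithinAt, fun x hx => (key x hx).2⟩

end P10sec


section P11sec
open scoped ENNReal NNReal Topology ContDiff
variable {N : ℕ} {D : Set (EE N)}
variable {wt : EE N → ℝ} {a0 a1 p lam : ℝ}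

/-- approximating Lipschitz functions vanishing outside `D` by test functions -/
lemma lip_approx (hD : IsOpen D) (hb : Bornology.IsBounded D) {w : EE N → ℝ} {K : ℝ≥0} (hw : LipschitzWith K w)
    (h0 : ∀ x, x ∉ D → w x = 0) {δ : ℝ} (hδ : 0 < δ) :
    ∃ φ, TF D φ ∧ (∀ x, |φ x - w x| ≤ 2 * δ) ∧ LipschitzWith K φ := by
  set w' : EE N → ℝ := fun x => max (w x - δ) 0 - max (-w x - δ) 0 with hw'
  have hlip : LipschitzWith K w' := by
    refine LipschitzWith.of_dist_le_mul fun x y => ?_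
    refine le_trans ?_ (hw.dist_le_mul x y)
    rw [Real.dist_eq, Real.dist_eq]
    simp only [hw']
    grind
  have hclose : ∀ x, |w' x - w x| ≤ δ := by
    intro x; simp only [hw']; grind
  set A : Set (EE N) := {x | δ ≤ |w x|} with hA
  have hAc : IsClosed A := isClosed_le continuous_const hw.continuous.abs
  have hAD : A ⊆ D := by
    intro x hx
    by_contra h
    rw [hA, Set.mem_ofPred_eq, h0 x h] at hx
    simp at hx; linarith
  have hAk : IsCompact A := Metric.isCompact_of_isClosed_isBounded hAc (hb.subset hAD)
  have hw0 : ∀ x, x ∉ A → w' x = 0 := by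
    intro x hx
    rw [hA, Set.mem_ofPred_eq] at hx
    simp only [hw']; grind
  obtain ⟨r, hr, hrD⟩ := hAk.exists_cthickening_subset_open hD hAD
  set R := min r (δ / (K + 1)) with hR
  have hR0 : 0 < R := lt_min hr (by positivity)
  have hRD : Metric.cthickening R A ⊆ D := (Metric.cthickening_mono (min_le_left _ _) _).trans hrD
  set b : ContDiffBump (0 : EE N) := ⟨R / 2, R, by positivity, by linarith⟩ with hbb
  have hρs : ContDiff ℝ 1 (b.normed volume) := b.contDiff_normed
  have hρc : HasCompactSupport (b.normed volume) := b.hasCompactSupport_normed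
  have hρi : Integrable (b.normed volume) := hρs.continuous.integrable_of_hasCompactSupport hρc
  set φ : EE N → ℝ := convolution (b.normed volume) w' (ContinuousLinearMap.lsmul ℝ ℝ) volume with hφ
  have hφe : ∀ x, φ x = ∫ t, b.normed volume t * w' (x - t) := fun x => rfl
  have hsupp : ∀ x, x ∉ Metric.cthickening R A → φ x = 0 := by
    intro x hx
    rw [hφe]
    rw [← integral_zero (EE N) ℝ (μ := volume)]
    refine integral_congr_ae (Eventually.of_forall fun t => ?_)
    simp only
    by_cases ht : t ∈ Metric.ball (0 : EE N) R
    · rw [hw0, mul_zero]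
      intro hxt
      refine hx (Metric.mem_cthickening_of_dist_le x (x - t) R A hxt ?_)
      simp at ht
      simpa [dist_eq_norm] using ht.le
    · have : b.normed volume t = 0 := by
        rw [← Function.notMem_support, b.support_normed_eq]; exact ht
      rw [this, zero_mul]
  have hli : LocallyIntegrable w' volume := hlip.continuous.locallyIntegrable
  have hIntg : ∀ x, Integrable fun t => b.normed volume t * w' (x - t) := by
    intro x
    refine Continuous.integrable_of_hasCompactSupport ?_ hρc.mul_right
    exact hρs.continuous.mul (hlip.continuous.comp (by fun_prop))
  refine ⟨φ, ⟨?_, ?_, ?_⟩, ?_, ?_⟩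
  · exact hρc.contDiff_convolution_left _ hρs hli
  · exact HasCompactSupport.intro hAk.cthickening hsupp
  · refine (closure_minimal ?_ Metric.isClosed_cthickening).trans hRD
    intro x hx
    by_contra h
    exact hx (hsupp x h)
  · intro x
    have h1 : dist (φ x) (w' x) ≤ δ := by
      refine b.dist_normed_convolution_le hlip.continuous.aestronglyMeasurable fun y hy => ?_
      refine (hlip.dist_le_mul y x).trans ?_
      have hy' : dist y x ≤ δ / (K + 1) := (Metric.mem_ball.1 hy).le.trans (min_le_right _ _)
      calc (K : ℝ) * dist y x ≤ (K + 1) * (δ / (K + 1)) := by gcongr; linarith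
        _ = δ := by field_simp
    rw [Real.dist_eq] at h1
    have := abs_sub_le (φ x) (w' x) (w x)
    linarith [hclose x]
  · refine LipschitzWith.of_dist_le_mul fun x y => ?_
    rw [Real.dist_eq, hφe, hφe, ← integral_sub (hIntg x) (hIntg y)]
    have e : ∫ t, b.normed volume t * (K * dist x y) = K * dist x y := by
      rw [integral_mul_const, b.integral_normed, one_mul]
    rw [← e, ← Real.norm_eq_abs]
    refine norm_integral_le_of_norm_le (hρi.mul_const _) (Eventually.of_forall fun t => ?_)
    rw [← mul_sub, norm_mul, Real.norm_of_nonneg (b.nonneg_normed t)]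
    refine mul_le_mul_of_nonneg_left ?_ (b.nonneg_normed t)
    have := hlip.dist_le_mul (x - t) (y - t)
    rwa [dist_sub_right, Real.dist_eq] at this

lemma lip_norm_grad {w : EE N → ℝ} {K : ℝ≥0} (hw : LipschitzWith K w) (z : EE N) : ‖gradient w z‖ ≤ K := by
  rw [norm_gradient']
  exact norm_fderiv_le_of_lipschitz ℝ hw

lemma measurable_gradient (w : EE N → ℝ) : Measurable (gradient w) := by
  have : Measurable (fderiv ℝ w) := measurable_fderiv ℝ w
  exact (LinearIsometryEquiv.continuous _).measurable.comp this

/-- Lipschitz functions vanishing outside `D` are in `H^1_0` -/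
lemma lipW (hD : IsOpen D) (hb : Bornology.IsBounded D) {w : EE N → ℝ} {K : ℝ≥0} (hw : LipschitzWith K w)
    (h0 : ∀ x, x ∉ D → w x = 0) : IsW D w (gradient w) := by
  have fm := finMeas hb
  choose φ hφ1 hφ2 hφ3 using fun n : ℕ => lip_approx hD hb hw h0 (δ := 1 / ((n : ℝ) + 1)) (by positivity)
  have hwc : HasCompactSupport w := by
    refine HasCompactSupport.intro hb.isCompact_closure fun x hx => h0 x fun h => hx (subset_closure h)
  obtain ⟨M, hM⟩ := hw.continuous.bounded_above_of_compact_support hwc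
  have hφM : ∀ n x, ‖φ n x‖ ≤ M + 2 := by
    intro n x
    have h1 := hφ2 n x
    have h2 : 1 / ((n : ℝ) + 1) ≤ 1 := by
      rw [div_le_one (by positivity)]; linarith [n.cast_nonneg (α := ℝ)]
    have h3 := hM x
    rw [Real.norm_eq_abs] at *
    have := abs_sub_abs_le_abs_sub (φ n x) (w x)
    linarith
  have mlw : MemLp w 2 (volume.restrict D) := (hw.continuous.memLp_of_hasCompactSupport hwc).restrict D
  have mlg : MemLp (gradient w) 2 (volume.restrict D) :=
    MemLp.of_bound (measurable_gradient w).aestronglyMeasurable K (Eventually.of_forall (lip_norm_grad hw))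
  have bd1 : ∃ C : ℝ≥0, ∀ n, eLpNorm (φ n) 2 (volume.restrict D) ≤ C := by
    refine ⟨((volume.restrict D Set.univ) ^ (2 : ℝ≥0∞).toReal⁻¹ * ENNReal.ofReal (M + 2)).toNNReal, fun n => ?_⟩
    rw [ENNReal.coe_toNNReal]
    · exact eLpNorm_le_of_ae_bound (Eventually.of_forall (hφM n))
    · exact ENNReal.mul_ne_top (ENNReal.rpow_ne_top_of_nonneg (by positivity) (measure_ne_top _ _)) ENNReal.ofReal_ne_top
  have bd2 : ∃ C : ℝ≥0, ∀ n, eLpNorm (gradient (φ n)) 2 (volume.restrict D) ≤ C := by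
    refine ⟨((volume.restrict D Set.univ) ^ (2 : ℝ≥0∞).toReal⁻¹ * ENNReal.ofReal K).toNNReal, fun n => ?_⟩
    rw [ENNReal.coe_toNNReal]
    · exact eLpNorm_le_of_ae_bound (Eventually.of_forall (lip_norm_grad (hφ3 n)))
    · exact ENNReal.mul_ne_top (ENNReal.rpow_ne_top_of_nonneg (by positivity) (measure_ne_top _ _)) ENNReal.ofReal_ne_top
  obtain ⟨C1, hC1⟩ := bd1
  obtain ⟨C2, hC2⟩ := bd2
  obtain ⟨u0, g0, k, hk, hW, hu, -⟩ := weak_compact_W (fun n => IsW.of_TF (hφ1 n)) (M := max C1 C2)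
    (fun n => (hC1 n).trans (by exact_mod_cast le_max_left _ _)) (fun n => (hC2 n).trans (by exact_mod_cast le_max_right _ _))
  have hlim : ∀ x, Tendsto (fun n => φ (k n) x) atTop (𝓝 (w x)) := by
    intro x
    rw [tendsto_iff_norm_sub_tendsto_zero]
    have h1 : Tendsto (fun n : ℕ => 2 * (1 / ((n : ℝ) + 1))) atTop (𝓝 0) := by
      simpa using (tendsto_one_div_add_atTop_nhds_zero_nat (𝕜 := ℝ)).const_mul 2
    exact squeeze_zero (fun n => norm_nonneg _) (fun n => hφ2 (k n) x) (h1.comp hk.tendsto_atTop)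
  have hu0 : u0 =ᵐ[volume.restrict D] w := by
    have key : ∀ ψ : EE N → ℝ, MemLp ψ 2 (volume.restrict D) → ∫ z in D, u0 z * ψ z = ∫ z in D, w z * ψ z := by
      intro ψ hψ
      refine tendsto_nhds_unique (hu ψ hψ) ?_
      refine tendsto_integral_of_dominated_convergence (fun z => (M + 2) * ‖ψ z‖) (fun n => ?_) ?_ ?_ ?_
      · exact (hφ1 (k n)).1.continuous.aestronglyMeasurable.mul hψ.1
      · exact (hψ.integrable (by norm_num)).norm.const_mul _
      · intro n
        refine Eventually.of_forall fun z => ?_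
        rw [norm_mul]; gcongr; exact hφM _ _
      · exact Eventually.of_forall fun z => (hlim z).mul_const _
    have h2 := key (u0 - w) (hW.1.sub mlw)
    have m2 : MemLp (u0 - w) 2 (volume.restrict D) := hW.1.sub mlw
    have i1 : Integrable (fun z => u0 z * (u0 - w) z) (volume.restrict D) := hW.1.integrable_mul m2
    have i2 : Integrable (fun z => w z * (u0 - w) z) (volume.restrict D) := mlw.integrable_mul m2
    have h3 : ∫ z in D, ((u0 - w) z) ^ 2 = 0 := by
      have := integral_sub i1 i2
      rw [h2, sub_self] at this
      rw [← this]
      refine integral_congr_ae (Eventually.of_forall fun z => ?_)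
      simp only [Pi.sub_apply]; ring
    rw [integral_eq_zero_iff_of_nonneg (fun z => sq_nonneg _) m2.integrable_sq] at h3
    filter_upwards [h3] with z hz
    have : (u0 - w) z = 0 := by simpa using hz
    simpa [sub_eq_zero] using this
  have hW' : IsW D w g0 := hW.congr hu0 EventuallyEq.rfl
  have hdiff : ∀ᵐ z : EE N, DifferentiableAt ℝ w z := hw.ae_differentiableAt
  refine hW'.congr EventuallyEq.rfl ?_
  have key : ∀ e : EE N, ∀ᵐ z ∂(volume.restrict D), inner ℝ (g0 z - gradient w z) e = 0 := fun e => by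
    have ml : MemLp (fun z => inner ℝ (g0 z - gradient w z) e) 2 (volume.restrict D) :=
      memLp_inner_left (hW'.2.1.sub mlg) e
    rw [ae_restrict_iff' hD.measurableSet]
    refine hD.ae_eq_zero_of_integral_contDiff_smul_eq_zero ?_ ?_
    · intro z hz
      obtain ⟨K, hK, hzK, hKD⟩ : ∃ K, IsCompact K ∧ z ∈ interior K ∧ K ⊆ D := exists_compact_subset hD hz
      refine ⟨K, mem_nhdsWithin_of_mem_nhds (mem_interior_iff_mem_nhds.1 hzK), ?_⟩
      have : MemLp (fun z => inner ℝ (g0 z - gradient w z) e) 2 (volume.restrict K) :=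
        ml.mono_measure (Measure.restrict_mono hKD le_rfl)
      have hfin : IsFiniteMeasure ((volume : Measure (EE N)).restrict K) := ⟨by simpa using hK.measure_lt_top⟩
      exact this.integrable (by norm_num)
    · intro ψ hψ hc hs
      have hψ1 : ContDiff ℝ 1 ψ := hψ.of_le (by exact_mod_cast le_top)
      obtain ⟨L, hL⟩ := ContDiff.lipschitzWith_of_hasCompactSupport hc hψ1 one_ne_zero
      have a := hW'.ibp hψ1 hc e
      have b := hw.integral_lineDeriv_mul_eq hL hc e (μ := volume)
      simp_rw [(hψ1.differentiable one_ne_zero).differentiableAt.lineDeriv_eq_fderiv, map_neg] at b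
      have b1 : ∫ z in D, inner ℝ (gradient w z) e * ψ z = -∫ z in D, w z * fderiv ℝ ψ z e := by
        rw [setIntegral_eq_integral_of_forall_compl_eq_zero (s := D), setIntegral_eq_integral_of_forall_compl_eq_zero (s := D), ← integral_neg]
        · rw [show (∫ z, -(w z * fderiv ℝ ψ z e)) = ∫ x, -(fderiv ℝ ψ x) e * w x by
            refine integral_congr_ae (Eventually.of_forall fun z => ?_); simp only; ring]
          rw [← b]
          refine integral_congr_ae ?_
          filter_upwards [hdiff] with z hz
          rw [hz.lineDeriv_eq_fderiv, inner_gradient']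
        · intro z hz; rw [h0 z hz, zero_mul]
        · intro z hz
          have : ψ z = 0 := image_eq_zero_of_notMem_tsupport fun h' => hz (hs h')
          rw [this, mul_zero]
      have w2 : MemLp ψ 2 (volume.restrict D) := (hψ.continuous.memLp_of_hasCompactSupport hc).restrict D
      have i1 := (memLp_inner_left hW'.2.1 e).integrable_mul w2
      have i2 := (memLp_inner_left mlg e).integrable_mul w2
      have : ∫ z in D, (inner ℝ (g0 z) e * ψ z - inner ℝ (gradient w z) e * ψ z) = 0 := by
        have := integral_sub i1 i2
        simp only [Pi.mul_apply] at this
        rw [this]; linarith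
      rw [← setIntegral_eq_integral_of_forall_compl_eq_zero (s := D), ← this]
      · refine integral_congr_ae (Eventually.of_forall fun z => ?_)
        simp only [smul_eq_mul, inner_sub_left]; ring
      · intro z hz
        have : ψ z = 0 := image_eq_zero_of_notMem_tsupport fun h' => hz (hs h')
        simp [this]
  have : ∀ᵐ z ∂(volume.restrict D), ∀ i : Fin N, inner ℝ (g0 z - gradient w z) (EuclideanSpace.single i (1 : ℝ)) = 0 :=
    ae_all_iff.2 fun i => key _
  filter_upwards [this] with z hz
  rw [← sub_eq_zero]
  ext i
  simpa [EuclideanSpace.inner_single_right] using hz i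

end P11sec


section P12sec
open scoped ENNReal NNReal Topology ContDiff
variable {N : ℕ} {D : Set (EE N)}

/-- inversion in the sphere of radius `R` -/
def ivs (R : ℝ) (y : EE N) : EE N := (R ^ 2 / ‖y‖ ^ 2) • y

/-- Kelvin type transform -/
def kel (R C b : ℝ) (A : EE N → ℝ) (y : EE N) : ℝ := C * (‖y‖ ^ 2) ^ b * A (ivs R y)

lemma nsq_fd (y : EE N) : HasFDerivAt (fun y : EE N => ‖y‖ ^ 2) ((2 : ℝ) • innerSL ℝ y) y := by
  have := (hasStrictFDerivAt_norm_sq y).hasFDerivAt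
  refine this.congr_fderiv ?_
  ext v; simp

lemma ivs_fd (R : ℝ) {y : EE N} (hy : y ≠ 0) : HasFDerivAt (ivs R : EE N → EE N)
    ((R ^ 2 / ‖y‖ ^ 2) • ContinuousLinearMap.id ℝ (EE N) +
      ((-(R ^ 2) / (‖y‖ ^ 2) ^ 2) • ((2 : ℝ) • innerSL ℝ y)).smulRight y) y := by
  have hs : ‖y‖ ^ 2 ≠ 0 := by positivity
  have h1 : HasDerivAt (fun s : ℝ => R ^ 2 / s) (-(R ^ 2) / (‖y‖ ^ 2) ^ 2) (‖y‖ ^ 2) := by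
    have := (hasDerivAt_const (‖y‖ ^ 2) (R ^ 2)).div (hasDerivAt_id (‖y‖ ^ 2)) hs
    refine (this.congr_deriv (by simp)).congr_of_eventuallyEq (Eventually.of_forall fun x => rfl)
  have h2 := h1.comp_hasFDerivAt y (nsq_fd y)
  exact h2.smul (hasFDerivAt_id y)

lemma kel_fd (R C b : ℝ) {A : EE N → ℝ} (hA : Differentiable ℝ A) {y : EE N} (hy : y ≠ 0) :
    HasFDerivAt (kel R C b A) ((C * (‖y‖ ^ 2) ^ b) • ((fderiv ℝ A (ivs R y)).comp
      ((R ^ 2 / ‖y‖ ^ 2) • ContinuousLinearMap.id ℝ (EE N) +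
      ((-(R ^ 2) / (‖y‖ ^ 2) ^ 2) • ((2 : ℝ) • innerSL ℝ y)).smulRight y)) +
      A (ivs R y) • ((C * (b * (‖y‖ ^ 2) ^ (b - 1))) • ((2 : ℝ) • innerSL ℝ y))) y := by
  have hs : ‖y‖ ^ 2 ≠ 0 := by positivity
  have h1 : HasDerivAt (fun s : ℝ => C * s ^ b) (C * (b * (‖y‖ ^ 2) ^ (b - 1))) (‖y‖ ^ 2) :=
    (Real.hasDerivAt_rpow_const (Or.inl hs)).const_mul C
  have h2 := h1.comp_hasFDerivAt y (nsq_fd y)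
  have h3 := (hA (ivs R y)).hasFDerivAt.comp y (ivs_fd R hy)
  exact h2.mul h3

lemma fd_sum (A : EE N → ℝ) (x y : EE N) : fderiv ℝ A x y = ∑ j, y j * pd j A x := by
  conv_lhs => rw [show y = ∑ j, y j • EuclideanSpace.single j (1 : ℝ) by
    ext i; simp [Finset.sum_apply, Pi.single_apply]]
  rw [map_sum]
  simp [pd]

lemma kel_pd (R C b : ℝ) {A : EE N → ℝ} (hA : Differentiable ℝ A) {y : EE N} (hy : y ≠ 0) (i : Fin N) :
    pd i (kel R C b A) y = 2 * b * y i * kel R C (b - 1) A y + R ^ 2 * kel R C (b - 1) (pd i A) y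
      - 2 * R ^ 2 * (y i * ∑ j, y j * kel R C (b - 2) (pd j A) y) := by
  have hs : 0 < ‖y‖ ^ 2 := by positivity
  unfold pd
  rw [(kel_fd R C b hA hy).fderiv]
  have e1 : (‖y‖ ^ 2) ^ (b - 1) = (‖y‖ ^ 2) ^ b / ‖y‖ ^ 2 := by rw [Real.rpow_sub hs]; simp
  have e2 : (‖y‖ ^ 2) ^ (b - 2) = (‖y‖ ^ 2) ^ b / (‖y‖ ^ 2) ^ 2 := by
    rw [Real.rpow_sub hs]; norm_num
  have e3 := fd_sum A (ivs R y) y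
  have e4 : ∑ j, y j * kel R C (b - 2) (fun z => fderiv ℝ A z (EuclideanSpace.single j 1)) y =
      C * ((‖y‖ ^ 2) ^ b / (‖y‖ ^ 2) ^ 2) * fderiv ℝ A (ivs R y) y := by
    rw [e3, Finset.mul_sum]
    refine Finset.sum_congr rfl fun j _ => ?_
    simp only [kel, pd, e2]; ring
  rw [e4]
  simp only [kel, e1]
  simp [EuclideanSpace.inner_single_right]
  field_simp
  ring

lemma kel_diffAt (R C b : ℝ) {A : EE N → ℝ} (hA : Differentiable ℝ A) {y : EE N} (hy : y ≠ 0) :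
    DifferentiableAt ℝ (kel R C b A) y := (kel_fd R C b hA hy).differentiableAt

lemma kel_lap (R C b : ℝ) (hb : b = 1 - (N : ℝ) / 2) {φ : EE N → ℝ} (hφ : ContDiff ℝ ∞ φ) {y : EE N} (hy : y ≠ 0) :
    lapE (kel R C b φ) y = R ^ 4 * kel R C (b - 2) (lapE φ) y := by
  have hs : 0 < ‖y‖ ^ 2 := by positivity
  have d0 : Differentiable ℝ φ := hφ.differentiable (by simp)
  have d1 : ∀ j, Differentiable ℝ (pd j φ) := fun j => (pd_smooth hφ j).differentiable (by simp)
  have hcoord : ∀ j : Fin N, HasFDerivAt (fun y : EE N => y j) (EuclideanSpace.proj j : EE N →L[ℝ] ℝ) y := fun j =>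
    (EuclideanSpace.proj j : EE N →L[ℝ] ℝ).hasFDerivAt (x := y)
  set T := C * (‖y‖ ^ 2) ^ b with hT
  set s := ‖y‖ ^ 2 with hsd
  have e1 : ∀ A : EE N → ℝ, kel R C (b - 1) A y = T / s * A (ivs R y) := by
    intro A; unfold kel; rw [Real.rpow_sub hs, Real.rpow_one, hT]; ring
  have e2 : ∀ A : EE N → ℝ, kel R C (b - 2) A y = T / s ^ 2 * A (ivs R y) := by
    intro A; unfold kel; rw [Real.rpow_sub hs, hT, show (2 : ℝ) = ((2 : ℕ) : ℝ) by norm_num, Real.rpow_natCast]; ring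
  have e3 : ∀ A : EE N → ℝ, kel R C (b - 3) A y = T / s ^ 3 * A (ivs R y) := by
    intro A; unfold kel; rw [Real.rpow_sub hs, hT, show (3 : ℝ) = ((3 : ℕ) : ℝ) by norm_num, Real.rpow_natCast]; ring
  have e4 : ∀ A : EE N → ℝ, kel R C (b - 4) A y = T / s ^ 4 * A (ivs R y) := by
    intro A; unfold kel; rw [Real.rpow_sub hs, hT, show (4 : ℝ) = ((4 : ℕ) : ℝ) by norm_num, Real.rpow_natCast]; ring
  set x := ivs R y with hx
  set E := ∑ j, y j * pd j φ x with hE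
  set V : Fin N → ℝ := fun i => ∑ j, y j * pd j (pd i φ) x with hV
  set W : Fin N → ℝ := fun i => ∑ j, y j * pd i (pd j φ) x with hW
  set Q := ∑ i, y i * V i with hQ
  have hQ' : ∑ i, y i * W i = Q := by
    simp only [hQ, hV, hW, Finset.mul_sum]
    rw [Finset.sum_comm]
    refine Finset.sum_congr rfl fun i _ => Finset.sum_congr rfl fun j _ => by ring
  have hss : ∑ i, y i ^ 2 = s := by rw [hsd, EuclideanSpace.real_norm_sq_eq]
  have key : ∀ i, pd i (pd i (kel R C b φ)) y =
      2 * b * (T / s * φ x) + 4 * b * (b - 1) * (T / s ^ 2 * φ x) * y i ^ 2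
      + (4 * b - 4) * R ^ 2 * (T / s ^ 2) * (y i * pd i φ x)
      - 4 * b * R ^ 2 * (T / s ^ 3) * E * y i ^ 2 + R ^ 4 * (T / s ^ 2) * pd i (pd i φ) x
      - 2 * R ^ 4 * (T / s ^ 3) * (y i * V i) - 2 * R ^ 2 * (T / s ^ 2) * E
      - 4 * (b - 2) * R ^ 2 * (T / s ^ 3) * E * y i ^ 2 - 2 * R ^ 4 * (T / s ^ 3) * (y i * W i)
      + 4 * R ^ 4 * (T / s ^ 4) * Q * y i ^ 2 := by
    intro i
    have ev : pd i (kel R C b φ) =ᶠ[𝓝 y] fun y => 2 * b * (y i * kel R C (b - 1) φ y) + R ^ 2 * kel R C (b - 1) (pd i φ) y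
      - 2 * R ^ 2 * (y i * ∑ j, y j * kel R C (b - 2) (pd j φ) y) := by
      filter_upwards [isOpen_ne.mem_nhds hy] with z hz
      rw [kel_pd R C b d0 hz]; ring
    have f1 := (kel_diffAt R C (b - 1) d0 hy).hasFDerivAt
    have f2 := (kel_diffAt R C (b - 1) (d1 i) hy).hasFDerivAt
    have f3 := fun j => (kel_diffAt R C (b - 2) (d1 j) hy).hasFDerivAt
    have f4 : HasFDerivAt (fun y => ∑ j, y j * kel R C (b - 2) (pd j φ) y) _ y :=
      HasFDerivAt.fun_sum (u := Finset.univ) fun j _ => (hcoord j).fun_mul (f3 j)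
    have f5 := ((((hcoord i).fun_mul f1).const_mul (2 * b)).fun_add (f2.const_mul (R ^ 2))).fun_sub
      (((hcoord i).fun_mul f4).const_mul (2 * R ^ 2))
    have g1 := kel_pd R C (b - 1) d0 hy i
    have g2 := kel_pd R C (b - 1) (d1 i) hy i
    have g3 := fun j => kel_pd R C (b - 2) (d1 j) hy i
    have ea : b - 1 - 1 = b - 2 := by ring
    have eb : b - 1 - 2 = b - 3 := by ring
    have ec : b - 2 - 1 = b - 3 := by ring
    have ed : b - 2 - 2 = b - 4 := by ring
    simp only [ea, eb, ec, ed, e2, e3, e4] at g1 g2 g3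
    have h0 : pd i (pd i (kel R C b φ)) y = fderiv ℝ (pd i (kel R C b φ)) y (EuclideanSpace.single i 1) := rfl
    rw [h0, ev.fderiv_eq, f5.fderiv]
    have hp : ∀ (A : EE N → ℝ), fderiv ℝ A y (EuclideanSpace.single i 1) = pd i A y := fun _ => rfl
    have hproj : ∀ (j : Fin N) (v : EE N), (EuclideanSpace.proj j : EE N →L[ℝ] ℝ) v = v j := fun _ _ => rfl
    simp only [add_apply, sub_apply, smul_apply, sum_apply, smul_eq_mul, hp, hproj, g1, g2, g3, e1, e2]
    have m1 : ∀ (c : ℝ), ∑ j, y j * (c * pd j φ x) = c * E := by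
      intro c; rw [hE, Finset.mul_sum]; exact Finset.sum_congr rfl fun j _ => by ring
    have m2 : ∀ (c : ℝ) (k : Fin N), ∑ j, y j * (c * pd j (pd k φ) x) = c * V k := by
      intro c k; rw [hV]; simp only [Finset.mul_sum]; exact Finset.sum_congr rfl fun j _ => by ring
    simp only [m1, m2]
    have m3 : ∑ j, (y j * (2 * (b - 2) * y i * (T / s ^ 3 * pd j φ x) + R ^ 2 * (T / s ^ 3 * pd i (pd j φ) x) -
        2 * R ^ 2 * (y i * (T / s ^ 4 * V j))) + (T / s ^ 2 * pd j φ x) * (EuclideanSpace.single i (1 : ℝ) : EE N) j) =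
        2 * (b - 2) * y i * (T / s ^ 3) * E + R ^ 2 * (T / s ^ 3) * W i - 2 * R ^ 2 * y i * (T / s ^ 4) * Q
         + T / s ^ 2 * pd i φ x := by
      have m4 : T / s ^ 2 * pd i φ x = ∑ j, (T / s ^ 2 * pd j φ x) * (EuclideanSpace.single i (1 : ℝ) : EE N) j := by
        simp [Pi.single_apply]
      rw [m4, hE, hW, hQ]
      simp only [Finset.mul_sum]
      rw [← Finset.sum_add_distrib, ← Finset.sum_sub_distrib, ← Finset.sum_add_distrib]
      exact Finset.sum_congr rfl fun j _ => by ring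
    rw [m3]
    simp
    ring
  rw [lapE_pd]
  simp only
  simp_rw [key]
  rw [e2, lapE_pd]
  simp only [Finset.sum_add_distrib, Finset.sum_sub_distrib, ← Finset.mul_sum, ← hE, ← hQ, hQ', hss]
  simp
  rw [show (N : ℝ) = 2 - 2 * b by rw [hb]; ring]
  field_simp
  ring

end P12sec


section P13sec
open scoped ENNReal NNReal Topology ContDiff
variable {N : ℕ} {D : Set (EE N)}

lemma ivs_eq (R : ℝ) : (ivs R : EE N → EE N) = EuclideanGeometry.inversion 0 R := by
  ext1 y
  simp [ivs, EuclideanGeometry.inversion, div_pow]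

lemma norm_ivs (R : ℝ) (y : EE N) : ‖ivs R y‖ = R ^ 2 / ‖y‖ := by
  have := EuclideanGeometry.dist_inversion_center (0 : EE N) y R
  rw [← ivs_eq] at this
  simpa using this

lemma ivs_ivs {R : ℝ} (hR : R ≠ 0) (y : EE N) : ivs R (ivs R y) = y := by
  rw [ivs_eq]; exact EuclideanGeometry.inversion_inversion 0 hR y

lemma ivs_inj {R : ℝ} (hR : R ≠ 0) : Function.Injective (ivs R : EE N → EE N) := by
  rw [ivs_eq]; exact EuclideanGeometry.inversion_injective 0 hR

lemma ivs_ne {R : ℝ} (hR : R ≠ 0) {y : EE N} (hy : y ≠ 0) : ivs R y ≠ 0 := by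
  rw [← norm_ne_zero_iff, norm_ivs]; positivity

lemma ivs_image {R : ℝ} (hR : R ≠ 0) (S : Set (EE N)) : ivs R '' S = {z | ivs R z ∈ S} := by
  ext z
  constructor
  · rintro ⟨y, hy, rfl⟩
    simpa [ivs_ivs hR] using hy
  · intro h
    exact ⟨ivs R z, h, ivs_ivs hR z⟩

lemma ivs_contDiffAt (R : ℝ) {y : EE N} (hy : y ≠ 0) : ContDiffAt ℝ ∞ (ivs R : EE N → EE N) y := by
  unfold ivs
  exact (contDiffAt_const.div (contDiff_norm_sq ℝ).contDiffAt (by positivity)).smul contDiffAt_id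

lemma ivs_measurable (R : ℝ) : Measurable (ivs R : EE N → EE N) := by
  unfold ivs; fun_prop

lemma kel_measurable (R C b : ℝ) {A : EE N → ℝ} (hA : Measurable A) : Measurable (kel R C b A) := by
  unfold kel
  have := hA.comp (ivs_measurable (N := N) R)
  simp only [Function.comp_def] at this
  exact Measurable.mul (by fun_prop) this

lemma ivs_det {R : ℝ} {y : EE N} : |ContinuousLinearMap.det
    ((R / dist y 0) ^ 2 • ((ℝ ∙ (y - 0))ᗮ.reflection : EE N →L[ℝ] EE N))| = (R ^ 2 / ‖y‖ ^ 2) ^ N := by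
  rw [ContinuousLinearMap.det]
  have e : (((R / dist y 0) ^ 2 • ((ℝ ∙ (y - 0))ᗮ.reflection : EE N →L[ℝ] EE N) : EE N →L[ℝ] EE N) : EE N →ₗ[ℝ] EE N) =
    (R / dist y 0) ^ 2 • (ℝ ∙ (y - 0))ᗮ.reflection.toLinearMap := rfl
  rw [e, LinearMap.det_smul, Submodule.det_reflection]
  simp [abs_mul, div_pow]
  positivity

lemma ivs_cov {R : ℝ} (hR : R ≠ 0) {S : Set (EE N)} (hS : MeasurableSet S) (h0 : (0 : EE N) ∉ S) (G : EE N → ℝ) :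
    ∫ z in ivs R '' S, G z = ∫ y in S, (R ^ 2 / ‖y‖ ^ 2) ^ N * G (ivs R y) := by
  have := integral_image_eq_integral_abs_det_fderiv_smul (f := ivs R) (s := S) volume hS
    (f' := fun y => ((R / dist y 0) ^ 2 • ((ℝ ∙ (y - 0))ᗮ.reflection : EE N →L[ℝ] EE N)))
    (fun y hy => by
      rw [ivs_eq]
      exact (EuclideanGeometry.hasFDerivAt_inversion (fun h : y = 0 => h0 (h ▸ hy))).hasFDerivWithinAt)
    (ivs_inj hR).injOn G
  rw [this]
  simp_rw [ivs_det, smul_eq_mul]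

lemma kel_cov {R C b : ℝ} (hR : 0 < R) (hb : b = 1 - (N : ℝ) / 2) {S : Set (EE N)} (hS : MeasurableSet S)
    (h0 : (0 : EE N) ∉ S) (u F : EE N → ℝ) :
    ∫ z in ivs R '' S, kel R C b u z * F z = ∫ y in S, u y * (R ^ 4 * kel R C (b - 2) F y) := by
  rw [ivs_cov hR.ne' hS h0]
  refine setIntegral_congr_fun hS fun y hy => ?_
  have hy0 : y ≠ 0 := fun h => h0 (h ▸ hy)
  have hs : 0 < ‖y‖ ^ 2 := by positivity
  simp only [kel, ivs_ivs hR.ne', norm_ivs]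
  have key : (R ^ 2 / ‖y‖ ^ 2) ^ N * ((R ^ 2 / ‖y‖) ^ 2) ^ b = R ^ 4 * (‖y‖ ^ 2) ^ (b - 2) := by
    rw [← Real.rpow_natCast (R ^ 2 / ‖y‖ ^ 2) N, show (N : ℝ) = 2 - 2 * b by rw [hb]; ring,
      show (R ^ 2 / ‖y‖) ^ 2 = (R ^ 2) ^ 2 / (‖y‖ ^ 2) by field_simp]
    generalize ‖y‖ ^ 2 = s at *
    rw [Real.div_rpow (by positivity) hs.le, Real.div_rpow (by positivity) hs.le, Real.rpow_sub hs, Real.rpow_sub hs,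
      Real.rpow_sub (by positivity), mul_comm 2 b, Real.rpow_mul (by positivity), Real.rpow_mul (by positivity) b 2]
    norm_num
    rw [← Real.rpow_pow_comm (by positivity : (0 : ℝ) ≤ R ^ 2)]
    field_simp
  linear_combination (C * u y * F (ivs R y)) * key

lemma kel_smooth {R C b : ℝ} (hR : R ≠ 0) {φ : EE N → ℝ} (hφ : ContDiff ℝ ∞ φ) (hc : HasCompactSupport φ)
    (h0 : (0 : EE N) ∉ tsupport φ) : ContDiff ℝ ∞ (kel R C b φ) ∧ HasCompactSupport (kel R C b φ) := by
  obtain ⟨ρ, hρ, hρ'⟩ := Metric.isOpen_iff.1 (isClosed_tsupport φ).isOpen_compl 0 h0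
  obtain ⟨B, hB⟩ := hc.isBounded.exists_norm_le
  have hφ0 : ∀ x, φ x ≠ 0 → ρ ≤ ‖x‖ ∧ ‖x‖ ≤ B := by
    intro x hx
    have hx' : x ∈ tsupport φ := subset_tsupport _ hx
    refine ⟨?_, hB x hx'⟩
    by_contra h
    exact hρ' (show x ∈ Metric.ball 0 ρ by simpa using h) hx'
  have hk : ∀ y, kel R C b φ y ≠ 0 → ρ ≤ R ^ 2 / ‖y‖ ∧ R ^ 2 / ‖y‖ ≤ B := by
    intro y hy
    have : φ (ivs R y) ≠ 0 := fun h => hy (by simp [kel, h])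
    simpa [norm_ivs] using hφ0 _ this
  have hR2 : 0 < R ^ 2 := by positivity
  constructor
  · rw [contDiff_iff_contDiffAt]
    intro y
    by_cases hy : y = 0
    · subst hy
      have : kel R C b φ =ᶠ[𝓝 0] fun _ => 0 := by
        filter_upwards [Metric.ball_mem_nhds (0 : EE N) (show 0 < R ^ 2 / (|B| + 1) by positivity)] with y hy
        by_contra h
        have h1 := hk y h
        have hy0 : 0 < ‖y‖ := by
          rcases (norm_nonneg y).eq_or_lt with h2 | h2
          · rw [← h2] at h1; simp at h1; linarith
          · exact h2
        simp at hy
        rw [lt_div_iff₀ (by positivity)] at hy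
        have h2 := h1.2
        rw [div_le_iff₀ hy0] at h2
        nlinarith [le_abs_self B]
      exact contDiffAt_const.congr_of_eventuallyEq this
    · unfold kel
      have h1 : ContDiffAt ℝ ∞ (fun y : EE N => (‖y‖ ^ 2) ^ b) y :=
        (contDiff_norm_sq ℝ).contDiffAt.rpow_const_of_ne (by positivity)
      exact (contDiffAt_const.mul h1).mul (hφ.contDiffAt.comp y (ivs_contDiffAt R hy))
  · refine HasCompactSupport.intro (isCompact_closedBall (0 : EE N) (R ^ 2 / ρ)) fun y hy => ?_
    by_contra h
    have h1 := (hk y h).1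
    have hy0 : 0 < ‖y‖ := by
      rcases (norm_nonneg y).eq_or_lt with h2 | h2
      · rw [← h2] at h1; simp at h1; linarith
      · exact h2
    simp at hy
    rw [div_lt_iff₀ hρ] at hy
    rw [le_div_iff₀ hy0] at h1
    nlinarith

lemma kel_bdd {R C b ρ M : ℝ} (hb : b ≤ 0) (hρ : 0 < ρ) {u : EE N → ℝ} (hu : ∀ x, |u x| ≤ M) {z : EE N}
    (hz : ρ ≤ ‖z‖) : |kel R C b u z| ≤ |C| * (ρ ^ 2) ^ b * M := by
  unfold kel
  rw [abs_mul, abs_mul, abs_of_nonneg (Real.rpow_nonneg (sq_nonneg ‖z‖) b)]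
  have h1 : (‖z‖ ^ 2) ^ b ≤ (ρ ^ 2) ^ b :=
    Real.rpow_le_rpow_of_nonpos (by positivity) (by gcongr) hb
  have := hu (ivs R z)
  gcongr

lemma lapE_sub {φ ψ : EE N → ℝ} (hφ : ContDiff ℝ ∞ φ) (hψ : ContDiff ℝ ∞ ψ) (x : EE N) :
    lapE (fun y => φ y - ψ y) x = lapE φ x - lapE ψ x := by
  have h : ∀ {A B : EE N → ℝ} (_ : ContDiff ℝ ∞ A) (_ : ContDiff ℝ ∞ B) (i : Fin N),
      pd i (fun y => A y - B y) = fun y => pd i A y - pd i B y := by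
    intro A B hA hB i
    ext y
    unfold pd
    rw [fderiv_fun_sub ((hA.differentiable (by simp)) y) ((hB.differentiable (by simp)) y)]
    rfl
  simp only [lapE_pd]
  rw [← Finset.sum_sub_distrib]
  refine Finset.sum_congr rfl fun i _ => ?_
  rw [h hφ hψ, h (pd_smooth hφ i) (pd_smooth hψ i)]

/-- one reflected piece -/
lemma kel_piece {R C b : ℝ} (hN : 3 ≤ N) (hR : 0 < R) (hb : b = 1 - (N : ℝ) / 2) (hD : MeasurableSet D) {ρ : ℝ} (hρ : 0 < ρ)
    (h0 : (0 : EE N) ∉ D) (hA : ∀ z, ivs R z ∈ D → ρ ≤ ‖z‖)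
    {u f : EE N → ℝ} {M : ℝ} (hu : Measurable u) (hf : Measurable f) (hMu : ∀ x, |u x| ≤ M) (hMf : ∀ x, |f x| ≤ M) :
    ∃ u' f' : EE N → ℝ, u' = Set.indicator (ivs R '' D) (kel R C b u) ∧ Measurable u' ∧ Measurable f' ∧
      (∃ M', ∀ x, |u' x| ≤ M' ∧ |f' x| ≤ M') ∧ (∀ z, z ∉ ivs R '' D → f' z = 0) ∧
      ∀ φ : EE N → ℝ, ContDiff ℝ ∞ φ → HasCompactSupport φ → (0 : EE N) ∉ tsupport φ →
        (∫ z, u' z * lapE φ z = ∫ y in D, u y * lapE (kel R C b φ) y) ∧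
        (∫ z, f' z * φ z = ∫ y in D, f y * kel R C b φ y) := by
  have hAm : MeasurableSet (ivs R '' D) := by
    rw [ivs_image hR.ne']; exact ivs_measurable R hD
  have hM : 0 ≤ M := (abs_nonneg _).trans (hMu 0)
  have hb0 : b ≤ 0 := by
    have : (3 : ℝ) ≤ N := by exact_mod_cast hN
    rw [hb]; linarith
  refine ⟨_, Set.indicator (ivs R '' D) (fun z => R ^ 4 * kel R C (b - 2) f z), rfl,
    (kel_measurable R C b hu).indicator hAm, ((kel_measurable R C (b - 2) hf).const_mul _).indicator hAm, ?_, ?_, ?_⟩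
  · refine ⟨max (|C| * (ρ ^ 2) ^ b * M) (R ^ 4 * (|C| * (ρ ^ 2) ^ (b - 2) * M)), fun x => ?_⟩
    by_cases hx : x ∈ ivs R '' D
    · have hx' : ρ ≤ ‖x‖ := hA x (by rwa [ivs_image hR.ne'] at hx)
      rw [Set.indicator_of_mem hx, Set.indicator_of_mem hx]
      refine ⟨le_max_of_le_left (kel_bdd hb0 hρ hMu hx'), le_max_of_le_right ?_⟩
      rw [abs_mul, abs_of_pos (by positivity : 0 < R ^ 4)]
      have := kel_bdd (R := R) (C := C) (by linarith : b - 2 ≤ 0) hρ hMf hx'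
      gcongr
    · rw [Set.indicator_of_notMem hx, Set.indicator_of_notMem hx, abs_zero]
      have : 0 ≤ max (|C| * (ρ ^ 2) ^ b * M) (R ^ 4 * (|C| * (ρ ^ 2) ^ (b - 2) * M)) :=
        le_max_of_le_left (by positivity)
      exact ⟨this, this⟩
  · intro z hz
    rw [Set.indicator_of_notMem hz]
  · intro φ hφ hc h0φ
    constructor
    · simp_rw [← Set.indicator_mul_left]
      rw [integral_indicator hAm, kel_cov hR hb hD h0]
      refine setIntegral_congr_fun hD fun y hy => ?_
      rw [kel_lap R C b hb hφ (fun h => h0 (h ▸ hy))]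
    · have e : ∀ z, (ivs R '' D).indicator (fun z => R ^ 4 * kel R C (b - 2) f z) z * φ z =
          (ivs R '' D).indicator (fun z => R ^ 4 * kel R C (b - 2) f z * φ z) z := fun z => by
        by_cases hz : z ∈ ivs R '' D
        · rw [Set.indicator_of_mem hz, Set.indicator_of_mem hz]
        · rw [Set.indicator_of_notMem hz, Set.indicator_of_notMem hz, zero_mul]
      simp_rw [e]
      rw [integral_indicator hAm]
      have h1 : ivs R '' (ivs R '' D) = D := by
        rw [ivs_image hR.ne', ivs_image hR.ne']
        ext z; simp [ivs_ivs hR.ne']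
      have h2 : (0 : EE N) ∉ ivs R '' D := by
        rw [ivs_image hR.ne']; intro h
        have := hA _ h
        simp at this; linarith
      have := kel_cov (C := C) hR hb hAm h2 φ f
      rw [h1] at this
      calc _ = ∫ y in ivs R '' D, φ y * (R ^ 4 * kel R C (b - 2) f y) := by
            congr 1; ext y; ring
        _ = _ := by rw [← this]; congr 1; ext y; ring

end P13sec


section P14sec
open scoped ENNReal NNReal Topology ContDiff
variable {N : ℕ} {D : Set (EE N)}

lemma DSet_open (R₁ R₂ : ℝ) : IsOpen (DSet N R₁ R₂) :=
  (isOpen_lt continuous_const continuous_norm).inter (isOpen_lt continuous_norm continuous_const)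

lemma DSet_bdd (R₁ R₂ : ℝ) : Bornology.IsBounded (DSet N R₁ R₂) :=
  (Metric.isBounded_ball (x := (0 : EE N)) (r := R₂)).subset fun z (hz : R₁ < ‖z‖ ∧ ‖z‖ < R₂) => by simpa using hz.2

lemma mem_ivs_DSet {R₁ R₂ R : ℝ} (h1 : 0 < R₁) (h2 : 0 < R₂) (hR : 0 < R) (z : EE N) :
    ivs R z ∈ DSet N R₁ R₂ ↔ z ∈ DSet N (R ^ 2 / R₂) (R ^ 2 / R₁) := by
  simp only [DSet, Set.mem_ofPred_eq, norm_ivs]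
  rcases (norm_nonneg z).eq_or_lt with h | h
  · rw [← h]
    simp only [div_zero]
    constructor
    · rintro ⟨h3, _⟩; linarith
    · rintro ⟨h3, _⟩
      have : 0 < R ^ 2 / R₂ := by positivity
      linarith
  · rw [lt_div_iff₀ h, div_lt_iff₀ h, div_lt_iff₀ h2, lt_div_iff₀ h1]
    constructor <;> rintro ⟨a, b⟩ <;> constructor <;> linarith

lemma kel_VW (hN : 3 ≤ N) {R₁ R₂ : ℝ} (hR₁ : 0 < R₁) (hR : R₁ < R₂) {u f : EE N → ℝ} (hu : Measurable u) (hf : Measurable f)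
    {M : ℝ} (hMu : ∀ x, |u x| ≤ M) (hMf : ∀ x, |f x| ≤ M)
    (H : ∀ ψ : EE N → ℝ, ContDiff ℝ ∞ ψ → HasCompactSupport ψ → (∀ z, ‖z‖ = R₁ → ψ z = 0) → (∀ z, ‖z‖ = R₂ → ψ z = 0) →
      ∫ z in DSet N R₁ R₂, u z * lapE ψ z = -∫ z in DSet N R₁ R₂, f z * ψ z) :
    ∃ ut ft : EE N → ℝ, ∃ M', Measurable ut ∧ Measurable ft ∧ (∀ x, |ut x| ≤ M') ∧ (∀ x, |ft x| ≤ M') ∧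
      VW (DSet N (R₁ ^ 2 / R₂) (R₂ ^ 2 / R₁)) ut ft ∧ (∀ z ∈ DSet N R₁ R₂, ut z = u z) ∧
      (∀ z ∈ DSet N (R₁ ^ 2 / R₂) R₁, ut z = -kel R₁ ((R₁ ^ 2) ^ (-(1 - (N : ℝ) / 2))) (1 - (N : ℝ) / 2) u z) ∧
      (∀ z ∈ DSet N R₂ (R₂ ^ 2 / R₁), ut z = -kel R₂ ((R₂ ^ 2) ^ (-(1 - (N : ℝ) / 2))) (1 - (N : ℝ) / 2) u z) := by
  have hR₂ : 0 < R₂ := hR₁.trans hR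
  have ha : 0 < R₁ ^ 2 / R₂ := by positivity
  have haR : R₁ ^ 2 / R₂ < R₁ := by rw [div_lt_iff₀ hR₂]; nlinarith
  have hRb : R₂ < R₂ ^ 2 / R₁ := by rw [lt_div_iff₀ hR₁]; nlinarith
  set b : ℝ := 1 - (N : ℝ) / 2 with hb
  set C₁ := (R₁ ^ 2) ^ (-b) with hC₁
  set C₂ := (R₂ ^ 2) ^ (-b) with hC₂
  set D := DSet N R₁ R₂ with hDd
  have hDm : MeasurableSet D := (DSet_open R₁ R₂).measurableSet
  have h0D : (0 : EE N) ∉ D := by intro h; have := h.1; simp at this; linarith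
  have hA1 : ivs R₁ '' D = DSet N (R₁ ^ 2 / R₂) R₁ := by
    rw [ivs_image hR₁.ne']; ext z
    rw [Set.mem_ofPred_eq, mem_ivs_DSet hR₁ hR₂ hR₁, show R₁ ^ 2 / R₁ = R₁ by field_simp]
  have hA2 : ivs R₂ '' D = DSet N R₂ (R₂ ^ 2 / R₁) := by
    rw [ivs_image hR₂.ne']; ext z
    rw [Set.mem_ofPred_eq, mem_ivs_DSet hR₁ hR₂ hR₂, show R₂ ^ 2 / R₂ = R₂ by field_simp]
  obtain ⟨u1, f1, hu1, mu1, mf1, ⟨M1, hM1⟩, hf1, hp1⟩ := kel_piece (C := C₁) hN hR₁ hb hDm ha h0D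
    (fun z hz => by
      rw [mem_ivs_DSet hR₁ hR₂ hR₁] at hz; exact hz.1.le) hu hf hMu hMf
  obtain ⟨u2, f2, hu2, mu2, mf2, ⟨M2, hM2⟩, hf2, hp2⟩ := kel_piece (C := C₂) hN hR₂ hb hDm ha h0D
    (fun z hz => by
      rw [mem_ivs_DSet hR₁ hR₂ hR₂] at hz
      have := hz.1
      have e : R₂ ^ 2 / R₂ = R₂ := by field_simp
      linarith) hu hf hMu hMf
  have hM : 0 ≤ M := (abs_nonneg _).trans (hMu 0)
  have bi : ∀ (q : EE N → ℝ), (∀ x, |q x| ≤ M) → ∀ x, |D.indicator q x| ≤ M := by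
    intro q hq x
    by_cases hx : x ∈ D
    · rw [Set.indicator_of_mem hx]; exact hq x
    · rw [Set.indicator_of_notMem hx]; simpa using hM
  refine ⟨fun z => D.indicator u z - u1 z - u2 z, fun z => D.indicator f z - f1 z - f2 z, M + M1 + M2,
    ((hu.indicator hDm).sub mu1).sub mu2, ((hf.indicator hDm).sub mf1).sub mf2, ?_, ?_, ?_, ?_, ?_, ?_⟩
  · intro x
    have h1 := bi u hMu x
    have h2 := (hM1 x).1
    have h3 := (hM2 x).1
    rw [abs_le] at *
    constructor <;> linarith [h1.1, h1.2, h2.1, h2.2, h3.1, h3.2]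
  · intro x
    have h1 := bi f hMf x
    have h2 := (hM1 x).2
    have h3 := (hM2 x).2
    rw [abs_le] at *
    constructor <;> linarith [h1.1, h1.2, h2.1, h2.2, h3.1, h3.2]
  · intro φ hφ hc hs
    have h0φ : (0 : EE N) ∉ tsupport φ := by
      intro h; have := (hs h).1; simp at this; linarith
    obtain ⟨s1, c1⟩ := kel_smooth (R := R₁) (C := C₁) (b := b) hR₁.ne' hφ hc h0φ
    obtain ⟨s2, c2⟩ := kel_smooth (R := R₂) (C := C₂) (b := b) hR₂.ne' hφ hc h0φ
    have hz : ∀ z, z ∉ DSet N (R₁ ^ 2 / R₂) (R₂ ^ 2 / R₁) → φ z = 0 := by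
      intro z hz; by_contra h; exact hz (hs (subset_tsupport _ h))
    have kelR : ∀ R : ℝ, 0 < R → ∀ z : EE N, ‖z‖ = R → kel R ((R ^ 2) ^ (-b)) b φ z = φ z := by
      intro R hR z hz
      unfold kel ivs
      rw [hz, div_self (by positivity), one_smul, ← Real.rpow_add (by positivity)]
      simp
    have HH := H (fun y => φ y - kel R₁ C₁ b φ y - kel R₂ C₂ b φ y) ((hφ.sub s1).sub s2)
      ((hc.sub c1).sub c2) ?_ ?_
    rotate_left
    · intro z hz1
      rw [kelR R₁ hR₁ z hz1]
      have : kel R₂ C₂ b φ z = 0 := by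
        unfold kel
        rw [hz, mul_zero]
        rintro ⟨_, h⟩
        rw [norm_ivs, hz1] at h
        exact lt_irrefl _ h
      rw [this]; simp
    · intro z hz1
      rw [kelR R₂ hR₂ z hz1]
      have : kel R₁ C₁ b φ z = 0 := by
        unfold kel
        rw [hz, mul_zero]
        rintro ⟨h, _⟩
        rw [norm_ivs, hz1] at h
        exact lt_irrefl _ h
      rw [this]; simp
    have bint : ∀ {q A : EE N → ℝ} {m : ℝ}, Measurable q → (∀ x, |q x| ≤ m) → Continuous A → HasCompactSupport A →
        Integrable fun z => q z * A z := by
      intro q A m hq hm hA hAc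
      exact (hA.integrable_of_hasCompactSupport hAc).bdd_mul hq.aestronglyMeasurable (Eventually.of_forall hm)
    have lapc : ∀ {A : EE N → ℝ}, ContDiff ℝ ∞ A → Continuous (lapE A) := fun h => (lapE_smooth h).continuous
    have key : ∀ {q q1 q2 A B1 B2 : EE N → ℝ} (_ : Measurable q) (_ : Measurable q1) (_ : Measurable q2)
        (_ : ∀ x, |q x| ≤ M) (_ : ∀ x, |q1 x| ≤ M1) (_ : ∀ x, |q2 x| ≤ M2) (_ : Continuous A) (_ : HasCompactSupport A)
        (_ : Continuous B1) (_ : HasCompactSupport B1) (_ : Continuous B2) (_ : HasCompactSupport B2)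
        (_ : ∫ z, q1 z * A z = ∫ y in D, q y * B1 y) (_ : ∫ z, q2 z * A z = ∫ y in D, q y * B2 y),
        ∫ z, (D.indicator q z - q1 z - q2 z) * A z = ∫ y in D, q y * (A y - B1 y - B2 y) := by
      intro q q1 q2 A B1 B2 mq mq1 mq2 bq bq1 bq2 cA sA cB1 sB1 cB2 sB2 e1 e2
      simp only [sub_mul, mul_sub]
      have i12 : Integrable (fun z => D.indicator q z * A z - q1 z * A z) :=
        (bint (mq.indicator hDm) (bi q bq) cA sA).sub (bint mq1 bq1 cA sA)
      have i34 : Integrable (fun z => q z * A z - q z * B1 z) := (bint mq bq cA sA).sub (bint mq bq cB1 sB1)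
      rw [integral_sub i12 (bint mq2 bq2 cA sA),
        integral_sub (bint (mq.indicator hDm) (bi q bq) cA sA) (bint mq1 bq1 cA sA),
        integral_sub i34.integrableOn (bint mq bq cB2 sB2).integrableOn,
        integral_sub (bint mq bq cA sA).integrableOn (bint mq bq cB1 sB1).integrableOn, e1, e2]
      congr 2
      rw [← integral_indicator hDm]
      congr 1; ext z
      by_cases hz : z ∈ D
      · rw [Set.indicator_of_mem hz, Set.indicator_of_mem hz]
      · rw [Set.indicator_of_notMem hz, Set.indicator_of_notMem hz, zero_mul]
    rw [key hu mu1 mu2 hMu (fun x => (hM1 x).1) (fun x => (hM2 x).1) (lapc hφ) (lapE_cs hc) (lapc s1) (lapE_cs c1)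
      (lapc s2) (lapE_cs c2) (hp1 φ hφ hc h0φ).1 (hp2 φ hφ hc h0φ).1,
      key hf mf1 mf2 hMf (fun x => (hM1 x).2) (fun x => (hM2 x).2) hφ.continuous hc s1.continuous c1
      s2.continuous c2 (hp1 φ hφ hc h0φ).2 (hp2 φ hφ hc h0φ).2, ← HH]
    congr 1; ext y
    rw [lapE_sub (hφ.sub s1) s2, lapE_sub hφ s1]
  · intro z hz
    simp only [hu1, hu2, hA1, hA2]
    rw [Set.indicator_of_mem hz, Set.indicator_of_notMem, Set.indicator_of_notMem]
    · ring
    · intro h; linarith [h.1, hz.2]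
    · intro h; linarith [h.2, hz.1]
  · intro z hz
    simp only [hu1, hu2, hA1, hA2]
    rw [Set.indicator_of_notMem, Set.indicator_of_mem hz, Set.indicator_of_notMem]
    · ring
    · intro h; linarith [h.1, hz.2]
    · intro h; linarith [h.1, hz.2]
  · intro z hz
    simp only [hu1, hu2, hA1, hA2]
    rw [Set.indicator_of_notMem, Set.indicator_of_notMem, Set.indicator_of_mem hz]
    · ring
    · intro h; linarith [h.2, hz.1]
    · intro h; linarith [h.2, hz.1]

/-- vanishing on the sphere by odd reflection -/
lemma odd_zero {R b : ℝ} (hR : 0 < R) {v : EE N → ℝ} (hv : Continuous v) {W : Set (EE N)} (hW : IsOpen W) (h0 : (0 : EE N) ∉ W)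
    (h : ∀ᵐ z, z ∈ W → v z = -kel R ((R ^ 2) ^ (-b)) b v z) {z₀ : EE N} (hz : ‖z₀‖ = R) (hcl : z₀ ∈ closure W) : v z₀ = 0 := by
  have hkc : ContinuousOn (kel R ((R ^ 2) ^ (-b)) b v) {0}ᶜ := by
    intro y hy
    have hy' : y ≠ 0 := hy
    refine ContinuousAt.continuousWithinAt ?_
    unfold kel
    have h1 : ContinuousAt (fun y : EE N => (‖y‖ ^ 2) ^ b) y :=
      ContinuousAt.rpow_const (by fun_prop) (Or.inl (by positivity))
    exact (continuousAt_const.mul h1).mul (hv.continuousAt.comp (ivs_contDiffAt R hy').continuousAt)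
  have hsub : W ⊆ {0}ᶜ := fun z hz h => h0 (by rw [Set.mem_singleton_iff] at h; exact h ▸ hz)
  have heq : Set.EqOn v (fun z => -kel R ((R ^ 2) ^ (-b)) b v z) W := by
    refine Measure.eqOn_open_of_ae_eq (μ := volume) ?_ hW hv.continuousOn (hkc.mono hsub).neg
    rw [EventuallyEq, ae_restrict_iff' hW.measurableSet]
    exact h
  have hz0 : z₀ ≠ 0 := by intro h; rw [h] at hz; simp at hz; linarith
  have hk1 : ContinuousAt (kel R ((R ^ 2) ^ (-b)) b v) z₀ :=
    hkc.continuousAt (isOpen_compl_singleton.mem_nhds hz0)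
  have : (𝓝[W] z₀).NeBot := mem_closure_iff_nhdsWithin_neBot.1 hcl
  have t1 : Tendsto v (𝓝[W] z₀) (𝓝 (v z₀)) := hv.continuousAt.mono_left nhdsWithin_le_nhds
  have t2 : Tendsto v (𝓝[W] z₀) (𝓝 (-kel R ((R ^ 2) ^ (-b)) b v z₀)) := by
    refine (Tendsto.neg (hk1.mono_left nhdsWithin_le_nhds)).congr' ?_
    filter_upwards [self_mem_nhdsWithin] with z hz using (heq hz).symm
  have e := tendsto_nhds_unique t1 t2
  have : kel R ((R ^ 2) ^ (-b)) b v z₀ = v z₀ := by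
    unfold kel ivs
    rw [hz, div_self (by positivity), one_smul, ← Real.rpow_add (by positivity)]
    simp
  rw [this] at e
  linarith

lemma closure_DSet {R₁ R₂ : ℝ} (hR₁ : 0 < R₁) (hR : R₁ < R₂) : closure (DSet N R₁ R₂) = {z | R₁ ≤ ‖z‖ ∧ ‖z‖ ≤ R₂} := by
  apply Set.Subset.antisymm
  · refine closure_minimal (fun z hz => ⟨hz.1.le, hz.2.le⟩) ?_
    exact (isClosed_le continuous_const continuous_norm).inter (isClosed_le continuous_norm continuous_const)
  · rintro z ⟨h1, h2⟩
    have hz : 0 < ‖z‖ := hR₁.trans_le h1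
    set c := (R₁ + R₂) / 2 with hc
    have ht : Tendsto (fun s : ℝ => (1 + s * ((c - ‖z‖) / ‖z‖)) • z) (𝓝[>] 0) (𝓝 z) := by
      have : Continuous fun s : ℝ => (1 + s * ((c - ‖z‖) / ‖z‖)) • z := by fun_prop
      have h := this.tendsto 0
      simp at h
      exact h.mono_left nhdsWithin_le_nhds
    refine mem_closure_of_tendsto ht ?_
    have : Set.Ioo (0 : ℝ) 1 ∈ 𝓝[>] (0 : ℝ) := Ioo_mem_nhdsGT one_pos
    filter_upwards [this] with s hs
    have e : (1 + s * ((c - ‖z‖) / ‖z‖)) * ‖z‖ = ‖z‖ + s * (c - ‖z‖) := by field_simp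
    have hpos : 0 ≤ 1 + s * ((c - ‖z‖) / ‖z‖) := by
      have : 0 ≤ (‖z‖ + s * (c - ‖z‖)) := by nlinarith [hs.1, hs.2]
      rw [← e] at this
      exact nonneg_of_mul_nonneg_left this hz
    have hn : ‖(1 + s * ((c - ‖z‖) / ‖z‖)) • z‖ = ‖z‖ + s * (c - ‖z‖) := by
      rw [norm_smul, Real.norm_of_nonneg hpos, e]
    simp only [DSet, Set.mem_ofPred_eq, hn]
    constructor <;> nlinarith [hs.1, hs.2]

lemma frontier_DSet {R₁ R₂ : ℝ} (hR₁ : 0 < R₁) (hR : R₁ < R₂) : frontier (DSet N R₁ R₂) = {z | ‖z‖ = R₁ ∨ ‖z‖ = R₂} := by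
  rw [(DSet_open R₁ R₂).frontier_eq, closure_DSet hR₁ hR]
  ext z
  simp only [DSet, Set.mem_sdiff, Set.mem_ofPred_eq]
  constructor
  · rintro ⟨⟨h1, h2⟩, h3⟩
    rcases h1.eq_or_lt with h | h
    · exact Or.inl h.symm
    · rcases h2.eq_or_lt with h' | h'
      · exact Or.inr h'
      · exact absurd ⟨h, h'⟩ h3
  · rintro (h | h) <;> rw [h]
    · exact ⟨⟨le_refl _, hR.le⟩, fun h => lt_irrefl _ h.1⟩
    · exact ⟨⟨hR.le, le_refl _⟩, fun h => lt_irrefl _ h.2⟩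

theorem bdry_reg (hN : 3 ≤ N) {R₁ R₂ : ℝ} (hR₁ : 0 < R₁) (hR : R₁ < R₂) {u f : EE N → ℝ} (hu : Measurable u) (hf : Measurable f)
    {M : ℝ} (hMu : ∀ x, |u x| ≤ M) (hMf : ∀ x, |f x| ≤ M)
    (H : ∀ ψ : EE N → ℝ, ContDiff ℝ ∞ ψ → HasCompactSupport ψ → (∀ z, ‖z‖ = R₁ → ψ z = 0) → (∀ z, ‖z‖ = R₂ → ψ z = 0) →
      ∫ z in DSet N R₁ R₂, u z * lapE ψ z = -∫ z in DSet N R₁ R₂, f z * ψ z) :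
    ∃ v : EE N → ℝ, ContDiff ℝ 1 v ∧ (∀ᵐ z, z ∈ DSet N R₁ R₂ → v z = u z) ∧
      (∀ z, ‖z‖ = R₁ → v z = 0) ∧ (∀ z, ‖z‖ = R₂ → v z = 0) := by
  have hR₂ : 0 < R₂ := hR₁.trans hR
  have ha : 0 < R₁ ^ 2 / R₂ := by positivity
  have haR : R₁ ^ 2 / R₂ < R₁ := by rw [div_lt_iff₀ hR₂]; nlinarith
  have hRb : R₂ < R₂ ^ 2 / R₁ := by rw [lt_div_iff₀ hR₁]; nlinarith
  obtain ⟨ut, ft, M', mu, mf, bu, bf, hV, e0, e1, e2⟩ := kel_VW hN hR₁ hR hu hf hMu hMf H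
  set a := R₁ ^ 2 / R₂ with had
  set b := R₂ ^ 2 / R₁ with hbd
  obtain ⟨r, hr, hr1, hr2⟩ : ∃ r : ℝ, 0 < r ∧ r ≤ (R₁ - a) / 2 ∧ r ≤ (b - R₂) / 2 :=
    ⟨min ((R₁ - a) / 2) ((b - R₂) / 2), lt_min (by linarith) (by linarith), min_le_left _ _, min_le_right _ _⟩
  obtain ⟨v, hv, hve⟩ := reg1 hN (S := DSet N ((a + R₁) / 2) ((R₂ + b) / 2)) mu.aestronglyMeasurable mf.aestronglyMeasurable bu bf hV hr (by
    intro x hx y hy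
    rw [mem_closedBall_iff_norm] at hy
    have h1 := norm_sub_norm_le y x
    have h2 := norm_sub_norm_le x y
    rw [norm_sub_rev] at h2
    have := hx.1
    have := hx.2
    constructor <;> linarith)
  have hD : ∀ᵐ z, z ∈ DSet N R₁ R₂ → v z = u z := by
    filter_upwards [hve] with z hz hzD
    rw [hz ⟨by linarith [hzD.1], by linarith [hzD.2]⟩, e0 z hzD]
  have hnull : ∀ R : ℝ, 0 < R → ∀ᵐ z : EE N, ivs R z ∈ DSet N R₁ R₂ → v (ivs R z) = u (ivs R z) := by
    intro R hR
    set Z : Set (EE N) := {y | ¬ (y ∈ DSet N R₁ R₂ → v y = u y)} with hZ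
    have hZ0 : volume Z = 0 := hD
    have := addHaar_image_eq_zero_of_differentiableOn_of_addHaar_eq_zero volume (s := Z) (f := ivs R) (fun y hy => by
      have hy' : y ≠ 0 := by
        rintro rfl
        simp only [hZ, Set.mem_ofPred_eq, Classical.not_imp] at hy
        have := hy.1.1; simp at this; linarith
      exact (ivs_fd R hy').differentiableAt.differentiableWithinAt) hZ0
    rw [ivs_image hR.ne'] at this
    exact this
  refine ⟨v, hv, hD, ?_, ?_⟩
  · intro z₀ hz
    refine odd_zero (b := 1 - (N : ℝ) / 2) hR₁ hv.continuous (DSet_open ((a + R₁) / 2) R₁)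
      (fun h => by have := h.1; simp at this; linarith) ?_ hz ?_
    · filter_upwards [hve, hnull R₁ hR₁] with z h1 h2 hzW
      have hzA : z ∈ DSet N a R₁ := ⟨by linarith [hzW.1], hzW.2⟩
      rw [h1 ⟨hzW.1, by linarith [hzW.2]⟩, e1 z hzA]
      unfold kel
      rw [h2]
      rw [mem_ivs_DSet hR₁ hR₂ hR₁, show R₁ ^ 2 / R₁ = R₁ by field_simp]
      exact hzA
    · rw [closure_DSet (by linarith) (by linarith)]
      exact ⟨by linarith, by linarith⟩
  · intro z₀ hz
    refine odd_zero (b := 1 - (N : ℝ) / 2) hR₂ hv.continuous (DSet_open R₂ ((R₂ + b) / 2))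
      (fun h => by have := h.1; simp at this; linarith) ?_ hz ?_
    · filter_upwards [hve, hnull R₂ hR₂] with z h1 h2 hzW
      have hzA : z ∈ DSet N R₂ b := ⟨hzW.1, by linarith [hzW.2]⟩
      rw [h1 ⟨by linarith [hzW.1], hzW.2⟩, e2 z hzA]
      unfold kel
      rw [h2]
      rw [mem_ivs_DSet hR₁ hR₂ hR₂, show R₂ ^ 2 / R₂ = R₂ by field_simp]
      exact hzA
    · rw [closure_DSet (by linarith) (by linarith)]
      exact ⟨by linarith, by linarith⟩

end P14sec


section P15sec
open scoped ENNReal NNReal Topology ContDiff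
variable {N : ℕ} {D : Set (EE N)}

lemma seg_frontier {S : Set (EE N)} {x y : EE N} (hx : x ∈ S) (hy : y ∉ S) :
    ∃ q ∈ frontier S, dist x q ≤ dist x y := by
  have hseg : IsPreconnected (segment ℝ x y) := (convex_segment x y).isPreconnected
  by_contra hcon
  push Not at hcon
  have hd : ∀ q ∈ segment ℝ x y, q ∉ frontier S := by
    intro q hq hqf
    have h1 := hcon q hqf
    have h2 := dist_add_dist_of_mem_segment hq
    linarith [dist_nonneg (x := q) (y := y)]
  obtain ⟨q, hq, h1, h2⟩ := hseg (interior S) (closure S)ᶜ isOpen_interior isClosed_closure.isOpen_compl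
    (fun q hq => by
      by_cases h : q ∈ interior S
      · exact Or.inl h
      · right
        intro hc
        exact hd q hq ⟨hc, h⟩)
    ⟨x, left_mem_segment ℝ x y, by
      by_contra h
      exact hd x (left_mem_segment ℝ x y) ⟨subset_closure hx, h⟩⟩
    ⟨y, right_mem_segment ℝ x y, fun h =>
      hd y (right_mem_segment ℝ x y) ⟨h, fun h' => hy (interior_subset h')⟩⟩
  exact h2 (subset_closure (interior_subset h1))

lemma ext_lip {S : Set (EE N)} {w : EE N → ℝ} {K : ℝ≥0} (h : LipschitzOnWith K w (closure S))
    (h0 : ∀ z ∈ frontier S, w z = 0) : LipschitzWith K (S.indicator w) := by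
  have key : ∀ x ∈ S, ∀ y ∉ S, |w x| ≤ K * dist x y := by
    intro x hx y hy
    obtain ⟨q, hq, hd⟩ := seg_frontier hx hy
    have := h.dist_le_mul x (subset_closure hx) q (frontier_subset_closure hq)
    rw [h0 q hq, Real.dist_eq, sub_zero] at this
    exact this.trans (by gcongr)
  refine LipschitzWith.of_dist_le_mul fun x y => ?_
  by_cases hx : x ∈ S <;> by_cases hy : y ∈ S
  · simpa [hx, hy] using h.dist_le_mul x (subset_closure hx) y (subset_closure hy)
  · simpa [hx, hy, Real.dist_eq] using key x hx y hy
  · simpa [hx, hy, Real.dist_eq, dist_comm] using key y hy x hx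
  · simp [hx, hy]; positivity

lemma gradient_ev {S : Set (EE N)} (hS : IsOpen S) {w w' : EE N → ℝ} (h : ∀ z ∈ S, w z = w' z) {z : EE N} (hz : z ∈ S) :
    gradient w z = gradient w' z := by
  have : w =ᶠ[𝓝 z] w' := by
    filter_upwards [hS.mem_nhds hz] with y hy using h y hy
  simp [gradient, this.fderiv_eq]

lemma bdryW (hD : IsOpen D) (hb : Bornology.IsBounded D) {w : EE N → ℝ} {K : ℝ≥0} (h : LipschitzOnWith K w (closure D))
    (h0 : ∀ z ∈ frontier D, w z = 0) : IsW D w (gradient w) := by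
  have h1 := lipW hD hb (ext_lip h h0) (fun x hx => by simp [hx])
  refine h1.congr ?_ ?_
  · filter_upwards [ae_restrict_mem hD.measurableSet] with z hz
    simp [hz]
  · filter_upwards [ae_restrict_mem hD.measurableSet] with z hz
    exact gradient_ev hD (fun y hy => by simp [hy]) hz

variable {wt : EE N → ℝ} {a0 a1 p lam : ℝ}

lemma IsMinz.congr {u u' : EE N → ℝ} {g g' : EE N → EE N} (h : IsMinz D wt p lam u g)
    (h1 : u =ᵐ[volume.restrict D] u') (h2 : g =ᵐ[volume.restrict D] g') : IsMinz D wt p lam u' g' := by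
  have e1 : uP u =ᵐ[volume.restrict D] uP u' := by filter_upwards [h1] with z hz; simp [uP, hz]
  have e2 : uM u =ᵐ[volume.restrict D] uM u' := by filter_upwards [h1] with z hz; simp [uM, hz]
  have e3 : gP u g =ᵐ[volume.restrict D] gP u' g' := by filter_upwards [h1, h2] with z hz hz'; simp [gP, hz, hz']
  have e4 : gM u g =ᵐ[volume.restrict D] gM u' g' := by filter_upwards [h1, h2] with z hz hz'; simp [gM, hz, hz']
  obtain ⟨k1, k2, k3, k4, k5, k6⟩ := h
  simp only [Bf_congr e1, Bf_congr e2, Af_congr e1 e3, Af_congr e2 e4] at *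
  exact ⟨k1.congr h1 h2, k2, k3, k4, k5, k6⟩

lemma hasDerivAt_hp (hp : 1 < p) (x : ℝ) : HasDerivAt (fun x : ℝ => |x| ^ (p - 1) * x) (p * |x| ^ (p - 1)) x := by
  by_cases hx : x = 0
  · subst hx
    rw [hasDerivAt_iff_tendsto_slope]
    have hc : Continuous fun x : ℝ => |x| ^ (p - 1) := continuous_abs.rpow_const fun x => Or.inr (by linarith)
    have h0 : |(0:ℝ)| ^ (p - 1) = 0 := by rw [abs_zero, Real.zero_rpow (by linarith)]
    have : Tendsto (fun x : ℝ => |x| ^ (p - 1)) (𝓝[≠] 0) (𝓝 (p * |(0:ℝ)| ^ (p - 1))) := by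
      have := (hc.tendsto 0).mono_left (nhdsWithin_le_nhds (s := {0}ᶜ))
      rw [h0] at this; rwa [h0, mul_zero]
    refine this.congr' ?_
    filter_upwards [self_mem_nhdsWithin] with y hy
    have hy : y ≠ 0 := hy
    simp [slope, hy]
    field_simp
  · have h1 := (hasDerivAt_abs_rpow x hp).const_mul (x / |x|)
    have h2 : (fun y : ℝ => |y| ^ (p - 1) * y) =ᶠ[𝓝 x] fun y => x / |x| * |y| ^ p := by
      have : ∀ᶠ y in 𝓝 x, 0 < y * x := by
        have hc : Continuous fun y : ℝ => y * x := by fun_prop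
        exact hc.tendsto x (lt_mem_nhds (by have := mul_self_pos.2 hx; simpa using this))
      filter_upwards [this] with y hy
      have hy0 : y ≠ 0 := by rintro rfl; simp at hy
      have e : |y| ^ p = |y| ^ (p - 1) * |y| := by
        rw [← Real.rpow_add_one (abs_ne_zero.2 hy0)]; congr 1; ring
      rw [e]
      rcases lt_or_gt_of_ne hx with h | h
      · have : y < 0 := by nlinarith
        rw [abs_of_neg h, abs_of_neg this]; field_simp
      · have : 0 < y := by nlinarith
        rw [abs_of_pos h, abs_of_pos this]; field_simp
    have h3 := h1.congr_of_eventuallyEq h2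
    have e : |x| ^ (p - 1) = |x| ^ (p - 2) * |x| := by
      rw [← Real.rpow_add_one (abs_ne_zero.2 hx)]; congr 1; ring
    have h4 : |x| ≠ 0 := abs_ne_zero.2 hx
    have e5 : p * |x| ^ (p - 1) = x / |x| * (p * |x| ^ (p - 2) * x) := by
      rw [e]; field_simp; rw [sq_abs]
    rw [e5]; exact h3

lemma hp_C1 (hp : 1 < p) : ContDiff ℝ 1 (fun x : ℝ => |x| ^ (p - 1) * x) := by
  rw [contDiff_one_iff_deriv]
  refine ⟨fun x => (hasDerivAt_hp hp x).differentiableAt, ?_⟩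
  have : deriv (fun x : ℝ => |x| ^ (p - 1) * x) = fun x => p * |x| ^ (p - 1) := by
    ext x; exact (hasDerivAt_hp hp x).deriv
  rw [this]
  exact continuous_const.mul (continuous_abs.rpow_const fun x => Or.inr (by linarith))

lemma weakLap {u ψ : EE N → ℝ} {g : EE N → EE N} (h : IsW D u g) (hψ : ContDiff ℝ ∞ ψ) (hc : HasCompactSupport ψ) :
    ∫ z in D, u z * lapE ψ z = - ∫ z in D, inner ℝ (g z) (gradient ψ z) := by
  have hpd : ∀ i, ContDiff ℝ 1 (pd i ψ) := fun i => by exact_mod_cast contDiff_infty.1 (pd_smooth hψ i) 1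
  have m : ∀ i, MemLp (pd i ψ) 2 (volume.restrict D) := fun i =>
    ((hpd i).continuous.memLp_of_hasCompactSupport (pd_cs hc i)).restrict D
  have m2 : ∀ i, MemLp (pd i (pd i ψ)) 2 (volume.restrict D) := fun i =>
    ((pd_smooth (pd_smooth hψ i) i).continuous.memLp_of_hasCompactSupport (pd_cs (pd_cs hc i) i)).restrict D
  have e1 : ∀ z, u z * lapE ψ z = ∑ i, u z * pd i (pd i ψ) z := fun z => by rw [lapE_pd, Finset.mul_sum]
  have e2 : ∀ z, inner ℝ (g z) (gradient ψ z) = ∑ i, inner ℝ (g z) (EuclideanSpace.single i (1:ℝ)) * pd i ψ z := fun z => by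
    rw [real_inner_comm, inner_gradient', fd_sum]
    refine Finset.sum_congr rfl fun i _ => ?_
    congr 1
    simp [EuclideanSpace.inner_single_right]
  simp_rw [e1, e2]
  have k1 : ∀ i, Integrable (fun z => u z * pd i (pd i ψ) z) (volume.restrict D) := fun i => h.1.integrable_mul (m2 i)
  have k2 : ∀ i, Integrable (fun z => inner ℝ (g z) (EuclideanSpace.single i (1:ℝ)) * pd i ψ z) (volume.restrict D) :=
    fun i => (memLp_inner_left h.2.1 _).integrable_mul (m i)
  rw [integral_finsetSum _ fun i _ => k1 i, integral_finsetSum _ fun i _ => k2 i, ← Finset.sum_neg_distrib]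
  exact Finset.sum_congr rfl fun i _ => h.ibp (hpd i) (pd_cs hc i) _


/-- the very weak formulation, tested by smooth functions vanishing on the boundary -/
lemma Prob.veryweak (P : Prob N D wt a0 a1 p lam) {u ψ : EE N → ℝ} {g : EE N → EE N} (h : IsW D u g) (hE : WeakEq D wt p lam u g)
    (hψ : ContDiff ℝ ∞ ψ) (hc : HasCompactSupport ψ) (h0 : ∀ z ∈ frontier D, ψ z = 0) :
    ∫ z in D, u z * lapE ψ z = - ∫ z in D, (wt z * (|u z| ^ (p - 1) * u z - lam * u z)) * ψ z := by
  have hψ1 : ContDiff ℝ 1 ψ := by exact_mod_cast contDiff_infty.1 hψ 1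
  obtain ⟨K, hK⟩ := ContDiff.lipschitzWith_of_hasCompactSupport hc hψ1 one_ne_zero
  have hW : IsW D ψ (gradient ψ) := bdryW P.hD P.hb hK.lipschitzOnWith h0
  rw [weakLap h hψ hc]
  have i1 : Integrable (fun z => wt z * (|u z| ^ (p - 1) * u z * ψ z)) (volume.restrict D) := P.wint (P.i3' h hW)
  have i2 : Integrable (fun z => wt z * (u z * ψ z)) (volume.restrict D) := P.wint (h.1.integrable_mul hW.1)
  have e := hE ψ _ hW
  have e2 : ∫ z in D, (wt z * (|u z| ^ (p - 1) * u z - lam * u z)) * ψ z =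
      (∫ z in D, wt z * (|u z| ^ (p - 1) * u z * ψ z)) - lam * ∫ z in D, wt z * (u z * ψ z) := by
    rw [← integral_const_mul, ← integral_sub i1 (i2.const_mul lam)]
    congr 1; ext z; ring
  rw [e2]
  linarith

lemma prob_DSet (hN : 3 ≤ N) {R₁ R₂ : ℝ} (hR₁ : 0 < R₁) (hR : R₁ < R₂) (hp : 1 < p)
    (hp' : p < ((N : ℝ) + 2) / ((N : ℝ) - 2)) (hlam : 0 < lam) :
    Prob N (DSet N R₁ R₂) (fun z => 1 / (2 * ‖z‖)) (1 / (2 * R₂)) (1 / (2 * R₁)) p lam where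
  hN := hN
  hD := DSet_open R₁ R₂
  hb := DSet_bdd R₁ R₂
  hne := by
    refine ⟨EuclideanSpace.single ⟨0, by omega⟩ ((R₁ + R₂) / 2), ?_⟩
    simp only [DSet, Set.mem_ofPred_eq, EuclideanSpace.norm_single, Real.norm_eq_abs]
    rw [abs_of_pos (by linarith)]
    constructor <;> linarith
  hwm := by fun_prop
  ha0 := by have : 0 < R₂ := hR₁.trans hR; positivity
  hw0 := fun z hz => by
    have h1 : 0 < ‖z‖ := hR₁.trans hz.1
    have h2 : ‖z‖ < R₂ := hz.2
    gcongr
  hw1 := fun z hz => by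
    have h1 : R₁ < ‖z‖ := hz.1
    gcongr
  hp := hp
  hp' := by
    have h3 : (3:ℝ) ≤ N := by exact_mod_cast hN
    rw [sst_coe hN]
    rw [lt_div_iff₀ (by linarith)] at hp' ⊢
    linarith
  hlam := hlam

theorem exists_sol (hN : 3 ≤ N) {R₁ R₂ : ℝ} (hR₁ : 0 < R₁) (hR : R₁ < R₂) (hp : 1 < p)
    (hp' : p < ((N : ℝ) + 2) / ((N : ℝ) - 2)) (hlam : 0 < lam) :
    ∃ v : EE N → ℝ, ContDiff ℝ 1 v ∧ ContDiffOn ℝ 2 v (DSet N R₁ R₂) ∧ (∀ z ∈ frontier (DSet N R₁ R₂), v z = 0) ∧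
      (∀ z ∈ DSet N R₁ R₂, -lapE v z = (|v z| ^ (p - 1) * v z - lam * v z) / (2 * ‖z‖)) ∧
      IsMinz (DSet N R₁ R₂) (fun z => 1 / (2 * ‖z‖)) p lam v (gradient v) := by
  have P := prob_DSet hN hR₁ hR hp hp' hlam
  set D := DSet N R₁ R₂ with hDd
  set wt : EE N → ℝ := fun z => 1 / (2 * ‖z‖) with hwt
  obtain ⟨u, g, hm⟩ := P.exists_minz
  obtain ⟨M, hM, hb⟩ := P.bdd hm.hW (P.EL hm)
  obtain ⟨u0, hu0, he0⟩ := hm.hW.1.1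
  set u' : EE N → ℝ := fun z => max (-M) (min M (u0 z)) with hu'
  have hu'm : Measurable u' := by
    have := hu0.measurable
    fun_prop
  have hu'b : ∀ z, |u' z| ≤ M := fun z => by simp only [hu']; grind
  have hu'e : u =ᵐ[volume.restrict D] u' := by
    filter_upwards [he0, hb] with z h1 h2
    simp only [hu', ← h1]; grind
  have hm' := hm.congr hu'e (ae_eq_refl g)
  have hE' := P.EL hm'
  set f : EE N → ℝ := D.indicator (fun z => wt z * (|u' z| ^ (p - 1) * u' z - lam * u' z)) with hf
  have ha1 := P.a1pos
  have hfm : Measurable f := by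
    refine Measurable.indicator ?_ P.hD.measurableSet
    have := P.hwm
    fun_prop
  have hfb : ∀ z, |f z| ≤ 1 / (2 * R₁) * (M ^ (p - 1) * M + lam * M) := fun z => by
    by_cases hz : z ∈ D
    · simp only [hf, Set.indicator_of_mem hz]
      have h1 := P.hw1 z hz
      have h0 : 0 ≤ wt z := P.ha0.le.trans (P.hw0 z hz)
      rw [abs_mul, abs_of_nonneg h0]
      have h2 : |(|u' z| ^ (p - 1) * u' z - lam * u' z)| ≤ M ^ (p - 1) * M + lam * M := by
        refine (abs_sub _ _).trans ?_
        rw [abs_mul, abs_mul, abs_of_pos hlam, abs_of_nonneg (by positivity : (0:ℝ) ≤ |u' z| ^ (p - 1))]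
        have := hu'b z
        have : |u' z| ^ (p - 1) ≤ M ^ (p - 1) := Real.rpow_le_rpow (abs_nonneg _) this (by linarith)
        gcongr
      gcongr
    · simp only [hf, Set.indicator_of_notMem hz, abs_zero]
      positivity
  have hfr : frontier D = {z | ‖z‖ = R₁ ∨ ‖z‖ = R₂} := frontier_DSet hR₁ hR
  have hIntg : ∀ ψ : EE N → ℝ, ∫ z in D, f z * ψ z = ∫ z in D, (wt z * (|u' z| ^ (p - 1) * u' z - lam * u' z)) * ψ z := fun ψ => by
    refine setIntegral_congr_fun P.hD.measurableSet fun z hz => ?_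
    simp only [hf, Set.indicator_of_mem hz]
  obtain ⟨v, hv, hvu, hv1, hv2⟩ := bdry_reg hN hR₁ hR hu'm hfm
    (M := max M (1 / (2 * R₁) * (M ^ (p - 1) * M + lam * M)))
    (fun z => (hu'b z).trans (le_max_left _ _)) (fun z => (hfb z).trans (le_max_right _ _)) (fun ψ h1 h2 h3 h4 => by
      have := P.veryweak hm'.hW hE' h1 h2 (fun z hz => by
        rw [hfr] at hz
        exact hz.elim (h3 z) (h4 z))
      rw [hIntg]; exact this)
  have hvf : ∀ z ∈ frontier D, v z = 0 := fun z hz => by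
    rw [hfr] at hz
    exact hz.elim (hv1 z) (hv2 z)
  have huv : u' =ᵐ[volume.restrict D] v := by
    rw [Filter.EventuallyEq, ae_restrict_iff' P.hD.measurableSet]
    filter_upwards [hvu] with z hz hz' using (hz hz').symm
  obtain ⟨K, hK⟩ : ∃ K, LipschitzOnWith K v (Metric.closedBall 0 R₂) :=
    hv.contDiffOn.exists_lipschitzOnWith one_ne_zero (convex_closedBall _ _) (isCompact_closedBall _ _)
  have hWv : IsW D v (gradient v) := bdryW P.hD P.hb (hK.mono (by
    rw [closure_DSet hR₁ hR]; intro z hz; simpa using hz.2)) hvf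
  have hmv : IsMinz D wt p lam v (gradient v) :=
    hm'.congr huv ((hm'.hW.congr huv (ae_eq_refl g)).unique P.hD hWv)
  have hEv := P.EL hmv
  have hVW : VW D v (fun z => wt z * (|v z| ^ (p - 1) * v z - lam * v z)) := by
    intro φ h1 h2 h3
    have hz : ∀ z ∉ D, φ z = 0 := fun z hz => image_eq_zero_of_notMem_tsupport fun h => hz (h3 h)
    have hz2 : ∀ z ∉ D, lapE φ z = 0 := fun z hz => by
      rw [lapE_pd]
      refine Finset.sum_eq_zero fun i _ => image_eq_zero_of_notMem_tsupport fun h => hz (h3 (pd_ts _ _ (pd_ts _ _ h)))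
    have := P.veryweak hWv hEv h1 h2 (fun z hz' => hz z (fun h => by
      rw [P.hD.frontier_eq] at hz'; exact hz'.2 h))
    rw [setIntegral_eq_integral_of_forall_compl_eq_zero (fun z h => by rw [hz2 z h, mul_zero]),
      setIntegral_eq_integral_of_forall_compl_eq_zero (fun z h => by rw [hz z h, mul_zero])] at this
    exact this
  have hF : ContDiffOn ℝ 1 (fun z => wt z * (|v z| ^ (p - 1) * v z - lam * v z)) D := by
    have hw : ContDiffOn ℝ 1 wt D := by
      intro z hz
      have hz0 : z ≠ 0 := by
        intro h
        have h1 : R₁ < ‖z‖ := hz.1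
        rw [h, norm_zero] at h1; linarith
      refine ContDiffAt.contDiffWithinAt ?_
      exact contDiffAt_const.div (contDiffAt_const.mul (contDiffAt_norm ℝ hz0)) (by positivity)
    exact hw.mul (((hp_C1 hp).comp hv).sub (contDiff_const.mul hv)).contDiffOn
  obtain ⟨hC2, hpde⟩ := reg3 hN P.hD hv hF hVW
  refine ⟨v, hv, hC2, hvf, fun z hz => ?_, hmv⟩
  rw [hpde z hz]
  simp only [hwt]
  ring

end P15sec


section P16sec
open scoped ENNReal NNReal Topology ContDiff
variable {N : ℕ} {D : Set (EE N)}
variable {wt : EE N → ℝ} {a0 a1 p lam : ℝ}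

lemma Ff_self {B : ℝ} (hB : 0 < B) : Ff p B B = B := by
  simp [Ff, div_self hB.ne']

lemma Prob.Bf_pos_of (P : Prob N D wt a0 a1 p lam) {w : EE N → ℝ} {g : EE N → EE N} (hW : IsW D w g)
    (hc : ContinuousOn w D) {z : EE N} (hz : z ∈ D) (hwz : w z ≠ 0) : 0 < Bf D wt p w := by
  refine P.Bpos hW (not_ae_zero P.hD (U := D ∩ w ⁻¹' {0}ᶜ) (hc.isOpen_inter_preimage P.hD isOpen_compl_singleton)
    ⟨z, hz, hwz⟩ Set.inter_subset_left fun y hy => hy.2)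

lemma Prob.ex_pos (P : Prob N D wt a0 a1 p lam) {w : EE N → ℝ} (h : 0 < Bf D wt p w) : ∃ z ∈ D, w z ≠ 0 := by
  by_contra hcon
  push Not at hcon
  have : Bf D wt p w = 0 := by
    unfold Bf
    refine setIntegral_eq_zero_of_forall_eq_zero fun z hz => ?_
    rw [hcon z hz, abs_zero, Real.zero_rpow (by linarith [P.hp]), mul_zero]
  linarith

lemma lip_pos {S : Set (EE N)} {w : EE N → ℝ} {K : ℝ≥0} (h : LipschitzOnWith K w S) : LipschitzOnWith K (uP w) S := by
  refine LipschitzOnWith.of_dist_le_mul fun x hx y hy => ?_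
  refine le_trans ?_ (h.dist_le_mul x hx y hy)
  simp only [uP, Real.dist_eq]
  exact abs_max_sub_max_le_abs _ _ _

lemma lip_neg {S : Set (EE N)} {w : EE N → ℝ} {K : ℝ≥0} (h : LipschitzOnWith K w S) : LipschitzOnWith K (uM w) S := by
  refine LipschitzOnWith.of_dist_le_mul fun x hx y hy => ?_
  refine le_trans ?_ (h.dist_le_mul x hx y hy)
  simp only [uM, Real.dist_eq]
  refine (abs_max_sub_max_le_abs _ _ _).trans (le_of_eq ?_)
  rw [← abs_neg]; congr 1; ring

lemma Prob.Af_pos_eq (P : Prob N D wt a0 a1 p lam) {w : EE N → ℝ} {K : ℝ≥0} (h : LipschitzOnWith K w (closure D))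
    (h0 : ∀ z ∈ frontier D, w z = 0) :
    Af D wt lam (uP w) (gradient (uP w)) = Af D wt lam (uP w) (gP w (gradient w)) ∧
    Af D wt lam (uM w) (gradient (uM w)) = Af D wt lam (uM w) (gM w (gradient w)) := by
  have := finMeas P.hb
  have hW := bdryW P.hD P.hb h h0
  have hp : IsW D (uP w) (gP w (gradient w)) := hW.pos_part
  have hm : IsW D (uM w) (gM w (gradient w)) := hW.neg_part
  have hp' := bdryW P.hD P.hb (lip_pos h) (fun z hz => by simp [uP, h0 z hz])
  have hm' := bdryW P.hD P.hb (lip_neg h) (fun z hz => by simp [uM, h0 z hz])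
  exact ⟨Af_congr (ae_eq_refl _) (hp'.unique P.hD hp), Af_congr (ae_eq_refl _) (hm'.unique P.hD hm)⟩

lemma nehari_iff (R₁ R₂ : ℝ) (w : EE N → ℝ) : NehariId N R₁ R₂ lam p w ↔
    Af (DSet N R₁ R₂) (fun z => 1 / (2 * ‖z‖)) lam w (gradient w) = Bf (DSet N R₁ R₂) (fun z => 1 / (2 * ‖z‖)) p w := by
  unfold NehariId Af Bf
  simp_rw [norm_gradient', one_div_mul_eq_div]

lemma J_eq {R₁ R₂ : ℝ} (P : Prob N (DSet N R₁ R₂) (fun z => 1 / (2 * ‖z‖)) a0 a1 p lam) {w : EE N → ℝ}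
    (hW : IsW (DSet N R₁ R₂) w (gradient w)) : Jfun N R₁ R₂ lam p w =
    Af (DSet N R₁ R₂) (fun z => 1 / (2 * ‖z‖)) lam w (gradient w) / 2 - Bf (DSet N R₁ R₂) (fun z => 1 / (2 * ‖z‖)) p w / (p + 1) := by
  have hp : p + 1 ≠ 0 := by linarith [P.hp]
  have i1 := Prob.ig hW
  have i2 := P.wint (Prob.i2 hW)
  have i3 := P.wint (P.iq hW)
  have := int_add3 (i1.const_mul (1 / 2)) i2 i3 (lam / 2) (-(1 / (p + 1)))
  unfold Jfun Af Bf
  rw [integral_const_mul] at this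
  have e : ∀ z : EE N, ‖fderiv ℝ w z‖ ^ 2 / 2 + lam * w z ^ 2 / (4 * ‖z‖) - |w z| ^ (p + 1) / (2 * (p + 1) * ‖z‖) =
     1 / 2 * ‖gradient w z‖ ^ 2 + lam / 2 * (1 / (2 * ‖z‖) * w z ^ 2) + -(1 / (p + 1)) * (1 / (2 * ‖z‖) * |w z| ^ (p + 1)) := fun z => by
    rw [norm_gradient']
    by_cases hz : ‖z‖ = 0
    · rw [hz]; simp; ring
    · field_simp; ring
  simp_rw [e]
  rw [← this]; ring

lemma J_nodal {R₁ R₂ : ℝ} (P : Prob N (DSet N R₁ R₂) (fun z => 1 / (2 * ‖z‖)) a0 a1 p lam) {w : EE N → ℝ}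
    (hW : IsW (DSet N R₁ R₂) w (gradient w))
    (h1 : Af (DSet N R₁ R₂) (fun z => 1 / (2 * ‖z‖)) lam (uP w) (gP w (gradient w)) = Bf (DSet N R₁ R₂) (fun z => 1 / (2 * ‖z‖)) p (uP w))
    (h2 : Af (DSet N R₁ R₂) (fun z => 1 / (2 * ‖z‖)) lam (uM w) (gM w (gradient w)) = Bf (DSet N R₁ R₂) (fun z => 1 / (2 * ‖z‖)) p (uM w)) :
    Jfun N R₁ R₂ lam p w = (1 / 2 - 1 / (p + 1)) *
      (Bf (DSet N R₁ R₂) (fun z => 1 / (2 * ‖z‖)) p (uP w) + Bf (DSet N R₁ R₂) (fun z => 1 / (2 * ‖z‖)) p (uM w)) := by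
  rw [J_eq P hW, ← P.A_split hW, ← P.B_split hW, h1, h2]
  ring

/-- components of the nonvanishing set -/
def Om (D : Set (EE N)) (v : EE N → ℝ) : Set (EE N) := {z | z ∈ D ∧ v z ≠ 0}

lemma Om_open (hD : IsOpen D) {v : EE N → ℝ} (hv : Continuous v) : IsOpen (Om D v) :=
  hD.inter (isOpen_compl_singleton.preimage hv)

lemma cc_frontier (hD : IsOpen D) {v : EE N → ℝ} (hv : Continuous v) (h0 : ∀ z ∈ frontier D, v z = 0) (x : EE N) :
    ∀ q ∈ frontier (connectedComponentIn (Om D v) x), v q = 0 := by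
  intro q hq
  have hO := Om_open hD hv
  have hC : IsOpen (connectedComponentIn (Om D v) x) := hO.connectedComponentIn
  rw [hC.frontier_eq] at hq
  by_contra hvq
  have hqD : q ∈ D := by
    by_contra hqD
    refine hvq (h0 q ?_)
    rw [hD.frontier_eq]
    exact ⟨closure_mono (fun y hy => (connectedComponentIn_subset _ _ hy).1) hq.1, hqD⟩
  have hqO : q ∈ Om D v := ⟨hqD, hvq⟩
  obtain ⟨y, hy1, hy2⟩ := mem_closure_iff.1 hq.1 _ (hO.connectedComponentIn (x := q)) (mem_connectedComponentIn hqO)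
  have e := (connectedComponentIn_eq hy1).trans (connectedComponentIn_eq hy2).symm
  exact hq.2 (e ▸ mem_connectedComponentIn hqO)

lemma cc_sign {v : EE N → ℝ} (hv : Continuous v) {x y z : EE N} (hy : y ∈ connectedComponentIn (Om D v) x)
    (hz : z ∈ connectedComponentIn (Om D v) x) (h : 0 < v y) : 0 < v z := by
  by_contra hcon
  obtain ⟨q, hq, hq0⟩ := (isPreconnected_connectedComponentIn (F := Om D v) (x := x)).intermediate_value hz hy hv.continuousOn
    ⟨not_lt.1 hcon, h.le⟩
  exact (connectedComponentIn_subset _ _ hq).2 hq0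

lemma cc_W (P : Prob N D wt a0 a1 p lam) {v : EE N → ℝ} (hv : Continuous v) {K : ℝ≥0}
    (hK : LipschitzOnWith K v (closure D)) (h0 : ∀ z ∈ frontier D, v z = 0) (x : EE N) :
    IsW D ((connectedComponentIn (Om D v) x).indicator v) ((connectedComponentIn (Om D v) x).indicator (gradient v)) := by
  have := finMeas P.hb
  have hO := Om_open P.hD hv
  have hC : IsOpen (connectedComponentIn (Om D v) x) := hO.connectedComponentIn
  have hCD : connectedComponentIn (Om D v) x ⊆ D := fun y hy => (connectedComponentIn_subset _ _ hy).1
  have hCO : ∀ y ∈ connectedComponentIn (Om D v) x, v y ≠ 0 := fun y hy => (connectedComponentIn_subset _ _ hy).2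
  have hfr := cc_frontier P.hD hv h0 x
  set C := connectedComponentIn (Om D v) x
  have hl : LipschitzWith K (C.indicator v) := ext_lip (hK.mono (closure_mono hCD)) hfr
  have hW := lipW P.hD P.hb hl (fun y hy => Set.indicator_of_notMem (fun h => hy (hCD h)) _)
  refine hW.congr (ae_eq_refl _) ?_
  filter_upwards [hW.grad_zero P.hD] with z hz
  by_cases hzC : z ∈ C
  · rw [Set.indicator_of_mem hzC]
    exact gradient_ev hC (fun y hy => by simp [hy]) hzC
  · rw [Set.indicator_of_notMem hzC]
    exact hz (Set.indicator_of_notMem hzC _)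

lemma cc_nehari {v : EE N → ℝ} {g : EE N → EE N} (P : Prob N D wt a0 a1 p lam) (hE : WeakEq D wt p lam v g) (C : Set (EE N))
    (hW : IsW D (C.indicator v) (C.indicator g)) : Af D wt lam (C.indicator v) (C.indicator g) = Bf D wt p (C.indicator v) := by
  have := hE _ _ hW
  have hp := P.hp
  have e1 : ∀ z, ‖C.indicator g z‖ ^ 2 = inner ℝ (g z) (C.indicator g z) := fun z => by
    by_cases hz : z ∈ C <;> simp [hz]
  have e2 : ∀ z, wt z * C.indicator v z ^ 2 = wt z * (v z * C.indicator v z) := fun z => by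
    by_cases hz : z ∈ C
    · simp only [Set.indicator_of_mem hz]; ring
    · simp [hz]
  have e3 : ∀ z, wt z * |C.indicator v z| ^ (p + 1) = wt z * (|v z| ^ (p - 1) * v z * C.indicator v z) := fun z => by
    by_cases hz : z ∈ C
    · simp only [Set.indicator_of_mem hz]
      congr 1
      rw [mul_assoc, ← abs_mul_abs_self (v z), ← mul_assoc]
      by_cases h : v z = 0
      · simp [h, Real.zero_rpow (by linarith : p + 1 ≠ 0)]
      · have h' : |v z| ≠ 0 := abs_ne_zero.2 h
        rw [← Real.rpow_add_one h', ← Real.rpow_add_one h']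
        congr 1; ring
    · simp [hz, Real.zero_rpow (by linarith : p + 1 ≠ 0)]
  unfold Af Bf
  simp_rw [e1, e2, e3]
  exact this

lemma cc_B_pos {v : EE N → ℝ} {g : EE N → EE N} (P : Prob N D wt a0 a1 p lam) {C : Set (EE N)} (hC : IsOpen C) (hne : C.Nonempty)
    (hCO : C ⊆ Om D v) (hW : IsW D (C.indicator v) (C.indicator g)) : 0 < Bf D wt p (C.indicator v) :=
  P.Bpos hW (not_ae_zero P.hD hC hne (fun y hy => (hCO hy).1) (fun y hy => by
    rw [Set.indicator_of_mem hy]; exact (hCO hy).2))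

lemma cc_disj {O : Set (EE N)} {x y : EE N} (h : connectedComponentIn O x ≠ connectedComponentIn O y) {z : EE N}
    (hz : z ∈ connectedComponentIn O x) : z ∉ connectedComponentIn O y := fun hz' =>
  h ((connectedComponentIn_eq hz).trans (connectedComponentIn_eq hz').symm)

lemma two_comp (P : Prob N D wt a0 a1 p lam) {v : EE N → ℝ} (hv : Continuous v) {K : ℝ≥0}
    (hK : LipschitzOnWith K v (closure D)) (h0 : ∀ z ∈ frontier D, v z = 0)
    (hm : IsMinz D wt p lam v (gradient v)) {x y z : EE N} (hx : x ∈ Om D v) (hy : y ∈ Om D v) (hz : z ∈ Om D v)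
    (hvx : 0 < v x) (hvy : v y < 0) (h1 : connectedComponentIn (Om D v) z ≠ connectedComponentIn (Om D v) x)
    (h2 : connectedComponentIn (Om D v) z ≠ connectedComponentIn (Om D v) y) : False := by
  have hp := P.hp
  have hE := P.EL hm
  have hO := Om_open P.hD hv
  have o : ∀ q, IsOpen (connectedComponentIn (Om D v) q) := fun q => hO.connectedComponentIn
  have W := cc_W P hv hK h0
  have A := fun q => cc_nehari P hE _ (W q)
  have B := fun q (hq : q ∈ Om D v) => cc_B_pos P (o q) ⟨q, mem_connectedComponentIn hq⟩ (connectedComponentIn_subset _ _) (W q)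
  have sx : ∀ q ∈ connectedComponentIn (Om D v) x, 0 < v q := fun q hq => cc_sign hv (mem_connectedComponentIn hx) hq hvx
  have sy : ∀ q ∈ connectedComponentIn (Om D v) y, v q < 0 := fun q hq => by
    by_contra hcon
    have h3 : 0 < v q := lt_of_le_of_ne (not_lt.1 hcon) (connectedComponentIn_subset _ _ hq).2.symm
    have := cc_sign hv hq (mem_connectedComponentIn hy) h3
    linarith
  have d1 := fun q => cc_disj h1 (z := q)
  have d2 := fun q => cc_disj h2 (z := q)
  have hw := (W x).add (W y)
  have Ax := A x
  have Ay := A y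
  have Bx := B x hx
  have By := B y hy
  have Bz := B z hz
  have Wx := W x
  have Wy := W y
  have Wz := W z
  clear A B W
  generalize connectedComponentIn (Om D v) x = C1 at *
  generalize connectedComponentIn (Om D v) y = C2 at *
  generalize connectedComponentIn (Om D v) z = C3 at *
  have d3 : ∀ q ∈ C1, q ∉ C2 := fun q hq hq' => by linarith [sx q hq, sy q hq']
  have e1 : uP (C1.indicator v + C2.indicator v) = C1.indicator v := by
    ext q
    by_cases q1 : q ∈ C1
    · simp [uP, q1, d3 q q1, (sx q q1).le]
    · by_cases q2 : q ∈ C2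
      · simp [uP, q1, q2, (sy q q2).le]
      · simp [uP, q1, q2]
  have e2 : gP (C1.indicator v + C2.indicator v) (C1.indicator (gradient v) + C2.indicator (gradient v)) = C1.indicator (gradient v) := by
    ext1 q
    by_cases q1 : q ∈ C1
    · simp [gP, q1, d3 q q1, sx q q1]
    · by_cases q2 : q ∈ C2
      · simp [gP, q1, q2, (sy q q2).le]
      · simp [gP, q1, q2]
  have e3 : uM (C1.indicator v + C2.indicator v) = -C2.indicator v := by
    ext q
    by_cases q1 : q ∈ C1
    · simp [uM, q1, d3 q q1, (sx q q1).le]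
    · by_cases q2 : q ∈ C2
      · simp [uM, q1, q2, (sy q q2).le]
      · simp [uM, q1, q2]
  have e4 : gM (C1.indicator v + C2.indicator v) (C1.indicator (gradient v) + C2.indicator (gradient v)) = -C2.indicator (gradient v) := by
    ext1 q
    by_cases q1 : q ∈ C1
    · simp [gM, q1, d3 q q1, (sx q q1).le]
    · by_cases q2 : q ∈ C2
      · simp [gM, q1, q2, (sy q q2)]
      · simp [gM, q1, q2]
  have n1 : Af D wt lam (-C2.indicator v) (-C2.indicator (gradient v)) = Af D wt lam (C2.indicator v) (C2.indicator (gradient v)) := by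
    simp [Af]
  have n2 : Bf D wt p (-C2.indicator v) = Bf D wt p (C2.indicator v) := by simp [Bf]
  have hmin := hm.hmin _ _ hw
  rw [e1, e2, e3, e4, n1, n2, Ax, Ay, Ff_self Bx, Ff_self By] at hmin
  have hmin := hmin Bx By
  rw [P.B_split hm.hW] at hmin
  have i1 := P.wint (P.iq Wx)
  have i2 := P.wint (P.iq Wy)
  have i3 := P.wint (P.iq Wz)
  have i4 := P.wint (P.iq hm.hW)
  have hle : Bf D wt p (C1.indicator v) + Bf D wt p (C2.indicator v) + Bf D wt p (C3.indicator v) ≤ Bf D wt p v := by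
    have := int_add3 i1 i2 i3 1 1
    simp only [one_mul] at this
    unfold Bf
    rw [this]
    refine setIntegral_mono_on (by exact (i1.add i2).add i3) i4 P.hD.measurableSet fun q hq => ?_
    have hw0 : 0 ≤ wt q := P.ha0.le.trans (P.hw0 q hq)
    have hz0 : (0:ℝ) ^ (p + 1) = 0 := Real.zero_rpow (by linarith)
    have hnn : 0 ≤ wt q * |v q| ^ (p + 1) := by positivity
    by_cases q1 : q ∈ C1
    · have q2 := d3 q q1
      have q3 : q ∉ C3 := fun h => d1 q h q1
      simp [q1, q2, q3, hz0]
    · by_cases q2 : q ∈ C2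
      · have q3 : q ∉ C3 := fun h => d2 q h q2
        simp [q1, q2, q3, hz0]
      · by_cases q3 : q ∈ C3
        · simp [q1, q2, q3, hz0]
        · simpa [q1, q2, q3, hz0] using hnn
  linarith

end P16sec

theorem stmt_9 (N : ℕ) (hN : 3 ≤ N) (R₁ R₂ : ℝ) (hR₁ : 0 < R₁) (hR : R₁ < R₂)
    (p lam : ℝ) (hp : 1 < p) (hp' : p < ((N : ℝ) + 2) / ((N : ℝ) - 2)) (hlam : 0 < lam) :
    ∃ v : EuclideanSpace ℝ (Fin N) → ℝ,
      ContDiffOn ℝ 2 v (DSet N R₁ R₂) ∧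
      ContDiffOn ℝ 1 v (closure (DSet N R₁ R₂)) ∧
      (∀ z ∈ frontier (DSet N R₁ R₂), v z = 0) ∧
      (∀ z ∈ DSet N R₁ R₂, -lapE v z = (|v z| ^ (p - 1) * v z - lam * v z) / (2 * ‖z‖)) ∧
      v ∈ NodalNehari N R₁ R₂ lam p ∧
      (∀ w ∈ NodalNehari N R₁ R₂ lam p, Jfun N R₁ R₂ lam p v ≤ Jfun N R₁ R₂ lam p w) ∧
      Set.ncard {C : Set (EuclideanSpace ℝ (Fin N)) |
        ∃ z ∈ {z | z ∈ DSet N R₁ R₂ ∧ v z ≠ 0},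
          C = connectedComponentIn {z | z ∈ DSet N R₁ R₂ ∧ v z ≠ 0} z} = 2 := by
  obtain ⟨v, hv, hv2, hv0, hpde, hm⟩ := exists_sol hN hR₁ hR hp hp' hlam
  have P := prob_DSet hN hR₁ hR hp hp' hlam
  obtain ⟨K, hK⟩ : ∃ K, LipschitzOnWith K v (closure (DSet N R₁ R₂)) := by
    obtain ⟨K, hK⟩ : ∃ K, LipschitzOnWith K v (Metric.closedBall 0 R₂) :=
      hv.contDiffOn.exists_lipschitzOnWith one_ne_zero (convex_closedBall _ _) (isCompact_closedBall _ _)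
    exact ⟨K, hK.mono (by rw [closure_DSet hR₁ hR]; intro z hz; simpa using hz.2)⟩
  obtain ⟨x, hxD, hx⟩ := P.ex_pos hm.hBp
  obtain ⟨y, hyD, hy⟩ := P.ex_pos hm.hBm
  replace hx : 0 < v x := by simp only [uP] at hx; grind
  replace hy : v y < 0 := by simp only [uM] at hy; grind
  refine ⟨v, hv2, hv.contDiffOn, hv0, hpde, ⟨⟨K, hK⟩, hv0, ⟨x, subset_closure hxD, hx⟩, ⟨y, subset_closure hyD, hy⟩, ?_, ?_⟩, ?_, ?_⟩
  · rw [nehari_iff]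
    exact (P.Af_pos_eq hK hv0).1.trans hm.hAp
  · rw [nehari_iff]
    exact (P.Af_pos_eq hK hv0).2.trans hm.hAm
  · rintro w ⟨⟨K', hK'⟩, hw0, ⟨a, haD, ha⟩, ⟨b, hbD, hb⟩, h1, h2⟩
    have := finMeas P.hb
    rw [nehari_iff] at h1 h2
    have hin : ∀ z ∈ closure (DSet N R₁ R₂), w z ≠ 0 → z ∈ DSet N R₁ R₂ := fun z hz hwz => by
      by_contra hzD
      exact hwz (hw0 z (by rw [P.hD.frontier_eq]; exact ⟨hz, hzD⟩))
    have hW := bdryW P.hD P.hb hK' hw0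
    have hWp : IsW (DSet N R₁ R₂) (uP w) (gP w (gradient w)) := hW.pos_part
    have hWm : IsW (DSet N R₁ R₂) (uM w) (gM w (gradient w)) := hW.neg_part
    have Bp := P.Bf_pos_of hWp ((lip_pos hK').continuousOn.mono subset_closure) (hin a haD ha.ne') (by simp only [uP]; grind)
    have Bm := P.Bf_pos_of hWm ((lip_neg hK').continuousOn.mono subset_closure) (hin b hbD hb.ne) (by simp only [uM]; grind)
    have h1' := (P.Af_pos_eq hK' hw0).1.symm.trans h1
    have h2' := (P.Af_pos_eq hK' hw0).2.symm.trans h2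
    have hmin := hm.hmin w _ hW Bp Bm
    change Af _ _ _ (uP w) _ = Bf _ _ _ (uP w) at h1'
    change Af _ _ _ (uM w) _ = Bf _ _ _ (uM w) at h2'
    rw [h1', h2', Ff_self Bp, Ff_self Bm] at hmin
    rw [J_nodal P hm.hW hm.hAp hm.hAm, J_nodal P hW h1' h2']
    refine mul_le_mul_of_nonneg_left hmin ?_
    rw [sub_nonneg]
    exact one_div_le_one_div_of_le two_pos (by linarith)
  · have hxO : x ∈ Om (DSet N R₁ R₂) v := ⟨hxD, hx.ne'⟩
    have hyO : y ∈ Om (DSet N R₁ R₂) v := ⟨hyD, hy.ne⟩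
    have hne : connectedComponentIn (Om (DSet N R₁ R₂) v) x ≠ connectedComponentIn (Om (DSet N R₁ R₂) v) y := by
      intro h
      have h3 : y ∈ connectedComponentIn (Om (DSet N R₁ R₂) v) x := h ▸ mem_connectedComponentIn hyO
      have := cc_sign hv.continuous (mem_connectedComponentIn hxO) h3 hx
      linarith
    have hS : {C : Set (EE N) | ∃ z ∈ Om (DSet N R₁ R₂) v, C = connectedComponentIn (Om (DSet N R₁ R₂) v) z} =
        {connectedComponentIn (Om (DSet N R₁ R₂) v) x, connectedComponentIn (Om (DSet N R₁ R₂) v) y} := by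
      ext C
      constructor
      · rintro ⟨z, hz, rfl⟩
        by_contra hcon
        simp only [Set.mem_insert_iff, Set.mem_singleton_iff, not_or] at hcon
        exact two_comp P hv.continuous hK hv0 hm hxO hyO hz hx hy hcon.1 hcon.2
      · rintro (h | h)
        · exact ⟨x, hxO, h⟩
        · exact ⟨y, hyO, h⟩
    change Set.ncard {C : Set (EE N) | ∃ z ∈ Om (DSet N R₁ R₂) v, C = connectedComponentIn (Om (DSet N R₁ R₂) v) z} = 2
    rw [hS, Set.ncard_pair hne]
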